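/- Assume that for every prime p ≡ −1 (mod 16) one has 4 ∥ h_K if and only if (p) = −1, where K = ℚ(⁴√p). Then the limit as X → ∞ of #{p ≤ X : p prime, p ≡ −1 (mod 16), 4 ∥ h_K} / #{p ≤ X : p prime, p ≡ −1 (mod 16)} equals 1/2. -/

import Mathlib

namespace QSpin

/-- reciprocity sign -/
def rho (x y : ℤ) : ℤ := if x % 4 = 3 ∧ y % 4 = 3 then -1 else 1

lemma chi4_nat_eq (u : ℕ) (hu : u % 2 = 1) : ZMod.χ₄ (u : ZMod 4) = if u % 4 = 3 then -1 else 1 := by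
  rw [ZMod.χ₄_nat_eq_if_mod_four]
  split_ifs <;> omega

lemma jac_recip (V U : ℤ) (hV : V % 2 = 1) (hU : U % 2 = 1) (hU0 : 0 < U) :
    jacobiSym V U.natAbs = rho V U * jacobiSym U V.natAbs := by
  obtain ⟨u, rfl⟩ := Int.eq_ofNat_of_zero_le hU0.le
  have hu : u % 2 = 1 := by omega
  rcases Int.natAbs_eq V with h | h
  · set v := V.natAbs with hv
    have hv2 : v % 2 = 1 := by omega
    rw [h]
    simp only [Int.natAbs_natCast]
    rw [jacobiSym.quadratic_reciprocity_if hv2 hu |>.symm]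
    unfold rho
    split_ifs <;> omega
  · set v := V.natAbs with hv
    have hv2 : v % 2 = 1 := by omega
    rw [h]
    simp only [Int.natAbs_natCast]
    rw [jacobiSym.neg _ (Nat.odd_iff.mpr hu), jacobiSym.quadratic_reciprocity_if hv2 hu |>.symm,
      chi4_nat_eq u hu]
    unfold rho
    split_ifs <;> omega

lemma rho_eq_one_left {x y : ℤ} (h : x % 4 = 1) : rho x y = 1 := by
  unfold rho; rw [if_neg]; omega

lemma rho_mul_left {x x' y : ℤ} (hx : x % 2 = 1) (hx' : x' % 2 = 1) :
    rho (x * x') y = rho x y * rho x' y := by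
  have h1 : x % 4 = 1 ∨ x % 4 = 3 := by omega
  have h2 : x' % 4 = 1 ∨ x' % 4 = 3 := by omega
  unfold rho
  rcases h1 with h1 | h1 <;> rcases h2 with h2 | h2 <;> simp [Int.mul_emod, h1, h2]
  all_goals split_ifs <;> simp

lemma rho_symm (x y : ℤ) : rho x y = rho y x := by
  unfold rho; simp only [and_comm]

lemma rho_mul_right {x x' y : ℤ} (hx : x % 2 = 1) (hx' : x' % 2 = 1) :
    rho y (x * x') = rho y x * rho y x' := by
  rw [rho_symm, rho_mul_left hx hx', rho_symm y, rho_symm y]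

lemma rho_sq (x y : ℤ) : rho x y * rho x y = 1 := by
  unfold rho; split_ifs <;> norm_num

lemma rho_self (x : ℤ) : rho x x = rho (-1) x := by
  unfold rho; norm_num

lemma jac_mul_right (a b c : ℤ) (hb : b ≠ 0) (hc : c ≠ 0) :
    jacobiSym a (b * c).natAbs = jacobiSym a b.natAbs * jacobiSym a c.natAbs := by
  rw [Int.natAbs_mul, jacobiSym.mul_right']
  · simpa using hb
  · simpa using hc

lemma jac_mod {a a' b : ℤ} (h : b ∣ a - a') : jacobiSym a b.natAbs = jacobiSym a' b.natAbs := by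
  apply jacobiSym.mod_left'
  rw [Int.emod_eq_emod_iff_emod_sub_eq_zero]
  apply Int.emod_eq_zero_of_dvd
  exact Int.natAbs_dvd.mpr h

lemma jac_neg_one {U : ℤ} (hU : U % 2 = 1) (hU0 : 0 < U) : jacobiSym (-1) U.natAbs = rho (-1) U := by
  have := jac_recip (-1) U (by norm_num) hU hU0
  simpa using this

lemma jac_sq_one {a b : ℤ} (h : IsCoprime a b) : jacobiSym a b.natAbs * jacobiSym a b.natAbs = 1 := by
  have := jacobiSym.sq_one (a := a) (b := b.natAbs) (by
    have h2 : a.gcd (b.natAbs : ℤ) = a.gcd b := by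
      unfold Int.gcd; rw [Int.natAbs_natCast]
    rw [h2]
    exact Int.isCoprime_iff_gcd_eq_one.mp h)
  rw [← this]; ring

lemma core (a b c d : ℤ) (ha : a % 2 = 1) (hb : b % 2 = 1) (hc : c % 2 = 1) (hd : d % 2 = 0)
    (hc0 : 0 < c) (hcd : IsCoprime c d) (hU : 0 < a * c + 2 * b * d) :
    jacobiSym (a * d + b * c) (a * c + 2 * b * d).natAbs =
      rho b c * rho c (a * c + 2 * b * d) * rho b (a * c + 2 * b * d) *
      (jacobiSym a b.natAbs * jacobiSym (2 * d) c.natAbs *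
        jacobiSym (a * c + 2 * b * d) (c ^ 2 - 2 * d ^ 2).natAbs) := by
  set g : ℤ := (Int.gcd b c : ℤ) with hg
  have hg0 : 0 < g := by
    have : 0 < Int.gcd b c := Int.gcd_pos_of_ne_zero_right _ hc0.ne'
    rw [hg]; exact_mod_cast this
  obtain ⟨b', hb'⟩ : g ∣ b := Int.gcd_dvd_left ..
  obtain ⟨c', hc'⟩ : g ∣ c := Int.gcd_dvd_right ..
  have hcop : IsCoprime b' c' := by
    have h1 : (Int.gcd b c : ℤ) = b * Int.gcdA b c + c * Int.gcdB b c := Int.gcd_eq_gcd_ab b c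
    refine ⟨Int.gcdA b c, Int.gcdB b c, ?_⟩
    have h2 : g * (Int.gcdA b c * b' + Int.gcdB b c * c') = g * 1 := by
      calc g * (Int.gcdA b c * b' + Int.gcdB b c * c')
          = (g * b') * Int.gcdA b c + (g * c') * Int.gcdB b c := by ring
        _ = b * Int.gcdA b c + c * Int.gcdB b c := by rw [← hb', ← hc']
        _ = g * 1 := by rw [← h1, mul_one]
    exact mul_left_cancel₀ hg0.ne' h2
  have hc'0 : 0 < c' := by
    by_contra h; push Not at h
    nlinarith
  have hgo : g % 2 = 1 := by
    rcases Int.emod_two_eq_zero_or_one g with h | h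
    · rw [hc', Int.mul_emod, h] at hc; simp at hc
    · exact h
  have hb'o : b' % 2 = 1 := by
    rcases Int.emod_two_eq_zero_or_one b' with h | h
    · rw [hb', Int.mul_emod, h] at hb; simp at hb
    · exact h
  have hc'o : c' % 2 = 1 := by
    rcases Int.emod_two_eq_zero_or_one c' with h | h
    · rw [hc', Int.mul_emod, h] at hc; simp at hc
    · exact h
  set U' : ℤ := a * c' + 2 * b' * d with hU'
  have hUU : a * c + 2 * b * d = g * U' := by rw [hU', hc', hb']; ring
  have hU'0 : 0 < U' := by
    rw [hUU] at hU
    by_contra h; push Not at h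
    nlinarith
  have hU'o : U' % 2 = 1 := by
    have : (a * c') % 2 = 1 := by rw [Int.mul_emod, ha, hc'o]; rfl
    rw [hU', mul_assoc]; omega
  set n : ℤ := c ^ 2 - 2 * d ^ 2 with hnn
  set V : ℤ := a * d + b * c with hVV
  have hn4 : n % 4 = 1 := by
    obtain ⟨c1, hc1⟩ : ∃ k, c = 2 * k + 1 := ⟨c / 2, by omega⟩
    obtain ⟨d1, hd1⟩ : ∃ k, d = 2 * k := ⟨d / 2, by omega⟩
    have : n = 4 * (c1 ^ 2 + c1 - 2 * d1 ^ 2) + 1 := by rw [hnn, hc1, hd1]; ring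
    omega
  have hno : n % 2 = 1 := by omega
  have hgd : IsCoprime g d := by rw [hc'] at hcd; exact hcd.of_mul_left_left
  have hc'd : IsCoprime c' d := by rw [hc'] at hcd; exact hcd.of_mul_left_right
  have hg2 : IsCoprime g 2 := by
    refine ⟨1, -(g / 2), ?_⟩; omega
  have hc'2 : IsCoprime c' 2 := by
    refine ⟨1, -(c' / 2), ?_⟩; omega
  -- pieces
  have e1 : jacobiSym V (a * c + 2 * b * d).natAbs = jacobiSym V g.natAbs * jacobiSym V U'.natAbs := by
    rw [hUU, jac_mul_right _ _ _ hg0.ne' hU'0.ne']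
  have e2 : jacobiSym V g.natAbs = jacobiSym a g.natAbs * jacobiSym d g.natAbs := by
    rw [← jacobiSym.mul_left]
    apply jac_mod
    rw [hVV, hc']; exact ⟨b * c', by ring⟩
  have e3 : jacobiSym c' U'.natAbs * jacobiSym V U'.natAbs =
      jacobiSym b' U'.natAbs * jacobiSym n U'.natAbs := by
    rw [← jacobiSym.mul_left, ← jacobiSym.mul_left]
    apply jac_mod
    refine ⟨d, ?_⟩
    rw [hVV, hnn, hU', hb', hc']; ring
  have hcU : IsCoprime c' U' := by
    have : IsCoprime c' (2 * b' * d) := (hc'2.mul_right hcop.symm).mul_right hc'd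
    rw [hU', add_comm]
    exact this.add_mul_right_right a
  have e4 : jacobiSym c' U'.natAbs * jacobiSym c' U'.natAbs = 1 := jac_sq_one hcU
  have e5 : jacobiSym c' U'.natAbs = rho c' U' * (jacobiSym b' c'.natAbs * jacobiSym (2 * d) c'.natAbs) := by
    rw [jac_recip _ _ hc'o hU'o hU'0, ← jacobiSym.mul_left]
    congr 1
    apply jac_mod
    rw [hU']; exact ⟨a, by ring⟩
  have e6 : jacobiSym b' U'.natAbs = rho b' U' * (jacobiSym a b'.natAbs * jacobiSym c' b'.natAbs) := by
    rw [jac_recip _ _ hb'o hU'o hU'0, ← jacobiSym.mul_left]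
    congr 1
    apply jac_mod
    rw [hU']; exact ⟨2 * d, by ring⟩
  have e7 : jacobiSym b' c'.natAbs = rho b' c' * jacobiSym c' b'.natAbs :=
    jac_recip _ _ hb'o hc'o hc'0
  have e8 : jacobiSym n U'.natAbs = jacobiSym U' n.natAbs := by
    rw [jac_recip _ _ hno hU'o hU'0, rho_eq_one_left hn4, one_mul]
  have e9 : jacobiSym (g * U') n.natAbs = jacobiSym g n.natAbs * jacobiSym U' n.natAbs :=
    jacobiSym.mul_left _ _ _
  have e10 : jacobiSym g n.natAbs = rho (-1) g * jacobiSym 2 g.natAbs := by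
    have h1 : jacobiSym n g.natAbs = rho n g * jacobiSym g n.natAbs := jac_recip _ _ hno hgo hg0
    rw [rho_eq_one_left hn4, one_mul] at h1
    rw [← h1]
    have h2 : jacobiSym n g.natAbs = jacobiSym (-1 * 2 * (d * d)) g.natAbs := by
      apply jac_mod; refine ⟨g * c' ^ 2, ?_⟩; rw [hnn, hc']; ring
    rw [h2, jacobiSym.mul_left, jacobiSym.mul_left, jacobiSym.mul_left d d, jac_sq_one hgd.symm,
      jac_neg_one hgo hg0, mul_one]
  have e11 : jacobiSym a b.natAbs = jacobiSym a g.natAbs * jacobiSym a b'.natAbs := by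
    rw [hb', jac_mul_right _ _ _ hg0.ne' (by rintro rfl; simp at hb'o)]
  have e12 : jacobiSym (2 * d) c.natAbs = jacobiSym 2 g.natAbs * jacobiSym d g.natAbs * jacobiSym (2 * d) c'.natAbs := by
    rw [hc', jac_mul_right _ _ _ hg0.ne' hc'0.ne', jacobiSym.mul_left 2 d g.natAbs]
  have e13 : jacobiSym 2 g.natAbs * jacobiSym 2 g.natAbs = 1 := jac_sq_one hg2.symm
  have e14 : jacobiSym c' b'.natAbs * jacobiSym c' b'.natAbs = 1 := jac_sq_one hcop.symm
  have e15 : jacobiSym (2 * d) c'.natAbs * jacobiSym (2 * d) c'.natAbs = 1 :=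
    jac_sq_one (hc'2.mul_right hc'd).symm
  have e16 : jacobiSym g n.natAbs * jacobiSym g n.natAbs = 1 := by
    apply jac_sq_one
    have : IsCoprime g (2 * d ^ 2) := hg2.mul_right (hgd.pow_right)
    rw [hnn, hc']
    have h3 := this.neg_right.add_mul_left_right (g * c' ^ 2)
    have h4 : (g * c') ^ 2 - 2 * d ^ 2 = -(2 * d ^ 2) + g * (g * c' ^ 2) := by ring
    rw [h4]; exact h3
  have r1 : rho b c = rho g g * rho g c' * rho b' g * rho b' c' := by
    rw [hb', hc', rho_mul_left hgo hb'o, rho_mul_right hgo hc'o, rho_mul_right hgo hc'o]; ring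
  have r2 : rho c (g * U') = rho g g * rho g U' * rho c' g * rho c' U' := by
    rw [hc', rho_mul_left hgo hc'o, rho_mul_right hgo hU'o, rho_mul_right hgo hU'o]; ring
  have r3 : rho b (g * U') = rho g g * rho g U' * rho b' g * rho b' U' := by
    rw [hb', rho_mul_left hgo hb'o, rho_mul_right hgo hU'o, rho_mul_right hgo hU'o]; ring
  -- final
  have f1 : jacobiSym V U'.natAbs =
      jacobiSym c' U'.natAbs * (jacobiSym b' U'.natAbs * jacobiSym n U'.natAbs) := by
    rw [← e3, ← mul_assoc, e4, one_mul]
  have f2 : jacobiSym U' n.natAbs = jacobiSym g n.natAbs * jacobiSym (g * U') n.natAbs := by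
    rw [e9, ← mul_assoc, e16, one_mul]
  rw [e1, e2, f1, e5, e6, e7, e8, f2, e11, e12, hUU, r1, r2, r3, e10, rho_symm c' g, rho_symm b' g, rho_self g]
  have q1 := rho_sq (-1) g
  have q2 := rho_sq g c'
  have q3 := rho_sq g b'
  have q4 := rho_sq g U'
  generalize jacobiSym a g.natAbs = x1 at *
  generalize jacobiSym d g.natAbs = x2 at *
  generalize jacobiSym c' b'.natAbs = x3 at *
  generalize jacobiSym (2*d) c'.natAbs = x4 at *
  generalize jacobiSym a b'.natAbs = x5 at *
  generalize jacobiSym (g*U') n.natAbs = x6 at *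
  generalize jacobiSym 2 g.natAbs = x7 at *
  generalize rho (-1) g = y1 at *
  generalize rho g c' = y2 at *
  generalize rho g b' = y3 at *
  generalize rho g U' = y4 at *
  clear e1 e2 e3 e4 e5 e6 e7 e8 e9 e10 e11 e12 e15 e16 f1 f2 r1 r2 r3
  have L : x1 * x2 * (rho c' U' * (rho b' c' * x3 * x4) * (rho b' U' * (x5 * x3) * (y1 * x7 * x6)))
     = (x1 * x2 * rho c' U' * rho b' c' * x4 * rho b' U' * x5 * y1 * x7 * x6) * (x3 * x3) := by ring
  have Rr : y1 * y2 * y3 * rho b' c' * (y1 * y4 * y2 * rho c' U') * (y1 * y4 * y3 * rho b' U') *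
    (x1 * x5 * (x7 * x2 * x4) * x6) = (x1 * x2 * rho c' U' * rho b' c' * x4 * rho b' U' * x5 * y1 * x7 * x6)
     * (y1 * y1) * (y2 * y2) * (y3 * y3) * (y4 * y4) := by ring
  rw [L, Rr, e14, q1, q2, q3, q4]; ring


/-- the even character mod 8 -/
def chi8 (x : ℤ) : ℤ := if x % 8 = 1 ∨ x % 8 = 7 then 1 else -1

lemma jac_two {V : ℤ} (hV : V % 2 = 1) : jacobiSym 2 V.natAbs = chi8 V := by
  have h : V.natAbs % 2 = 1 := by omega
  rw [jacobiSym.at_two (Nat.odd_iff.mpr h), ZMod.χ₈_nat_eq_if_mod_eight]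
  unfold chi8
  split_ifs <;> omega

lemma chi8_sq (x : ℤ) : chi8 x * chi8 x = 1 := by unfold chi8; split_ifs <;> norm_num

/-- the spin symbol -/
def sp (w : Zsqrtd 2) : ℤ := jacobiSym (2 * w.re) w.im.natAbs

lemma sp_eq (U V : ℤ) (hV : V % 2 = 1) :
    sp ⟨U, V⟩ = chi8 V * jacobiSym U V.natAbs := by
  unfold sp
  rw [jacobiSym.mul_left, jac_two hV]

lemma sp_eq' (U V : ℤ) (hU : U % 2 = 1) (hV : V % 2 = 1) (hU0 : 0 < U) :
    sp ⟨U, V⟩ = chi8 V * rho V U * jacobiSym V U.natAbs := by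
  rw [sp_eq _ _ hV, jac_recip V U hV hU hU0, ← mul_assoc, mul_assoc (chi8 V), rho_sq, mul_one]

lemma sp_unit (a b : ℤ) (ha : a % 2 = 1) (hb : b % 2 = 1) (hU : 0 < 3 * a + 4 * b) :
    sp ⟨3 * a + 4 * b, 2 * a + 3 * b⟩ = sp ⟨a, b⟩ := by
  have h := core a b 3 2 ha hb (by norm_num) (by norm_num) (by norm_num)
    (by refine ⟨1, -1, by norm_num⟩) (by linarith)
  have e1 : a * 3 + 2 * b * 2 = 3 * a + 4 * b := by ring
  have e2 : a * 2 + b * 3 = 2 * a + 3 * b := by ring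
  have e3 : jacobiSym (2 * 2) (3 : ℤ).natAbs = 1 := by norm_num
  have e4 : ((3 : ℤ) ^ 2 - 2 * 2 ^ 2).natAbs = 1 := by norm_num
  rw [e1, e2, e3, e4, jacobiSym.one_right] at h
  rw [sp_eq' _ _ (by omega) (by omega) hU, h, sp_eq _ _ hb]
  have key : chi8 (2 * a + 3 * b) * rho (2 * a + 3 * b) (3 * a + 4 * b) * (rho b 3 *
    rho 3 (3 * a + 4 * b) * rho b (3 * a + 4 * b)) = chi8 b := by
    have h1 : a % 8 = 1 ∨ a % 8 = 3 ∨ a % 8 = 5 ∨ a % 8 = 7 := by omega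
    have h2 : b % 8 = 1 ∨ b % 8 = 3 ∨ b % 8 = 5 ∨ b % 8 = 7 := by omega
    have t1 : (2 * a + 3 * b) % 8 = (2 * (a % 8) + 3 * (b % 8)) % 8 := by omega
    have t2 : (2 * a + 3 * b) % 4 = (2 * (a % 8) + 3 * (b % 8)) % 4 := by omega
    have t3 : (3 * a + 4 * b) % 4 = (3 * (a % 8)) % 4 := by omega
    have t4 : b % 4 = (b % 8) % 4 := by omega
    unfold chi8 rho
    rw [t1, t2, t3, t4]
    rcases h1 with h1 | h1 | h1 | h1 <;> rcases h2 with h2 | h2 | h2 | h2 <;> rw [h1, h2] <;> norm_num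
  rw [← key]; ring

def PhiA (a b c d : ℤ) : ℤ :=
  chi8 (a * d + b * c) * rho (a * d + b * c) (a * c + 2 * b * d) *
    (rho b c * rho c (a * c + 2 * b * d) * rho b (a * c + 2 * b * d))

def Phi (a b c d : ℤ) : ℤ :=
  if ((a ^ 2 - 2 * b ^ 2) * (c ^ 2 - 2 * d ^ 2)) % 16 = 15 then
    (if b % 2 = 1 then PhiA a b c d else PhiA c d a b * chi8 (a * c + 2 * b * d)) else 0

lemma rho_add (x y s t : ℤ) : rho (x + 16 * s) (y + 16 * t) = rho x y := by
  unfold rho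
  have h1 : (x + 16 * s) % 4 = x % 4 := by omega
  have h2 : (y + 16 * t) % 4 = y % 4 := by omega
  rw [h1, h2]

lemma chi8_add (x s : ℤ) : chi8 (x + 16 * s) = chi8 x := by
  unfold chi8
  have h1 : (x + 16 * s) % 8 = x % 8 := by omega
  rw [h1]

lemma PhiA_add (a b c d s t p q : ℤ) :
    PhiA (a + 16 * s) (b + 16 * t) (c + 16 * p) (d + 16 * q) = PhiA a b c d := by
  unfold PhiA
  obtain ⟨k, hk⟩ : ∃ k, (a + 16 * s) * (d + 16 * q) + (b + 16 * t) * (c + 16 * p)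
      = (a * d + b * c) + 16 * k := ⟨a * q + s * d + 16 * s * q + b * p + t * c + 16 * t * p, by ring⟩
  obtain ⟨l, hl⟩ : ∃ k, (a + 16 * s) * (c + 16 * p) + 2 * (b + 16 * t) * (d + 16 * q)
      = (a * c + 2 * b * d) + 16 * k :=
    ⟨a * p + s * c + 16 * s * p + 2 * b * q + 2 * t * d + 32 * t * q, by ring⟩
  rw [hk, hl]
  simp only [rho_add, chi8_add]

lemma Phi_add (a b c d s t p q : ℤ) :
    Phi (a + 16 * s) (b + 16 * t) (c + 16 * p) (d + 16 * q) = Phi a b c d := by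
  unfold Phi
  obtain ⟨l, hl⟩ : ∃ k, (a + 16 * s) * (c + 16 * p) + 2 * (b + 16 * t) * (d + 16 * q)
      = (a * c + 2 * b * d) + 16 * k :=
    ⟨a * p + s * c + 16 * s * p + 2 * b * q + 2 * t * d + 32 * t * q, by ring⟩
  obtain ⟨k, hk⟩ : ∃ k, ((a + 16 * s) ^ 2 - 2 * (b + 16 * t) ^ 2) * ((c + 16 * p) ^ 2 - 2 * (d + 16 * q) ^ 2)
      = ((a ^ 2 - 2 * b ^ 2) * (c ^ 2 - 2 * d ^ 2)) + 16 * k := by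
    obtain ⟨x, hx⟩ : ∃ x, (a + 16 * s) ^ 2 - 2 * (b + 16 * t) ^ 2 = (a ^ 2 - 2 * b ^ 2) + 16 * x :=
      ⟨2 * a * s + 16 * s ^ 2 - 4 * b * t - 32 * t ^ 2, by ring⟩
    obtain ⟨y, hy⟩ : ∃ x, (c + 16 * p) ^ 2 - 2 * (d + 16 * q) ^ 2 = (c ^ 2 - 2 * d ^ 2) + 16 * x :=
      ⟨2 * c * p + 16 * p ^ 2 - 4 * d * q - 32 * q ^ 2, by ring⟩
    rw [hx, hy]
    exact ⟨(a ^ 2 - 2 * b ^ 2) * y + x * (c ^ 2 - 2 * d ^ 2) + 16 * x * y, by ring⟩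
  rw [hl, hk, chi8_add, PhiA_add, PhiA_add]
  have h1 : (((a ^ 2 - 2 * b ^ 2) * (c ^ 2 - 2 * d ^ 2)) + 16 * k) % 16 =
    ((a ^ 2 - 2 * b ^ 2) * (c ^ 2 - 2 * d ^ 2)) % 16 := by omega
  have h2 : (b + 16 * t) % 2 = b % 2 := by omega
  rw [h1, h2]

lemma Phi_mod (a b c d : ℤ) : Phi a b c d = Phi (a % 16) (b % 16) (c % 16) (d % 16) := by
  conv_lhs => rw [← Int.emod_add_mul_ediv a 16, ← Int.emod_add_mul_ediv b 16,
    ← Int.emod_add_mul_ediv c 16, ← Int.emod_add_mul_ediv d 16]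
  exact Phi_add ..

lemma abs_rho (x y : ℤ) : |rho x y| = 1 := by unfold rho; split_ifs <;> norm_num
lemma abs_chi8 (x : ℤ) : |chi8 x| = 1 := by unfold chi8; split_ifs <;> norm_num

lemma abs_Phi_le (a b c d : ℤ) : |Phi a b c d| ≤ 1 := by
  unfold Phi PhiA
  split_ifs <;> simp [abs_mul, abs_rho, abs_chi8]

lemma abs_jac_le (a : ℤ) (n : ℕ) : |jacobiSym a n| ≤ 1 := by
  rcases jacobiSym.trichotomy a n with h | h | h <;> rw [h] <;> norm_num

def Fw (w : Zsqrtd 2) : ℤ :=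
  if w.im % 2 = 1 then jacobiSym w.re w.im.natAbs else jacobiSym (2 * w.im) w.re.natAbs

lemma abs_Fw_le (w : Zsqrtd 2) : |Fw w| ≤ 1 := by
  unfold Fw; split_ifs <;> exact abs_jac_le _ _

/-- totally positive, primitive, of odd norm -/
structure Good (w : Zsqrtd 2) : Prop where
  re_pos : 0 < w.re
  norm_pos : 0 < w.re ^ 2 - 2 * w.im ^ 2
  odd : w.re % 2 = 1
  cop : IsCoprime w.re w.im

lemma U_pos {a b c d : ℤ} (ha : 0 < a) (hc : 0 < c) (h1 : 0 < a ^ 2 - 2 * b ^ 2)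
    (h2 : 0 < c ^ 2 - 2 * d ^ 2) : 0 < a * c + 2 * b * d := by
  have h : |2 * b * d| < a * c := by
    apply abs_lt_of_sq_lt_sq _ (by positivity)
    have : (a * c) ^ 2 - (2 * b * d) ^ 2 = (a ^ 2 - 2 * b ^ 2) * c ^ 2 + 2 * b ^ 2 * (c ^ 2 - 2 * d ^ 2) := by ring
    nlinarith [mul_pos h1 (pow_pos hc 2), mul_nonneg (by positivity : (0:ℤ) ≤ 2 * b ^ 2) h2.le]
  have := (abs_lt.mp h).1
  linarith

lemma norm_mul' (a b c d : ℤ) : (a * c + 2 * b * d) ^ 2 - 2 * (a * d + b * c) ^ 2 =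
    (a ^ 2 - 2 * b ^ 2) * (c ^ 2 - 2 * d ^ 2) := by ring

lemma jac_zero_of_dvd {q : ℕ} (hq : q.Prime) {x y : ℤ} (hx : (q : ℤ) ∣ x) (hy : (q : ℤ) ∣ y) (hy0 : y ≠ 0) :
    jacobiSym x y.natAbs = 0 := by
  rw [jacobiSym.eq_zero_iff]
  refine ⟨by simpa using hy0, fun h => ?_⟩
  have h1 : (q : ℤ) ∣ (x.gcd (y.natAbs : ℤ) : ℤ) := Int.dvd_coe_gcd hx (Int.dvd_natAbs.mpr hy)
  rw [h] at h1
  have : q ∣ 1 := by exact_mod_cast h1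
  exact hq.one_lt.ne' (Nat.dvd_one.mp this)

lemma swap_mod {a b c d : ℤ} (hU : 0 < a * c + 2 * b * d)
    (h1 : 0 < a ^ 2 - 2 * b ^ 2) (h2 : 0 < c ^ 2 - 2 * d ^ 2)
    (hab : IsCoprime a b) (hcd : IsCoprime c d)
    (h8 : ((a ^ 2 - 2 * b ^ 2) * (c ^ 2 - 2 * d ^ 2)) % 8 = 7) :
    jacobiSym (a * c + 2 * b * d) (c ^ 2 - 2 * d ^ 2).natAbs =
      chi8 (a * c + 2 * b * d) * jacobiSym (a * c + 2 * b * d) (a ^ 2 - 2 * b ^ 2).natAbs := by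
  have hN := norm_mul' a b c d
  set U := a * c + 2 * b * d with hUdef
  set V := a * d + b * c with hVdef
  set m := a ^ 2 - 2 * b ^ 2 with hm
  set n := c ^ 2 - 2 * d ^ 2 with hn
  have hUo : U % 2 = 1 := by
    rcases Int.emod_two_eq_zero_or_one U with h | h
    · exfalso
      obtain ⟨k, hk⟩ : ∃ k, U = 2 * k := ⟨U / 2, by omega⟩
      have : m * n = 2 * (2 * k ^ 2 - V ^ 2) := by rw [← hN, hk]; ring
      omega
    · exact h
  by_cases hc : IsCoprime U V
  · have hUm : IsCoprime U (m * n) := by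
      rw [← hN]
      have h2 : IsCoprime U 2 := ⟨1, -(U / 2), by omega⟩
      have h3 : IsCoprime U (2 * V ^ 2) := h2.mul_right hc.pow_right
      have h4 : U ^ 2 - 2 * V ^ 2 = -(2 * V ^ 2) + U * U := by ring
      rw [h4]
      exact h3.neg_right.add_mul_left_right U
    have e1 : jacobiSym U m.natAbs * jacobiSym U m.natAbs = 1 := jac_sq_one hUm.of_mul_right_left
    have e2 : jacobiSym U (m * n).natAbs = jacobiSym U m.natAbs * jacobiSym U n.natAbs :=
      jac_mul_right _ _ _ h1.ne' h2.ne'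
    have e3 : jacobiSym (m * n) U.natAbs = rho (m * n) U * jacobiSym U (m * n).natAbs :=
      jac_recip _ _ (by omega) hUo hU
    have e4 : jacobiSym (m * n) U.natAbs = jacobiSym (-1 * 2 * (V * V)) U.natAbs := by
      apply jac_mod; refine ⟨U, ?_⟩; rw [← hN]; ring
    rw [jacobiSym.mul_left (-1 * 2), jacobiSym.mul_left (-1) 2, jacobiSym.mul_left V V, jac_sq_one hc.symm,
      jac_neg_one hUo hU, mul_one] at e4
    have e5 : rho (m * n) U = rho (-1) U := by
      unfold rho
      have : (m * n) % 4 = 3 := by omega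
      rw [this]; norm_num
    have e6 : jacobiSym 2 U.natAbs = chi8 U := jac_two hUo
    have e7 : jacobiSym U (m * n).natAbs = chi8 U := by
      have : rho (-1) U * (rho (-1) U * jacobiSym U (m * n).natAbs) = rho (-1) U * (rho (-1) U * chi8 U) := by
        rw [← e5, ← e3, e4, e6, e5]
      rwa [← mul_assoc, ← mul_assoc, rho_sq, one_mul, one_mul] at this
    rw [← e7, e2, mul_comm, ← mul_assoc, e1, one_mul]
  · obtain ⟨q, hq, hqU, hqV⟩ : ∃ q : ℕ, q.Prime ∧ (q : ℤ) ∣ U ∧ (q : ℤ) ∣ V := by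
      have : Int.gcd U V ≠ 1 := fun h => hc (Int.isCoprime_iff_gcd_eq_one.mpr h)
      obtain ⟨q, hq, hd⟩ := Nat.exists_prime_and_dvd this
      have hd' : (q : ℤ) ∣ (Int.gcd U V : ℤ) := by exact_mod_cast hd
      exact ⟨q, hq, hd'.trans (Int.gcd_dvd_left ..), hd'.trans (Int.gcd_dvd_right ..)⟩
    have hqn : (q : ℤ) ∣ n := by
      obtain ⟨x, y, hxy⟩ := hab
      have t1 : c * U - 2 * d * V = a * n := by rw [hUdef, hVdef, hn]; ring
      have t2 : c * V - d * U = b * n := by rw [hUdef, hVdef, hn]; ring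
      have : n = x * (c * U - 2 * d * V) + y * (c * V - d * U) := by
        rw [t1, t2, ← mul_assoc, ← mul_assoc, ← add_mul, hxy, one_mul]
      rw [this]
      exact dvd_add (((hqU.mul_left c).sub (hqV.mul_left _)).mul_left x)
        (((hqV.mul_left c).sub (hqU.mul_left _)).mul_left y)
    have hqm : (q : ℤ) ∣ m := by
      obtain ⟨x, y, hxy⟩ := hcd
      have t1 : a * U - 2 * b * V = c * m := by rw [hUdef, hVdef, hm]; ring
      have t2 : a * V - b * U = d * m := by rw [hUdef, hVdef, hm]; ring
      have : m = x * (a * U - 2 * b * V) + y * (a * V - b * U) := by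
        rw [t1, t2, ← mul_assoc, ← mul_assoc, ← add_mul, hxy, one_mul]
      rw [this]
      exact dvd_add (((hqU.mul_left _).sub (hqV.mul_left _)).mul_left x)
        (((hqV.mul_left _).sub (hqU.mul_left _)).mul_left y)
    rw [jac_zero_of_dvd hq hqU hqn h2.ne', jac_zero_of_dvd hq hqU hqm h1.ne', mul_zero]

lemma twist_aux (a b c d : ℤ) (ha : a % 2 = 1) (hb : b % 2 = 1) (hc : c % 2 = 1) (hd : d % 2 = 0)
    (hc0 : 0 < c) (hcd : IsCoprime c d) (hU : 0 < a * c + 2 * b * d) :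
    sp ⟨a * c + 2 * b * d, a * d + b * c⟩ = PhiA a b c d * jacobiSym a b.natAbs *
      jacobiSym (2 * d) c.natAbs * jacobiSym (a * c + 2 * b * d) (c ^ 2 - 2 * d ^ 2).natAbs := by
  have h1 : (a * c) % 2 = 1 := by rw [Int.mul_emod, ha, hc]; rfl
  have h2 : (b * c) % 2 = 1 := by rw [Int.mul_emod, hb, hc]; rfl
  have h3 : (a * d) % 2 = 0 := by rw [Int.mul_emod, ha, hd]; rfl
  rw [sp_eq' _ _ (by rw [mul_assoc]; omega) (by omega) hU, core a b c d ha hb hc hd hc0 hcd hU]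
  unfold PhiA; ring

lemma norm_mod (a b : ℤ) (ha : a % 2 = 1) :
    (b % 2 = 1 → (a ^ 2 - 2 * b ^ 2) % 8 = 7) ∧ (b % 2 = 0 → (a ^ 2 - 2 * b ^ 2) % 8 = 1) := by
  have hsq : ∀ k : ℤ, (k * (k + 1)) % 2 = 0 := fun k => Int.even_iff.mp (Int.even_mul_succ_self k)
  obtain ⟨a1, rfl⟩ : ∃ k, a = 2 * k + 1 := ⟨a / 2, by omega⟩
  have h1 := hsq a1
  constructor
  · intro hb
    obtain ⟨b1, rfl⟩ : ∃ k, b = 2 * k + 1 := ⟨b / 2, by omega⟩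
    have : (2 * a1 + 1) ^ 2 - 2 * (2 * b1 + 1) ^ 2 = 4 * (a1 * (a1 + 1)) - 8 * (b1 * (b1 + 1)) - 1 := by ring
    omega
  · intro hb
    obtain ⟨b1, rfl⟩ : ∃ k, b = 2 * k := ⟨b / 2, by omega⟩
    have : (2 * a1 + 1) ^ 2 - 2 * (2 * b1) ^ 2 = 4 * (a1 * (a1 + 1)) - 8 * (b1 * b1) + 1 := by ring
    omega

theorem twist (w z : Zsqrtd 2) (hw : Good w) (hz : Good z) :
    (if ((w.re ^ 2 - 2 * w.im ^ 2) * (z.re ^ 2 - 2 * z.im ^ 2)) % 16 = 15 then sp (w * z) else 0) =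
      Phi w.re w.im z.re z.im * Fw w * Fw z *
        jacobiSym (w.re * z.re + 2 * w.im * z.im) (z.re ^ 2 - 2 * z.im ^ 2).natAbs := by
  obtain ⟨a, b⟩ := w
  obtain ⟨c, d⟩ := z
  obtain ⟨ha0, hm, ha, hab⟩ := hw
  obtain ⟨hc0, hn, hc, hcd⟩ := hz
  simp only at *
  have hU := U_pos ha0 hc0 hm hn
  have hmul : (⟨a, b⟩ * ⟨c, d⟩ : Zsqrtd 2) = ⟨a * c + 2 * b * d, a * d + b * c⟩ := by
    ext <;> simp
  unfold Phi
  split_ifs with h15 hb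
  · -- b odd
    have hd : d % 2 = 0 := by
      by_contra hd
      have t1 := (norm_mod a b ha).1 hb
      have t2 := (norm_mod c d hc).1 (by omega)
      have : ((a ^ 2 - 2 * b ^ 2) * (c ^ 2 - 2 * d ^ 2)) % 8 = 1 := by rw [Int.mul_emod, t1, t2]; rfl
      omega
    rw [hmul, twist_aux a b c d ha hb hc hd hc0 hcd hU]
    unfold Fw; simp only [hb, hd]; norm_num
  · have hb' : b % 2 = 0 := by omega
    have hd : d % 2 = 1 := by
      by_contra hd
      have t1 := (norm_mod a b ha).2 hb'
      have t2 := (norm_mod c d hc).2 (by omega)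
      have : ((a ^ 2 - 2 * b ^ 2) * (c ^ 2 - 2 * d ^ 2)) % 8 = 1 := by rw [Int.mul_emod, t1, t2]; rfl
      omega
    have e := twist_aux c d a b hc hd ha hb' ha0 hab (by linarith)
    have e1 : c * a + 2 * d * b = a * c + 2 * b * d := by ring
    have e2 : c * b + d * a = a * d + b * c := by ring
    rw [e1, e2] at e
    rw [hmul, e, swap_mod hU hm hn hab hcd (by omega)]
    unfold Fw; simp only [hb', hd]; norm_num
    have := chi8_sq (a * c + 2 * b * d)
    linear_combination (-PhiA c d a b * jacobiSym (2 * b) a.natAbs * jacobiSym c d.natAbs *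
      jacobiSym (a * c + 2 * b * d) (a ^ 2 - 2 * b ^ 2).natAbs) * this
  · ring

end QSpin

namespace QSpin

noncomputable def Dn (n : ℕ) : Finset (Zsqrtd 2) := by
  classical
  exact (((Finset.Icc (1:ℤ) (2 * n)) ×ˢ (Finset.Icc (-(n:ℤ)) n)).image
    (fun p => (⟨p.1, p.2⟩ : Zsqrtd 2))).filter
    (fun w => 0 < w.re ∧ 2 * |w.im| < w.re ∧ IsCoprime w.re w.im ∧ w.re ^ 2 - 2 * w.im ^ 2 = n)

lemma re_sq_lt {a b : ℤ} (h : 2 * |b| < a) : a ^ 2 < 2 * (a ^ 2 - 2 * b ^ 2) := by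
  have h1 : (2 * |b|) ^ 2 < a ^ 2 := by
    apply pow_lt_pow_left₀ h (by positivity) (by norm_num)
  have h2 : (2 * |b|) ^ 2 = 4 * b ^ 2 := by rw [mul_pow, sq_abs]; ring
  linarith

lemma mem_Dn {n : ℕ} {w : Zsqrtd 2} : w ∈ Dn n ↔
    0 < w.re ∧ 2 * |w.im| < w.re ∧ IsCoprime w.re w.im ∧ w.re ^ 2 - 2 * w.im ^ 2 = n := by
  unfold Dn
  simp only [Finset.mem_filter, Finset.mem_image, Finset.mem_product, Finset.mem_Icc]
  constructor
  · exact fun h => h.2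
  · intro h
    refine ⟨⟨(w.re, w.im), ?_, rfl⟩, h⟩
    obtain ⟨h1, h2, -, h4⟩ := h
    have h5 := re_sq_lt h2
    rw [h4] at h5
    have h6 : w.re ≤ w.re ^ 2 := by nlinarith
    have h7 : |w.im| ≤ n := by linarith
    rw [abs_le] at h7
    exact ⟨⟨by linarith, by linarith⟩, h7⟩

lemma odd_re {a b : ℤ} {n : ℕ} (hn : n % 2 = 1) (h : a ^ 2 - 2 * b ^ 2 = n) : a % 2 = 1 := by
  rcases Int.emod_two_eq_zero_or_one a with h' | h'
  · exfalso
    obtain ⟨k, hk⟩ : ∃ k, a = 2 * k := ⟨a / 2, by omega⟩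
    have : (n : ℤ) = 2 * (2 * k ^ 2 - b ^ 2) := by rw [← h, hk]; ring
    omega
  · exact h'

lemma good_of_mem {n : ℕ} (hn : n % 2 = 1) {w : Zsqrtd 2} (h : w ∈ Dn n) : Good w := by
  obtain ⟨h1, h2, h3, h4⟩ := mem_Dn.mp h
  exact ⟨h1, by rw [h4]; omega, odd_re hn h4, h3⟩

lemma cop_im {a b : ℤ} {n : ℤ} (h : IsCoprime a b) (hn : a ^ 2 - 2 * b ^ 2 = n) : IsCoprime b n := by
  have h1 : IsCoprime b (a ^ 2) := h.symm.pow_right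
  have h2 : n = a ^ 2 + b * (-2 * b) := by rw [← hn]; ring
  rw [h2]; exact h1.add_mul_left_right _

lemma cop_re {a b : ℤ} {n : ℤ} (h : IsCoprime a b) (hn : a ^ 2 - 2 * b ^ 2 = n) (ha : a % 2 = 1) :
    IsCoprime a n := by
  have h1 : IsCoprime a (2 * b ^ 2) := by
    refine IsCoprime.mul_right ⟨1, -(a / 2), by omega⟩ h.pow_right
  have h2 : n = -(2 * b ^ 2) + a * a := by rw [← hn]; ring
  rw [h2]; exact h1.neg_right.add_mul_left_right _

/-- same root -/
def Rel (n : ℤ) (w z : Zsqrtd 2) : Prop := n ∣ w.re * z.im - z.re * w.im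

lemma Rel.symm {n : ℤ} {w z : Zsqrtd 2} (h : Rel n w z) : Rel n z w := by
  unfold Rel at *
  have e : -(z.re * w.im - w.re * z.im) = w.re * z.im - z.re * w.im := by ring
  rw [← dvd_neg, e]; exact h

lemma Rel.trans {n : ℤ} {w z v : Zsqrtd 2} (hz : IsCoprime z.im n) (h : Rel n w z) (h' : Rel n z v) :
    Rel n w v := by
  unfold Rel at *
  apply hz.symm.dvd_of_dvd_mul_left
  have : z.im * (w.re * v.im - v.re * w.im) =
    (w.re * z.im - z.re * w.im) * v.im + w.im * (z.re * v.im - v.re * z.im) := by ring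
  rw [this]
  exact dvd_add (h.mul_right _) (h'.mul_left _)

lemma Dn_inj {n : ℕ} {w z : Zsqrtd 2} (hw : w ∈ Dn n) (hz : z ∈ Dn n) (h : Rel n w z) : w = z := by
  obtain ⟨a, b⟩ := w
  obtain ⟨c, d⟩ := z
  obtain ⟨ha, hb, hab, hN⟩ := mem_Dn.mp hw
  obtain ⟨hc, hd, hcd, hN'⟩ := mem_Dn.mp hz
  simp only at *
  have hn0 : (0:ℤ) < n := by
    have := re_sq_lt hb
    rw [hN] at this; nlinarith
  have hbn := cop_im hab hN
  unfold Rel at h; simp only at h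
  obtain ⟨y, hy⟩ := h
  obtain ⟨x, hx⟩ : (n : ℤ) ∣ a * c - 2 * b * d := by
    apply hbn.symm.dvd_of_dvd_mul_left
    have : b * (a * c - 2 * b * d) = -a * (a * d - c * b) + d * (a ^ 2 - 2 * b ^ 2) := by ring
    rw [this, hN]
    exact dvd_add ((Dvd.intro y hy.symm).mul_left _) (dvd_mul_left _ _)
  have hxy : x ^ 2 - 2 * y ^ 2 = 1 := by
    have : (n:ℤ) ^ 2 * (x ^ 2 - 2 * y ^ 2) = n ^ 2 * 1 := by
      calc (n:ℤ) ^ 2 * (x ^ 2 - 2 * y ^ 2) = (n * x) ^ 2 - 2 * (n * y) ^ 2 := by ring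
        _ = (a * c - 2 * b * d) ^ 2 - 2 * (a * d - c * b) ^ 2 := by rw [hx, hy]
        _ = (a ^ 2 - 2 * b ^ 2) * (c ^ 2 - 2 * d ^ 2) := by ring
        _ = n ^ 2 * 1 := by rw [hN, hN']; ring
    exact mul_left_cancel₀ (by positivity) this
  rw [← abs_two, ← abs_mul, abs_lt] at hb hd
  have k1 : 3 * (a * d - c * b) < 2 * (a * c - 2 * b * d) := by
    nlinarith [mul_pos (by linarith : 0 < a - 2 * b) (by linarith : 0 < c - 2 * d),
      mul_pos (by linarith : 0 < a + 2 * b) (by linarith : 0 < c + 2 * d),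
      mul_pos (by linarith : 0 < a + 2 * b) (by linarith : 0 < c - 2 * d)]
  have k2 : -(3 * (a * d - c * b)) < 2 * (a * c - 2 * b * d) := by
    nlinarith [mul_pos (by linarith : 0 < a - 2 * b) (by linarith : 0 < c - 2 * d),
      mul_pos (by linarith : 0 < a + 2 * b) (by linarith : 0 < c + 2 * d),
      mul_pos (by linarith : 0 < a - 2 * b) (by linarith : 0 < c + 2 * d)]
  rw [hx, hy] at k1 k2
  have k3 : 3 * y < 2 * x := by nlinarith
  have k4 : -(3 * y) < 2 * x := by nlinarith
  have hy2 : y ^ 2 < 4 := by nlinarith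
  have hy3 : -2 < y := by nlinarith
  have hy4 : y < 2 := by nlinarith
  have hx0 : 0 < x := by linarith
  have hy0 : y = 0 := by
    by_contra hne
    have : y ^ 2 = 1 := by
      have : y = 1 ∨ y = -1 := by omega
      rcases this with rfl | rfl <;> norm_num
    rw [this] at hxy
    have : x < 2 := by nlinarith
    have : x = 1 := by omega
    rw [this] at hxy; norm_num at hxy
  subst hy0
  have hx1 : x = 1 := by
    have : x ^ 2 = 1 := by linarith
    nlinarith
  subst hx1
  have e1 : a = c := by
    have : (n:ℤ) * a = n * c := by linear_combination (-2 * b) * hy - a * hx + c * hN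
    exact mul_left_cancel₀ hn0.ne' this
  have e2 : b = d := by
    have : (a:ℤ) * b = a * d := by rw [← e1] at hy; linarith
    exact mul_left_cancel₀ ha.ne' this
  rw [e1, e2]

lemma descent {n : ℕ} (hn : n % 2 = 1) : ∀ (k : ℕ) (w : Zsqrtd 2), w.re.toNat ≤ k → Good w →
    w.re ^ 2 - 2 * w.im ^ 2 = n → ∃ z ∈ Dn n, Rel n w z ∧ (n % 8 = 7 → sp z = sp w) := by
  intro k
  induction k with
  | zero => intro w hk hw _; have := hw.re_pos; omega
  | succ k ih =>
    intro w hk hw hN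
    obtain ⟨a, b⟩ := w
    obtain ⟨h1, h2, h3, h4⟩ := hw
    simp only at *
    by_cases hD : 2 * |b| < a
    · refine ⟨⟨a, b⟩, mem_Dn.mpr ⟨h1, hD, h4, hN⟩, ?_, fun _ => rfl⟩
      unfold Rel; simp only; ring_nf; exact dvd_zero _
    · have hbn := cop_im h4 hN
      have hbo : n % 8 = 7 → b % 2 = 1 := by
        intro h7
        by_contra hb
        have := (norm_mod a b h3).2 (by omega)
        omega
      rcases le_total 0 b with hb | hb
      · rw [abs_of_nonneg hb] at hD
        have hab : a < 2 * b := by omega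
        have p1 : 0 < 3 * a - 4 * b := by nlinarith
        have g : Good (⟨3 * a - 4 * b, 3 * b - 2 * a⟩ : Zsqrtd 2) := by
          refine ⟨p1, ?_, ?_, ?_⟩ <;> simp only
          · nlinarith
          · omega
          · obtain ⟨x, y, hxy⟩ := h4
            exact ⟨3 * x + 2 * y, 4 * x + 3 * y, by linear_combination hxy⟩
        obtain ⟨z, hz, hr, hs⟩ := ih _ (by simp only; omega) g (by simp only; linarith)
        refine ⟨z, hz, ?_, fun h7 => ?_⟩
        · refine Rel.trans (z := ⟨3 * a - 4 * b, 3 * b - 2 * a⟩) ?_ ?_ hr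
          · exact cop_im g.cop (by simp only; linarith)
          · unfold Rel; simp only; exact ⟨-2, by rw [← hN]; ring⟩
        · rw [hs h7]
          have := hbo h7
          have e := sp_unit (3 * a - 4 * b) (3 * b - 2 * a) (by omega) (by omega) (by linarith)
          rw [← e]; congr 2 <;> ring
      · rw [abs_of_nonpos hb] at hD
        have hab : a < -2 * b := by omega
        have p1 : 0 < 3 * a + 4 * b := by nlinarith
        have g : Good (⟨3 * a + 4 * b, 2 * a + 3 * b⟩ : Zsqrtd 2) := by
          refine ⟨p1, ?_, ?_, ?_⟩ <;> simp only
          · nlinarith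
          · omega
          · obtain ⟨x, y, hxy⟩ := h4
            exact ⟨3 * x - 2 * y, -4 * x + 3 * y, by linear_combination hxy⟩
        obtain ⟨z, hz, hr, hs⟩ := ih _ (by simp only; omega) g (by simp only; linarith)
        refine ⟨z, hz, ?_, fun h7 => ?_⟩
        · refine Rel.trans (z := ⟨3 * a + 4 * b, 2 * a + 3 * b⟩) ?_ ?_ hr
          · exact cop_im g.cop (by simp only; linarith)
          · unfold Rel; simp only; exact ⟨2, by rw [← hN]; ring⟩
        · rw [hs h7]
          have := hbo h7
          exact sp_unit a b h3 this p1

lemma exists_red {n : ℕ} (hn : n % 2 = 1) (w : Zsqrtd 2) (hw : Good w) (hN : w.re ^ 2 - 2 * w.im ^ 2 = n) :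
    ∃ z ∈ Dn n, Rel n w z ∧ (n % 8 = 7 → sp z = sp w) :=
  descent hn _ w le_rfl hw hN

end QSpin

namespace QSpin

lemma norm_ne_zero {x y : ℤ} (h : x ^ 2 - 2 * y ^ 2 = 0) : x = 0 ∧ y = 0 := by
  by_cases hy : y = 0
  · subst hy; simp at h; exact ⟨h, rfl⟩
  · exfalso
    have h1 : ((x : ℝ) / y) ^ 2 = 2 := by
      have : (x:ℝ) ^ 2 - 2 * y ^ 2 = 0 := by exact_mod_cast h
      have hy' : (y:ℝ) ≠ 0 := by exact_mod_cast hy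
      field_simp; linarith
    have h2 : |(x : ℝ) / y| = √2 := by rw [← Real.sqrt_sq_eq_abs, h1]
    apply irrational_sqrt_two
    exact ⟨|(x:ℚ) / y|, by push_cast; exact h2⟩

lemma thue_small {m : ℕ} (hm : 2 ≤ m) (a b : ℤ) : ∃ x y : ℤ, (x ≠ 0 ∨ y ≠ 0) ∧ x ^ 2 ≤ m ∧ y ^ 2 ≤ m ∧
    (m : ℤ) ∣ x * b - a * y := by
  classical
  have : NeZero m := ⟨by omega⟩
  set k := Nat.sqrt m with hk
  have hk1 : k * k ≤ m := Nat.sqrt_le m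
  have hk2 : m < (k + 1) * (k + 1) := Nat.lt_succ_sqrt m
  let f : ℕ × ℕ → ZMod m := fun p => ((p.1 * b - a * p.2 : ℤ) : ZMod m)
  obtain ⟨p, hp, q, hq, hpq, hf⟩ := Finset.exists_ne_map_eq_of_card_lt_of_maps_to
    (s := Finset.range (k + 1) ×ˢ Finset.range (k + 1)) (t := (Finset.univ : Finset (ZMod m))) (f := f)
    (by simp [ZMod.card]; exact hk2) (by intro x _; simp)
  simp only [Finset.mem_product, Finset.mem_range] at hp hq
  have hk1' : (k : ℤ) * k ≤ m := by exact_mod_cast hk1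
  refine ⟨p.1 - q.1, p.2 - q.2, ?_, ?_, ?_, ?_⟩
  · by_contra hc
    push Not at hc
    apply hpq
    ext <;> omega
  · have h1 : (p.1:ℤ) - q.1 ≤ k := by omega
    have h2 : -(k:ℤ) ≤ (p.1:ℤ) - q.1 := by omega
    nlinarith
  · have h1 : (p.2:ℤ) - q.2 ≤ k := by omega
    have h2 : -(k:ℤ) ≤ (p.2:ℤ) - q.2 := by omega
    nlinarith
  · have := (ZMod.intCast_eq_intCast_iff_dvd_sub _ _ _).mp hf.symm
    convert this using 1; ring

lemma thue_good {m : ℕ} (hm : m % 2 = 1) (a b : ℤ) (hb : IsCoprime b m) (h : (m:ℤ) ∣ a ^ 2 - 2 * b ^ 2) :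
    ∃ w : Zsqrtd 2, Good w ∧ w.re ^ 2 - 2 * w.im ^ 2 = m ∧ Rel m ⟨a, b⟩ w := by
  -- enough to find a primitive vector of norm m
  have fin : ∀ x y : ℤ, IsCoprime x y → x ^ 2 - 2 * y ^ 2 = m → (m:ℤ) ∣ x * b - a * y →
      ∃ w : Zsqrtd 2, Good w ∧ w.re ^ 2 - 2 * w.im ^ 2 = m ∧ Rel m ⟨a, b⟩ w := by
    intro x y hc hN hd
    have hodd := odd_re hm hN
    have hx0 : x ≠ 0 := by rintro rfl; omega
    rcases lt_or_gt_of_ne hx0 with h0 | h0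
    · refine ⟨⟨-x, -y⟩, ⟨by simp only; omega, by simp only; rw [neg_sq, neg_sq, hN]; omega,
        by simp only; omega, by simpa using hc.neg_neg⟩, by simpa using hN, ?_⟩
      unfold Rel; simp only
      convert hd using 1; ring
    · refine ⟨⟨x, y⟩, ⟨h0, by simp only; rw [hN]; omega, hodd, hc⟩, hN, ?_⟩
      unfold Rel; simp only
      rw [← dvd_neg]
      have e : -(a * y - x * b) = x * b - a * y := by ring
      rw [e]; exact hd
  rcases (show m = 1 ∨ 2 ≤ m by omega) with rfl | hm2
  · exact fin 1 0 isCoprime_one_left (by norm_num) (by simp)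
  obtain ⟨x, y, hxy, hx, hy, hd⟩ := thue_small hm2 a b
  have root : ∀ (M : ℤ) (x y : ℤ), M ∣ (m:ℤ) → M ∣ x * b - a * y → M ∣ x ^ 2 - 2 * y ^ 2 := by
    intro M x y hM hd
    have hbM : IsCoprime M (b ^ 2) := ((hb.of_isCoprime_of_dvd_right hM).symm).pow_right
    apply hbM.dvd_of_dvd_mul_left
    have : b ^ 2 * (x ^ 2 - 2 * y ^ 2) = (x * b - a * y) * (x * b + a * y) + y ^ 2 * (a ^ 2 - 2 * b ^ 2) := by
      ring
    rw [this]
    exact dvd_add (hd.mul_right _) ((hM.trans h).mul_left _)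
  obtain ⟨t, ht⟩ := root m x y dvd_rfl hd
  have hm0 : (0:ℤ) < m := by omega
  have ht0 : t ≠ 0 := by
    rintro rfl
    have := norm_ne_zero (x := x) (y := y) (by rw [ht]; ring)
    tauto
  have ht1 : t ≤ 1 := by nlinarith [sq_nonneg y]
  have ht2 : -2 ≤ t := by nlinarith [sq_nonneg x]
  have ht3 : t ≠ -2 := by
    rintro rfl
    have hx2 : x ^ 2 = 0 := by nlinarith [sq_nonneg x]
    have hx0 : x = 0 := by simpa using hx2
    subst hx0
    have hym : y ^ 2 = m := by linarith
    have ham : IsCoprime a m := by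
      have h2 : IsCoprime (2 * b ^ 2) (m:ℤ) := by
        refine IsCoprime.mul_left ⟨-((m:ℤ) / 2), 1, by omega⟩ hb.pow_left
      obtain ⟨s, hs⟩ := h
      have h3 : IsCoprime (a ^ 2) (m:ℤ) := by
        have : a ^ 2 = 2 * b ^ 2 + m * s := by linarith
        rw [this]; exact h2.add_mul_left_left _
      exact IsCoprime.of_isCoprime_of_dvd_left h3 (dvd_pow_self a (by norm_num))
    have hmy : (m:ℤ) ∣ y := by
      apply ham.symm.dvd_of_dvd_mul_left
      rw [← dvd_neg]; simpa using hd
    obtain ⟨s, rfl⟩ := hmy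
    have : (m:ℤ) * (m * s ^ 2) = m * 1 := by linarith
    have h4 := mul_left_cancel₀ hm0.ne' this
    have : (m:ℤ) ∣ 1 := ⟨s ^ 2, h4.symm⟩
    have := Int.le_of_dvd one_pos this
    omega
  have htu : t = 1 ∨ t = -1 := by omega
  have hcop : IsCoprime x y := by
    rw [Int.isCoprime_iff_gcd_eq_one]
    by_contra hg
    obtain ⟨q, hq, hqg⟩ := Nat.exists_prime_and_dvd hg
    have hqx : (q:ℤ) ∣ x := (Int.natCast_dvd_natCast.mpr hqg).trans (Int.gcd_dvd_left ..)
    have hqy : (q:ℤ) ∣ y := (Int.natCast_dvd_natCast.mpr hqg).trans (Int.gcd_dvd_right ..)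
    obtain ⟨x', rfl⟩ := hqx
    obtain ⟨y', rfl⟩ := hqy
    have hq0 : (q:ℤ) ≠ 0 := by exact_mod_cast hq.ne_zero
    have hqm : (q:ℤ) ∣ m := by
      have : (q:ℤ) ∣ m * t := ⟨q * (x' ^ 2 - 2 * y' ^ 2), by rw [← ht]; ring⟩
      rcases htu with rfl | rfl
      · simpa using this
      · simpa using this
    obtain ⟨m', hm'⟩ := hqm
    have hm'0 : m' ≠ 0 := by rintro rfl; rw [mul_zero] at hm'; omega
    have d1 : m' ∣ x' * b - a * y' := by
      have : (q:ℤ) * m' ∣ q * (x' * b - a * y') := by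
        rw [← hm']; convert hd using 1; ring
      exact (mul_dvd_mul_iff_left hq0).mp this
    obtain ⟨s, hs⟩ := root m' x' y' ⟨q, by rw [hm']; ring⟩ d1
    have e : (q:ℤ) * m' * (q * s) = q * m' * t := by
      rw [← hm', ← ht, hm']
      linear_combination (-(q:ℤ) ^ 2) * hs
    have e2 := mul_left_cancel₀ (mul_ne_zero hq0 hm'0) e
    have e3 : (q:ℤ) ∣ 1 := by
      have : (q:ℤ) ∣ t := ⟨s, e2.symm⟩
      rcases htu with rfl | rfl
      · exact this
      · simpa using this
    have := Int.le_of_dvd one_pos e3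
    have := hq.two_le
    omega
  rcases htu with rfl | rfl
  · exact fin x y hcop (by rw [ht]; ring) hd
  · refine fin (x + 2 * y) (x + y) ?_ (by linear_combination -ht) ?_
    · obtain ⟨p, q, hpq⟩ := hcop
      exact ⟨q - p, 2 * p - q, by linear_combination hpq⟩
    · apply hb.symm.dvd_of_dvd_mul_left
      have : b * ((x + 2 * y) * b - a * (x + y)) =
        (x * b - a * y) * (b - a) - y * (a ^ 2 - 2 * b ^ 2) := by ring
      rw [this]
      exact dvd_sub (hd.mul_right _) (h.mul_left _)

lemma thue {m : ℕ} (hm : m % 2 = 1) (a b : ℤ) (hb : IsCoprime b m) (h : (m:ℤ) ∣ a ^ 2 - 2 * b ^ 2) :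
    ∃ z ∈ Dn m, Rel m ⟨a, b⟩ z := by
  obtain ⟨w, hw, hN, hr⟩ := thue_good hm a b hb h
  obtain ⟨z, hz, hr', -⟩ := exists_red hm w hw hN
  exact ⟨z, hz, hr.trans (cop_im hw.cop hN) hr'⟩

end QSpin

namespace QSpin

lemma mul_re' (w z : Zsqrtd 2) : (w * z).re = w.re * z.re + 2 * w.im * z.im := by
  simp [Zsqrtd.re_mul]
lemma mul_im' (w z : Zsqrtd 2) : (w * z).im = w.re * z.im + w.im * z.re := by
  simp [Zsqrtd.im_mul]

lemma norm_mul'' (w z : Zsqrtd 2) : (w * z).re ^ 2 - 2 * (w * z).im ^ 2 =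
    (w.re ^ 2 - 2 * w.im ^ 2) * (z.re ^ 2 - 2 * z.im ^ 2) := by
  rw [mul_re', mul_im']; ring

lemma good_mul {m n : ℤ} {w z : Zsqrtd 2} (hw : Good w) (hz : Good z)
    (hm : w.re ^ 2 - 2 * w.im ^ 2 = m) (hn : z.re ^ 2 - 2 * z.im ^ 2 = n) (hmn : IsCoprime m n) :
    Good (w * z) := by
  refine ⟨?_, ?_, ?_, ?_⟩
  · rw [mul_re']; exact U_pos hw.re_pos hz.re_pos hw.norm_pos hz.norm_pos
  · rw [norm_mul'']; exact mul_pos hw.norm_pos hz.norm_pos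
  · rw [mul_re']
    have h1 := hw.odd
    have h2 := hz.odd
    have : (w.re * z.re) % 2 = 1 := by rw [Int.mul_emod, h1, h2]; rfl
    have e : 2 * w.im * z.im = 2 * (w.im * z.im) := by ring
    omega
  · rw [mul_re', mul_im']
    obtain ⟨x, y, h1⟩ := hw.cop
    obtain ⟨x', y', h2⟩ := hz.cop
    obtain ⟨s, t, h3⟩ := hmn
    generalize w.re = a at *
    generalize w.im = b at *
    generalize z.re = c at *
    generalize z.im = d at *
    have e1 : (x * c - y * d) * (a * c + 2 * b * d) + (y * c - 2 * x * d) * (a * d + b * c) = n := by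
      linear_combination (c ^ 2 - 2 * d ^ 2) * h1 + hn
    have e2 : (x' * a - y' * b) * (a * c + 2 * b * d) + (y' * a - 2 * x' * b) * (a * d + b * c) = m := by
      linear_combination (a ^ 2 - 2 * b ^ 2) * h2 + hm
    exact ⟨s * (x' * a - y' * b) + t * (x * c - y * d), s * (y' * a - 2 * x' * b) + t * (y * c - 2 * x * d),
      by linear_combination h3 + s * e2 + t * e1⟩

lemma rel_mul_left {m : ℤ} {w z : Zsqrtd 2} (hm : w.re ^ 2 - 2 * w.im ^ 2 = m) : Rel m (w * z) w := by
  unfold Rel; rw [mul_re', mul_im']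
  exact ⟨-z.im, by rw [← hm]; ring⟩

lemma rel_mul_right {n : ℤ} {w z : Zsqrtd 2} (hn : z.re ^ 2 - 2 * z.im ^ 2 = n) : Rel n (w * z) z := by
  unfold Rel; rw [mul_re', mul_im']
  exact ⟨-w.im, by rw [← hn]; ring⟩

theorem sum_sp_mul {m n : ℕ} (hm : m % 2 = 1) (hn : n % 2 = 1) (hmn : m.Coprime n) (h7 : (m * n) % 8 = 7) :
    ∑ w ∈ Dn (m * n), sp w = ∑ w ∈ Dn m, ∑ z ∈ Dn n, sp (w * z) := by
  classical
  have hmn2 : (m * n) % 2 = 1 := by rw [Nat.mul_mod, hm, hn]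
  have hmnZ : IsCoprime (m:ℤ) (n:ℤ) := Nat.isCoprime_iff_coprime.mpr hmn
  have ex : ∀ p ∈ Dn m ×ˢ Dn n, ∃ z ∈ Dn (m * n), Rel (m * n : ℕ) (p.1 * p.2) z ∧ sp z = sp (p.1 * p.2) := by
    intro p hp
    rw [Finset.mem_product] at hp
    obtain ⟨-, -, -, h1⟩ := mem_Dn.mp hp.1
    obtain ⟨-, -, -, h2⟩ := mem_Dn.mp hp.2
    obtain ⟨z, hz, hr, hs⟩ := exists_red hmn2 (p.1 * p.2)
      (good_mul (good_of_mem hm hp.1) (good_of_mem hn hp.2) h1 h2 hmnZ)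
      (by rw [norm_mul'', h1, h2]; push_cast; rfl)
    exact ⟨z, hz, hr, hs h7⟩
  choose f hf hr hs using ex
  have relm : ∀ p hp, Rel m p.1 (f p hp) := by
    intro p hp
    have hp' := Finset.mem_product.mp hp
    obtain ⟨-, -, -, h1⟩ := mem_Dn.mp hp'.1
    obtain ⟨-, -, -, h2⟩ := mem_Dn.mp hp'.2
    have g := good_mul (good_of_mem hm hp'.1) (good_of_mem hn hp'.2) h1 h2 hmnZ
    have c := cop_im (n := (m:ℤ) * n) g.cop (by rw [norm_mul'', h1, h2])
    refine Rel.trans (z := p.1 * p.2) (c.of_isCoprime_of_dvd_right (dvd_mul_right _ _)) (rel_mul_left h1).symm ?_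
    exact (Dvd.intro _ (by push_cast; rfl)).trans (hr p hp)
  have reln : ∀ p hp, Rel n p.2 (f p hp) := by
    intro p hp
    have hp' := Finset.mem_product.mp hp
    obtain ⟨-, -, -, h1⟩ := mem_Dn.mp hp'.1
    obtain ⟨-, -, -, h2⟩ := mem_Dn.mp hp'.2
    have g := good_mul (good_of_mem hm hp'.1) (good_of_mem hn hp'.2) h1 h2 hmnZ
    have c := cop_im (n := (m:ℤ) * n) g.cop (by rw [norm_mul'', h1, h2])
    refine Rel.trans (z := p.1 * p.2) (c.of_isCoprime_of_dvd_right (dvd_mul_left _ _)) (rel_mul_right h2).symm ?_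
    exact (Dvd.intro_left _ (by push_cast; rfl)).trans (hr p hp)
  rw [← Finset.sum_product']
  symm
  refine Finset.sum_bij f hf ?_ ?_ (fun p hp => (hs p hp).symm)
  · intro p hp q hq hpq
    have hp' := Finset.mem_product.mp hp
    have hq' := Finset.mem_product.mp hq
    obtain ⟨-, -, h3, h4⟩ := mem_Dn.mp (hf p hp)
    have c := cop_im h3 h4
    push_cast at c
    have e1 := (relm q hq).symm
    have e2 := (reln q hq).symm
    rw [← hpq] at e1 e2
    ext1
    · exact Dn_inj hp'.1 hq'.1 ((relm p hp).trans (c.of_isCoprime_of_dvd_right (dvd_mul_right _ _)) e1)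
    · exact Dn_inj hp'.2 hq'.2 ((reln p hp).trans (c.of_isCoprime_of_dvd_right (dvd_mul_left _ _)) e2)
  · intro z hz
    obtain ⟨-, -, h3, h4⟩ := mem_Dn.mp hz
    have c := cop_im h3 h4
    push_cast at c h4
    obtain ⟨w1, hw1, r1⟩ := thue hm z.re z.im (c.of_isCoprime_of_dvd_right (dvd_mul_right _ _))
      (by rw [h4]; exact dvd_mul_right _ _)
    obtain ⟨w2, hw2, r2⟩ := thue hn z.re z.im (c.of_isCoprime_of_dvd_right (dvd_mul_left _ _))
      (by rw [h4]; exact dvd_mul_left _ _)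
    have hp : (w1, w2) ∈ Dn m ×ˢ Dn n := Finset.mem_product.mpr ⟨hw1, hw2⟩
    refine ⟨(w1, w2), hp, ?_⟩
    apply (Dn_inj hz (hf _ hp) _).symm
    obtain ⟨-, -, c1, h1⟩ := mem_Dn.mp hw1
    obtain ⟨-, -, c2, h2⟩ := mem_Dn.mp hw2
    unfold Rel; push_cast
    apply hmnZ.mul_dvd
    · exact Rel.trans (w := z) (z := w1) (cop_im c1 h1) r1 (relm _ hp)
    · exact Rel.trans (w := z) (z := w2) (cop_im c2 h2) r2 (reln _ hp)

lemma dich {n : ℤ} {a b c d : ℤ} (h1 : a ^ 2 - 2 * b ^ 2 = n) (h2 : c ^ 2 - 2 * d ^ 2 = n) :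
    n ∣ (a * d - c * b) * (a * d + c * b) :=
  ⟨d ^ 2 - b ^ 2, by linear_combination d ^ 2 * h1 - b ^ 2 * h2⟩

theorem card_Dn_le {n : ℕ} (hn : n % 2 = 1) : (Dn n).card ≤ n.divisors.card := by
  classical
  rcases (Dn n).eq_empty_or_nonempty with h | ⟨w0, hw0⟩
  · rw [h]; simp
  obtain ⟨-, -, c0, h0⟩ := mem_Dn.mp hw0
  have g0 := good_of_mem hn hw0
  apply Finset.card_le_card_of_injOn (fun w => Int.gcd n (w.re * w0.im - w0.re * w.im))
  · intro w _
    simp only [Finset.mem_coe, Nat.mem_divisors]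
    refine ⟨?_, by omega⟩
    exact_mod_cast Int.gcd_dvd_left (n:ℤ) (w.re * w0.im - w0.re * w.im)
  · intro w hw z hz hg
    simp only at hg
    rw [Finset.mem_coe] at hw hz
    have key : ∀ w ∈ Dn n, ∀ g : ℕ, Int.gcd n (w.re * w0.im - w0.re * w.im) = g → ∀ h : ℤ, (n:ℤ) = h * g →
        (g:ℤ) ∣ w.re * w0.im - w0.re * w.im ∧ h ∣ w.re * w0.im + w0.re * w.im ∧ IsCoprime (g:ℤ) h := by
      intro w hw g hgc h hh
      have gw := good_of_mem hn hw
      obtain ⟨-, -, c1, h1⟩ := mem_Dn.mp hw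
      have hpos : 0 < Int.gcd n (w.re * w0.im - w0.re * w.im) := Int.gcd_pos_of_ne_zero_left _ (by omega)
      obtain ⟨n', x', hc, hn', hx'⟩ := Int.exists_gcd_one hpos
      rw [hgc] at hn' hx' hpos
      have hh' : h = n' := by
        have : h * (g:ℤ) = n' * g := by rw [← hh, ← hn']
        exact mul_right_cancel₀ (by omega) this
      subst hh'
      have d1 : h ∣ w.re * w0.im + w0.re * w.im := by
        have hd := dich h1 h0
        rw [hx', hh] at hd
        have : (g:ℤ) * h ∣ g * (x' * (w.re * w0.im + w0.re * w.im)) := by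
          convert hd using 1 <;> ring
        have := (mul_dvd_mul_iff_left (by omega)).mp this
        exact (Int.isCoprime_iff_gcd_eq_one.mpr hc).dvd_of_dvd_mul_left this
      refine ⟨⟨x', by rw [hx']; ring⟩, d1, ?_⟩
      have e : IsCoprime (2 * (w.re * w0.im)) (n:ℤ) := by
        refine IsCoprime.mul_left ⟨-((n:ℤ) / 2), 1, by omega⟩ (IsCoprime.mul_left ?_ (cop_im c0 h0))
        exact cop_re c1 h1 gw.odd
      obtain ⟨p, q, hpq⟩ := e
      obtain ⟨y', hy'⟩ := d1
      refine ⟨p * x' + q * h, p * y', ?_⟩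
      linear_combination hpq - p * hx' - p * hy' - q * hh
    obtain ⟨h, hh⟩ : ((Int.gcd n (w.re * w0.im - w0.re * w.im) : ℕ) : ℤ) ∣ n := Int.gcd_dvd_left ..
    obtain ⟨a1, a2, a3⟩ := key w hw _ rfl h (by rw [mul_comm]; exact hh)
    obtain ⟨b1, b2, -⟩ := key z hz _ hg.symm h (by rw [mul_comm]; exact hh)
    apply Dn_inj hw hz
    have hci := cop_im c0 h0
    unfold Rel
    rw [hh]
    apply a3.mul_dvd
    · refine Rel.trans (w := w) (z := w0) (v := z) (hci.of_isCoprime_of_dvd_right ?_) a1 (Rel.symm b1)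
      exact Int.gcd_dvd_left ..
    · refine Rel.trans (w := w) (z := ⟨w0.re, -w0.im⟩) (v := z) ?_ ?_ (Rel.symm ?_)
      · exact (hci.neg_left).of_isCoprime_of_dvd_right ⟨_, by rw [mul_comm]; exact hh⟩
      · unfold Rel; simp only
        have e : w.re * -w0.im - w0.re * w.im = -(w.re * w0.im + w0.re * w.im) := by ring
        rw [e]; exact (dvd_neg).mpr a2
      · unfold Rel; simp only
        have e : z.re * -w0.im - w0.re * z.im = -(z.re * w0.im + w0.re * z.im) := by ring
        rw [e]; exact (dvd_neg).mpr b2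

noncomputable def Aa (n : ℕ) : ℤ := if n % 16 = 15 then ∑ w ∈ Dn n, sp w else 0

lemma abs_sp_le (w : Zsqrtd 2) : |sp w| ≤ 1 := abs_jac_le _ _

lemma abs_Aa_le (n : ℕ) : |Aa n| ≤ n.divisors.card := by
  unfold Aa
  split_ifs with h
  · calc |∑ w ∈ Dn n, sp w| ≤ ∑ w ∈ Dn n, |sp w| := Finset.abs_sum_le_sum_abs _ _
      _ ≤ ∑ w ∈ Dn n, 1 := Finset.sum_le_sum fun w _ => abs_sp_le w
      _ = (Dn n).card := by simp
      _ ≤ n.divisors.card := by exact_mod_cast card_Dn_le (by omega)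
  · simp

lemma conj_mem {n : ℕ} {w : Zsqrtd 2} (h : w ∈ Dn n) : (⟨w.re, -w.im⟩ : Zsqrtd 2) ∈ Dn n := by
  obtain ⟨h1, h2, h3, h4⟩ := mem_Dn.mp h
  exact mem_Dn.mpr ⟨h1, by simpa using h2, by simpa using h3.neg_right, by simpa using h4⟩

theorem Aa_prime {p : ℕ} (hp : p.Prime) (h15 : p % 16 = 15) : ∃ s : ℤ, (s = 1 ∨ s = -1) ∧ Aa p = 2 * s ∧
    (∃ u v : ℕ, 0 < u ∧ 0 < v ∧ (p : ℤ) = u ^ 2 - 2 * v ^ 2) ∧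
    ∀ u v : ℕ, 0 < u → 0 < v → (p : ℤ) = u ^ 2 - 2 * v ^ 2 → jacobiSym (2 * u) v = s := by
  classical
  have : Fact p.Prime := ⟨hp⟩
  have hp2 : p % 2 = 1 := by omega
  obtain ⟨r, hr⟩ := (ZMod.exists_sq_eq_two_iff (p := p) (by omega)).mpr (by omega)
  have hdiv : (p:ℤ) ∣ (r.val : ℤ) ^ 2 - 2 * 1 ^ 2 := by
    rw [← ZMod.intCast_zmod_eq_zero_iff_dvd]
    push_cast
    rw [ZMod.natCast_zmod_val, hr]; ring
  obtain ⟨z, hz, -⟩ := thue hp2 (r.val : ℤ) 1 isCoprime_one_left hdiv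
  have gz := good_of_mem hp2 hz
  obtain ⟨z1, z2, z3, z4⟩ := mem_Dn.mp hz
  have hzo : z.im % 2 = 1 := by
    by_contra hb
    have := (norm_mod z.re z.im gz.odd).2 (by omega)
    omega
  have hz' := conj_mem hz
  have spc : sp ⟨z.re, -z.im⟩ = sp z := by simp [sp]
  have hD : ∀ w ∈ Dn p, w = z ∨ w = ⟨z.re, -z.im⟩ := by
    intro w hw
    obtain ⟨-, -, w3, w4⟩ := mem_Dn.mp hw
    rcases (Nat.prime_iff_prime_int.mp hp).dvd_or_dvd (dich w4 z4) with h | h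
    · left; exact Dn_inj hw hz h
    · right; apply Dn_inj hw hz'
      unfold Rel; simp only
      rw [← dvd_neg]; convert h using 1; ring
  have hne : z ≠ ⟨z.re, -z.im⟩ := by
    intro h
    have := congrArg Zsqrtd.im h
    simp only at this
    omega
  have hDn : Dn p = {z, ⟨z.re, -z.im⟩} := by
    ext w
    simp only [Finset.mem_insert, Finset.mem_singleton]
    exact ⟨hD w, by rintro (rfl | rfl) <;> assumption⟩
  refine ⟨sp z, ?_, ?_, ?_, ?_⟩
  · have : sp z * sp z = 1 := by
      unfold sp
      apply jac_sq_one
      exact IsCoprime.mul_left ⟨-(z.im / 2), 1, by omega⟩ z3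
    exact mul_self_eq_one_iff.mp this
  · unfold Aa
    rw [if_pos h15, hDn, Finset.sum_pair hne, spc]; ring
  · refine ⟨z.re.natAbs, z.im.natAbs, by omega, by omega, ?_⟩
    rw [Int.natCast_natAbs, Int.natCast_natAbs, sq_abs, sq_abs, z4]
  · intro u v hu hv huv
    have cop : IsCoprime (u:ℤ) (v:ℤ) := by
      rw [Nat.isCoprime_iff_coprime]
      by_contra hc
      obtain ⟨q, hq, hqu, hqv⟩ := Nat.Prime.not_coprime_iff_dvd.mp hc
      obtain ⟨u', rfl⟩ := hqu
      obtain ⟨v', rfl⟩ := hqv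
      have : ((q * q : ℕ):ℤ) ∣ (p:ℤ) := ⟨u' ^ 2 - 2 * v' ^ 2, by rw [huv]; push_cast; ring⟩
      have h1 : q * q ∣ p := by exact_mod_cast this
      have h2 : q = p := (Nat.prime_dvd_prime_iff_eq hq hp).mp ((dvd_mul_right q q).trans h1)
      subst h2
      have := Nat.le_of_dvd hp.pos h1
      have := hp.two_le
      nlinarith
    have g : Good (⟨u, v⟩ : Zsqrtd 2) := ⟨by simpa using hu, by simp only; rw [← huv]; exact_mod_cast hp.pos,
      odd_re hp2 huv.symm, cop⟩
    obtain ⟨w, hw, -, hs⟩ := exists_red hp2 _ g huv.symm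
    have e := hs (by omega)
    have e2 : sp ⟨u, v⟩ = jacobiSym (2 * u) v := by simp [sp]
    rw [← e2, ← e]
    rcases hD w hw with rfl | rfl
    · rfl
    · exact spc

end QSpin

namespace QSpin

/-- divisor bound -/
theorem tau_bound (ε : ℝ) (hε : 0 < ε) : ∃ C : ℝ, 1 ≤ C ∧ ∀ n : ℕ, n ≠ 0 → (n.divisors.card : ℝ) ≤ C * (n:ℝ) ^ ε := by
  classical
  obtain ⟨P, hP⟩ := exists_nat_ge ((2:ℝ) ^ (1 / ε))
  have hl2 : 0 < Real.log 2 := Real.log_pos (by norm_num)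
  set c : ℝ := 1 + 1 / (ε * Real.log 2) with hc
  have hc1 : 1 ≤ c := by
    have : 0 < 1 / (ε * Real.log 2) := by positivity
    linarith
  have hprime : ∀ p : ℕ, p.Prime → ∀ a : ℕ, ((a + 1 : ℕ) : ℝ) ≤ (if p < P then c else 1) * ((p:ℝ) ^ a) ^ ε := by
    intro p hp a
    have hp2 : (2:ℝ) ≤ p := by exact_mod_cast hp.two_le
    have hrw : ((p:ℝ) ^ a) ^ ε = ((p:ℝ) ^ ε) ^ a := by
      rw [← Real.rpow_natCast, ← Real.rpow_mul (by linarith), mul_comm, Real.rpow_mul (by linarith), Real.rpow_natCast]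
    rw [hrw]
    push_cast
    split_ifs with h
    · have h1 : (1 + ε * Real.log 2) ≤ (p:ℝ) ^ ε := by
        calc 1 + ε * Real.log 2 ≤ Real.exp (Real.log 2 * ε) := by
              have := Real.add_one_le_exp (Real.log 2 * ε); linarith
          _ = 2 ^ ε := by rw [Real.rpow_def_of_pos (by norm_num)]
          _ ≤ _ := Real.rpow_le_rpow (by norm_num) hp2 hε.le
      have h2 : 1 + a * (ε * Real.log 2) ≤ ((p:ℝ) ^ ε) ^ a := by
        calc 1 + a * (ε * Real.log 2) ≤ (1 + ε * Real.log 2) ^ a := by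
              apply one_add_mul_le_pow
              have : 0 < ε * Real.log 2 := by positivity
              linarith
          _ ≤ _ := pow_le_pow_left₀ (by positivity) h1 a
      have hpos : 0 < ε * Real.log 2 := by positivity
      calc (a:ℝ) + 1 ≤ c * (1 + a * (ε * Real.log 2)) := by
            rw [hc]
            have e : (1 + 1 / (ε * Real.log 2)) * (1 + a * (ε * Real.log 2)) =
              a + 1 + (1 / (ε * Real.log 2) + a * (ε * Real.log 2)) := by field_simp; ring
            rw [e]
            have : 0 ≤ 1 / (ε * Real.log 2) + a * (ε * Real.log 2) := by positivity
            linarith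
        _ ≤ _ := mul_le_mul_of_nonneg_left h2 (by linarith)
    · have h1 : (2:ℝ) ≤ (p:ℝ) ^ ε := by
        have hpP : (2:ℝ) ^ (1 / ε) ≤ p := hP.trans (by exact_mod_cast not_lt.mp h)
        calc (2:ℝ) = ((2:ℝ) ^ (1 / ε)) ^ ε := by
              rw [← Real.rpow_mul (by norm_num), one_div, inv_mul_cancel₀ hε.ne', Real.rpow_one]
          _ ≤ _ := Real.rpow_le_rpow (by positivity) hpP hε.le
      rw [one_mul]
      calc (a:ℝ) + 1 ≤ 2 ^ a := by
            have := one_add_mul_le_pow (a := (1:ℝ)) (by norm_num) a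
            norm_num at this; linarith
        _ ≤ _ := pow_le_pow_left₀ (by norm_num) h1 a
  refine ⟨c ^ P, one_le_pow₀ hc1, fun n hn => ?_⟩
  rw [Nat.card_divisors hn]
  push_cast
  calc ∏ x ∈ n.primeFactors, ((n.factorization x : ℝ) + 1)
      ≤ ∏ x ∈ n.primeFactors, ((if x < P then c else 1) * ((x:ℝ) ^ (n.factorization x)) ^ ε) := by
        apply Finset.prod_le_prod (fun _ _ => by positivity)
        intro p hp
        have := hprime p (Nat.prime_of_mem_primeFactors hp) (n.factorization p)
        push_cast at this; exact this
    _ = (∏ x ∈ n.primeFactors, (if x < P then c else 1)) * (∏ x ∈ n.primeFactors, ((x:ℝ) ^ (n.factorization x))) ^ ε := by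
        rw [Finset.prod_mul_distrib, Real.finsetProd_rpow _ _ (fun _ _ => by positivity)]
    _ ≤ c ^ P * (n:ℝ) ^ ε := by
        have e : ∏ x ∈ n.primeFactors, ((x:ℝ) ^ (n.factorization x)) = n := by
          have := Nat.prod_factorization_pow_eq_self hn
          rw [Finsupp.prod, Nat.support_factorization] at this
          exact_mod_cast this
        rw [e]
        apply mul_le_mul_of_nonneg_right _ (by positivity)
        rw [Finset.prod_ite, Finset.prod_const, Finset.prod_const_one, mul_one]
        apply pow_le_pow_right₀ hc1
        calc _ ≤ (Finset.range P).card := Finset.card_le_card (by intro x; simp)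
          _ = P := by simp

theorem holder {ι κ ω : Type*} [DecidableEq ω] (N : Finset ι) (M : Finset κ) (W : Finset ω)
    (α : κ → ℝ) (χ : κ → ι → ℝ) (X : ω → ι → ℝ) (pr : (Fin 6 → κ) → ω) (R : ℝ)
    (hα : ∀ m ∈ M, |α m| ≤ 1) (hpr : ∀ t : Fin 6 → κ, (∀ i, t i ∈ M) → pr t ∈ W)
    (hR : ∀ w ∈ W, (((Fintype.piFinset (fun _ : Fin 6 => M)).filter (fun t => pr t = w)).card : ℝ) ≤ R)
    (hX : ∀ t : Fin 6 → κ, (∀ i, t i ∈ M) → ∀ n ∈ N, ∏ i, χ (t i) n = X (pr t) n) :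
    (∑ n ∈ N, |∑ m ∈ M, α m * χ m n|) ^ 12 ≤ (N.card : ℝ) ^ 10 *
      (R * (M.card : ℝ) ^ 6 * ∑ n ∈ N, ∑ n' ∈ N, |∑ w ∈ W, X w n * X w n'|) := by
  classical
  set S : ι → ℝ := fun n => ∑ m ∈ M, α m * χ m n with hS
  set PF := Fintype.piFinset (fun _ : Fin 6 => M) with hPF
  set c : ω → ℝ := fun w => ∑ t ∈ PF.filter (fun t => pr t = w), ∏ i, α (t i) with hc
  have memPF : ∀ t, t ∈ PF ↔ ∀ i, t i ∈ M := by intro t; simp [hPF]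
  have hαt : ∀ t ∈ PF, |∏ i, α (t i)| ≤ 1 := by
    intro t ht
    rw [Finset.abs_prod]
    exact Finset.prod_le_one (fun _ _ => abs_nonneg _) (fun i _ => hα _ ((memPF t).mp ht i))
  have h6 : ∀ n ∈ N, S n ^ 6 = ∑ w ∈ W, c w * X w n := by
    intro n hn
    have e1 : S n ^ 6 = ∏ _i : Fin 6, ∑ m ∈ M, α m * χ m n := by simp [hS]
    rw [e1, Finset.prod_univ_sum]
    rw [← Finset.sum_fiberwise_of_maps_to (t := W) (g := pr) (fun t ht => hpr t ((memPF t).mp ht))]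
    apply Finset.sum_congr rfl
    intro w _
    rw [hc, Finset.sum_mul]
    apply Finset.sum_congr rfl
    intro t ht
    rw [Finset.mem_filter] at ht
    rw [Finset.prod_mul_distrib, hX t ((memPF t).mp ht.1) n hn, ht.2]
  have hcb : ∀ w ∈ W, |c w| ≤ R := by
    intro w hw
    refine le_trans ?_ (hR w hw)
    calc |c w| ≤ ∑ t ∈ PF.filter (fun t => pr t = w), |∏ i, α (t i)| := Finset.abs_sum_le_sum_abs _ _
      _ ≤ ∑ t ∈ PF.filter (fun t => pr t = w), 1 :=
        Finset.sum_le_sum fun t ht => hαt t (Finset.mem_filter.mp ht).1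
      _ = _ := by simp
  have hcs : ∑ w ∈ W, |c w| ≤ (M.card : ℝ) ^ 6 := by
    calc ∑ w ∈ W, |c w| ≤ ∑ w ∈ W, ∑ t ∈ PF.filter (fun t => pr t = w), (1:ℝ) := by
          apply Finset.sum_le_sum
          intro w _
          exact (Finset.abs_sum_le_sum_abs _ _).trans
            (Finset.sum_le_sum fun t ht => hαt t (Finset.mem_filter.mp ht).1)
      _ = ∑ t ∈ PF, (1:ℝ) := Finset.sum_fiberwise_of_maps_to (fun t ht => hpr t ((memPF t).mp ht)) _
      _ = _ := by simp [hPF]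
  set G : ω → ℝ := fun w => ∑ n ∈ N, X w n with hG
  have hsum : ∑ n ∈ N, S n ^ 6 = ∑ w ∈ W, c w * G w := by
    rw [Finset.sum_congr rfl h6, Finset.sum_comm]
    apply Finset.sum_congr rfl
    intro w _; rw [hG, Finset.mul_sum]
  have hG2 : ∑ w ∈ W, G w ^ 2 ≤ ∑ n ∈ N, ∑ n' ∈ N, |∑ w ∈ W, X w n * X w n'| := by
    have : ∑ w ∈ W, G w ^ 2 = ∑ n ∈ N, ∑ n' ∈ N, ∑ w ∈ W, X w n * X w n' := by
      have e : ∀ w, G w ^ 2 = ∑ n ∈ N, ∑ n' ∈ N, X w n * X w n' := by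
        intro w; rw [hG, sq, Finset.sum_mul_sum]
      simp_rw [e]
      rw [Finset.sum_comm]
      apply Finset.sum_congr rfl
      intro n _
      rw [Finset.sum_comm]
    rw [this]
    exact Finset.sum_le_sum fun n _ => Finset.sum_le_sum fun n' _ => le_abs_self _
  have hCS : (∑ n ∈ N, S n ^ 6) ^ 2 ≤ R * (M.card : ℝ) ^ 6 * ∑ n ∈ N, ∑ n' ∈ N, |∑ w ∈ W, X w n * X w n'| := by
    rw [hsum]
    refine (Finset.sum_mul_sq_le_sq_mul_sq W c G).trans ?_
    by_cases hW : W.Nonempty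
    · obtain ⟨w0, hw0⟩ := hW
      have hR0 : 0 ≤ R := (abs_nonneg _).trans (hcb w0 hw0)
      apply mul_le_mul _ hG2 (Finset.sum_nonneg fun _ _ => sq_nonneg _) (by positivity)
      calc ∑ w ∈ W, c w ^ 2 ≤ ∑ w ∈ W, R * |c w| := by
            apply Finset.sum_le_sum
            intro w hw
            rw [← sq_abs, sq]
            exact mul_le_mul_of_nonneg_right (hcb w hw) (abs_nonneg _)
        _ = R * ∑ w ∈ W, |c w| := by rw [Finset.mul_sum]
        _ ≤ _ := mul_le_mul_of_nonneg_left hcs hR0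
    · rw [Finset.not_nonempty_iff_eq_empty] at hW
      simp [hW]
  have hH : (∑ n ∈ N, |S n|) ^ 6 ≤ (N.card : ℝ) ^ 5 * ∑ n ∈ N, S n ^ 6 := by
    have h := pow_sum_div_card_le_sum_pow (s := N) (f := fun n => |S n|) (n := 5) (fun _ _ => abs_nonneg _)
    have e : ∀ n, |S n| ^ (5 + 1) = S n ^ 6 := by intro n; exact Even.pow_abs (by decide) _
    simp_rw [e] at h
    by_cases hN : N.Nonempty
    · have : (0:ℝ) < (N.card : ℝ) ^ 5 := by
        have := hN.card_pos
        positivity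
      rw [div_le_iff₀ this, mul_comm] at h
      exact h
    · rw [Finset.not_nonempty_iff_eq_empty] at hN
      simp [hN]
  calc (∑ n ∈ N, |S n|) ^ 12 = ((∑ n ∈ N, |S n|) ^ 6) ^ 2 := by ring
    _ ≤ ((N.card : ℝ) ^ 5 * ∑ n ∈ N, S n ^ 6) ^ 2 :=
      pow_le_pow_left₀ (pow_nonneg (Finset.sum_nonneg fun _ _ => abs_nonneg _) _) hH 2
    _ = (N.card : ℝ) ^ 10 * (∑ n ∈ N, S n ^ 6) ^ 2 := by ring
    _ ≤ _ := mul_le_mul_of_nonneg_left hCS (by positivity)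

end QSpin

namespace QSpin

lemma exists_nonres {q : ℕ} (hq : q % 2 = 1) (hs : ¬ IsSquare q) : ∃ t : ℤ, jacobiSym t q = -1 := by
  have hq0 : q ≠ 0 := by omega
  obtain ⟨l, hl, hodd⟩ : ∃ l : ℕ, l.Prime ∧ (q.factorization l) % 2 = 1 := by
    by_contra hc
    push Not at hc
    apply hs
    refine ⟨∏ p ∈ q.primeFactors, p ^ (q.factorization p / 2), ?_⟩
    rw [← Finset.prod_mul_distrib]
    conv_lhs => rw [← Nat.prod_factorization_pow_eq_self hq0]
    rw [Finsupp.prod, Nat.support_factorization]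
    apply Finset.prod_congr rfl
    intro p hp
    rw [← pow_add]
    congr 1
    have := hc p (Nat.prime_of_mem_primeFactors hp)
    omega
  have : Fact l.Prime := ⟨hl⟩
  set e := q.factorization l with he
  set r := ordCompl[l] q with hr
  have hqe : l ^ e * r = q := Nat.ordProj_mul_ordCompl_eq_self q l
  have hlq : l ∣ q := by
    rw [← hqe]
    exact (dvd_pow_self l (by omega)).mul_right _
  have hl2 : l ≠ 2 := by rintro rfl; omega
  have hcop : l.Coprime r := Nat.coprime_ordCompl hl hq0
  obtain ⟨a, ha⟩ := FiniteField.exists_nonsquare (F := ZMod l) (by rw [ZMod.ringChar_zmod_n]; exact hl2)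
  obtain ⟨t, ht1, ht2⟩ := Nat.chineseRemainder hcop a.val 1
  refine ⟨t, ?_⟩
  have hr0 : r ≠ 0 := by rintro h0; rw [h0, mul_zero] at hqe; omega
  have : NeZero r := ⟨hr0⟩
  have : NeZero (l ^ e) := ⟨pow_ne_zero _ hl.ne_zero⟩
  rw [← hqe, jacobiSym.mul_right, jacobiSym.pow_right]
  have h1 : jacobiSym t l = -1 := by
    rw [← jacobiSym.legendreSym.to_jacobiSym, legendreSym.eq_neg_one_iff]
    have : ((t : ℤ) : ZMod l) = a := by
      rw [Int.cast_natCast, (ZMod.natCast_eq_natCast_iff _ _ _).mpr ht1, ZMod.natCast_zmod_val]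
    rw [this]; exact ha
  have h2 : jacobiSym t r = 1 := by
    rw [jacobiSym.mod_left' (a₂ := 1) (by exact_mod_cast ht2), jacobiSym.one_left]
  rw [h1, h2, mul_one]
  exact Odd.neg_one_pow (Nat.odd_iff.mpr hodd)

lemma period_shift (q : ℕ) (g : ℤ → ℝ) (hper : ∀ x, g (x + q) = g x) (a : ℤ) :
    ∑ i ∈ Finset.range q, g (a + i) = ∑ i ∈ Finset.range q, g i := by
  have step : ∀ a : ℤ, ∑ i ∈ Finset.range q, g (a + 1 + i) = ∑ i ∈ Finset.range q, g (a + i) := by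
    intro a
    have h1 := Finset.sum_range_succ (fun i : ℕ => g (a + i)) q
    have h2 := Finset.sum_range_succ' (fun i : ℕ => g (a + i)) q
    rw [h1] at h2
    rw [hper a] at h2
    simp only [Nat.cast_zero, add_zero] at h2
    have h3 := add_right_cancel h2
    rw [h3]
    apply Finset.sum_congr rfl
    intro i _; congr 1; push_cast; ring
  induction a using Int.induction_on with
  | zero => simp
  | succ n ih => rw [step]; exact ih
  | pred n ih => rw [← ih, ← step]; simp

lemma incomplete (q : ℕ) (hq : 0 < q) (g : ℤ → ℝ) (hper : ∀ x, g (x + q) = g x) (B : ℝ)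
    (hB : ∀ x, |g x| ≤ B) (a : ℤ) (l : ℕ) :
    |∑ i ∈ Finset.range l, g (a + i) - (l / q : ℕ) * ∑ i ∈ Finset.range q, g i| ≤ q * B := by
  have main : ∀ k r : ℕ, ∑ i ∈ Finset.range (r + q * k), g (a + i) =
      ∑ i ∈ Finset.range r, g (a + i) + k * ∑ i ∈ Finset.range q, g i := by
    intro k r
    induction k with
    | zero => simp
    | succ k ih =>
      rw [show r + q * (k + 1) = (r + q * k) + q by ring, Finset.sum_range_add, ih]
      have : ∑ x ∈ Finset.range q, g (a + ((r + q * k + x : ℕ) : ℤ)) = ∑ i ∈ Finset.range q, g i := by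
        rw [← period_shift q g hper (a + (r + q * k : ℕ))]
        apply Finset.sum_congr rfl
        intro i _; congr 1; push_cast; ring
      rw [this]; push_cast; ring
  have h := main (l / q) (l % q)
  rw [Nat.mod_add_div] at h
  rw [h, add_sub_cancel_right]
  have hB0 : 0 ≤ B := (abs_nonneg _).trans (hB 0)
  calc |∑ i ∈ Finset.range (l % q), g (a + i)| ≤ ∑ i ∈ Finset.range (l % q), |g (a + i)| :=
        Finset.abs_sum_le_sum_abs _ _
    _ ≤ ∑ i ∈ Finset.range (l % q), B := Finset.sum_le_sum fun _ _ => hB _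
    _ = (l % q : ℕ) * B := by simp
    _ ≤ q * B := by
      apply mul_le_mul_of_nonneg_right _ hB0
      exact_mod_cast (Nat.mod_lt _ hq).le

lemma incomplete2 (q : ℕ) (hq : 0 < q) (f : ℤ → ℤ → ℝ) (h1 : ∀ x y, f (x + q) y = f x y)
    (h2 : ∀ x y, f x (y + q) = f x y) (hB : ∀ x y, |f x y| ≤ 1)
    (h0 : ∑ i ∈ Finset.range q, ∑ j ∈ Finset.range q, f i j = 0) (a : ℤ) (l : ℕ) :
    |∑ i ∈ Finset.range l, ∑ j ∈ Finset.range l, f (a + i) (a + j)| ≤ 2 * q * l := by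
  set h : ℤ → ℝ := fun x => ∑ j ∈ Finset.range q, f x j with hh
  have e1 : ∀ x, |∑ j ∈ Finset.range l, f x (a + j) - (l / q : ℕ) * h x| ≤ q := by
    intro x
    have := incomplete q hq (f x) (h2 x) 1 (hB x) a l
    rwa [mul_one] at this
  have hhb : ∀ x, |h x| ≤ q := by
    intro x
    calc |h x| ≤ ∑ j ∈ Finset.range q, |f x j| := Finset.abs_sum_le_sum_abs _ _
      _ ≤ ∑ j ∈ Finset.range q, 1 := Finset.sum_le_sum fun _ _ => hB _ _
      _ = q := by simp
  have e2 := incomplete q hq h (by intro x; simp only [hh]; exact Finset.sum_congr rfl fun _ _ => h1 _ _) q hhb a l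
  have h0' : ∑ i ∈ Finset.range q, h i = 0 := h0
  rw [h0', mul_zero, sub_zero] at e2
  have hk : ((l / q : ℕ) : ℝ) * q ≤ l := by exact_mod_cast Nat.div_mul_le_self l q
  have e3 : ∑ i ∈ Finset.range l, ∑ j ∈ Finset.range l, f (a + i) (a + j) =
      ∑ i ∈ Finset.range l, (∑ j ∈ Finset.range l, f (a + i) (a + j) - (l / q : ℕ) * h (a + i)) +
      (l / q : ℕ) * ∑ i ∈ Finset.range l, h (a + i) := by
    rw [Finset.sum_sub_distrib, Finset.mul_sum]; ring
  rw [e3]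
  calc _ ≤ |∑ i ∈ Finset.range l, (∑ j ∈ Finset.range l, f (a + i) (a + j) - (l / q : ℕ) * h (a + i))| +
        |(l / q : ℕ) * ∑ i ∈ Finset.range l, h (a + i)| := abs_add_le _ _
    _ ≤ l * q + (l / q : ℕ) * (q * q) := by
      apply add_le_add
      · calc _ ≤ ∑ i ∈ Finset.range l, |∑ j ∈ Finset.range l, f (a + i) (a + j) - (l / q : ℕ) * h (a + i)| :=
              Finset.abs_sum_le_sum_abs _ _
          _ ≤ ∑ i ∈ Finset.range l, (q:ℝ) := Finset.sum_le_sum fun _ _ => e1 _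
          _ = l * q := by simp
      · rw [abs_mul, abs_of_nonneg (by positivity)]
        exact mul_le_mul_of_nonneg_left e2 (by positivity)
    _ ≤ 2 * q * l := by
      have : (0:ℝ) ≤ q := by positivity
      nlinarith

lemma jac_period (q : ℕ) (x : ℤ) : jacobiSym (x + q) q = jacobiSym x q :=
  jacobiSym.mod_left' (by simp)

/-- full sums vanish by scaling: one dimensional -/
lemma scale_sum {q : ℕ} (hq : 0 < q) (g : ℤ → ℝ) (hper : ∀ x, g (x + q) = g x) (t s : ℤ)
    (hts : t * s % q = 1 % q) :
    ∑ i ∈ Finset.range q, g (t * i) = ∑ i ∈ Finset.range q, g i := by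
  have hperk : ∀ (k : ℕ) x, g (x + q * k) = g x := by
    intro k x
    induction k with
    | zero => simp
    | succ k ih => rw [← ih, ← hper (x + q * k)]; congr 1; push_cast; ring
  have hmod : ∀ x y : ℤ, x % q = y % q → g x = g y := by
    have hm : ∀ x : ℤ, g x = g (x % q) := by
      intro x
      rcases le_total 0 (x / q) with h | h
      · obtain ⟨k, hk⟩ := Int.eq_ofNat_of_zero_le h
        rw [← hperk k (x % q)]
        congr 1
        rw [← hk]; exact (Int.emod_add_mul_ediv x q).symm
      · obtain ⟨k, hk⟩ := Int.eq_ofNat_of_zero_le (neg_nonneg.mpr h)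
        rw [← hperk k x]
        congr 1
        rw [← hk]; have := Int.emod_add_mul_ediv x q; linarith
    intro x y h
    rw [hm x, hm y, h]
  have hqz : (q:ℤ) ≠ 0 := by omega
  refine Finset.sum_bij' (fun i _ => (t * i % q).toNat) (fun i _ => (s * i % q).toNat) ?_ ?_ ?_ ?_ ?_
  · intro i _
    have h1 := Int.emod_nonneg (t * i) hqz
    have h2 := Int.emod_lt_of_pos (t * i) (by omega : (0:ℤ) < q)
    rw [Finset.mem_range]; omega
  · intro i _
    have h1 := Int.emod_nonneg (s * i) hqz
    have h2 := Int.emod_lt_of_pos (s * i) (by omega : (0:ℤ) < q)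
    rw [Finset.mem_range]; omega
  · intro i hi
    rw [Finset.mem_range] at hi
    rw [Int.toNat_of_nonneg (Int.emod_nonneg _ hqz)]
    have : s * (t * i % q) % q = i := by
      have e : s * (t * i % q) ≡ i [ZMOD q] := by
        calc s * (t * i % q) ≡ s * (t * i) [ZMOD q] := (Int.mod_modEq _ _).mul_left _
          _ = (t * s) * i := by ring
          _ ≡ 1 * i [ZMOD q] := Int.ModEq.mul_right _ hts
          _ = i := one_mul _
      rw [e]; exact Int.emod_eq_of_lt (by omega) (by omega)
    rw [this]; simp
  · intro i hi
    rw [Finset.mem_range] at hi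
    rw [Int.toNat_of_nonneg (Int.emod_nonneg _ hqz)]
    have : t * (s * i % q) % q = i := by
      have e : t * (s * i % q) ≡ i [ZMOD q] := by
        calc t * (s * i % q) ≡ t * (s * i) [ZMOD q] := (Int.mod_modEq _ _).mul_left _
          _ = (t * s) * i := by ring
          _ ≡ 1 * i [ZMOD q] := Int.ModEq.mul_right _ hts
          _ = i := one_mul _
      rw [e]; exact Int.emod_eq_of_lt (by omega) (by omega)
    rw [this]; simp
  · intro i _
    rw [Int.toNat_of_nonneg (Int.emod_nonneg _ hqz)]
    exact hmod _ _ (Int.emod_emod_of_dvd _ dvd_rfl).symm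

lemma inv_of_jac {q : ℕ} {t : ℤ} (h : jacobiSym t q = -1) : ∃ s, t * s % q = 1 % q := by
  have hg : t.gcd q = 1 := by
    by_contra hc
    by_cases hq : q = 0
    · subst hq; simp at h
    · have : NeZero q := ⟨hq⟩
      rw [(jacobiSym.eq_zero_iff_not_coprime).mpr hc] at h; norm_num at h
  obtain ⟨a, b, hab⟩ := Int.isCoprime_iff_gcd_eq_one.mpr hg
  refine ⟨a, ?_⟩
  rw [← hab]
  rw [mul_comm t a]; simp

lemma jac_sum_zero {q : ℕ} (hq : q % 2 = 1) (hs : ¬ IsSquare q) :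
    ∑ i ∈ Finset.range q, ((jacobiSym i q : ℤ) : ℝ) = 0 := by
  obtain ⟨t, ht⟩ := exists_nonres hq hs
  obtain ⟨s, hts⟩ := inv_of_jac ht
  have := scale_sum (by omega : 0 < q) (fun x => ((jacobiSym x q : ℤ) : ℝ))
    (by intro x; simp only [jac_period]) t s hts
  simp only [jacobiSym.mul_left, ht] at this
  push_cast at this
  simp only [neg_mul, one_mul, Finset.sum_neg_distrib] at this
  linarith

lemma sq_pairs_card (X : ℕ) (Dv : ℝ) (hD : ∀ n : ℕ, n ≠ 0 → n ≤ X ^ 2 → (n.divisors.card : ℝ) ≤ Dv) :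
    ((((Finset.Icc 1 X) ×ˢ (Finset.Icc 1 X)).filter (fun p : ℕ × ℕ => IsSquare (p.1 * p.2))).card : ℝ) ≤ X * Dv := by
  classical
  have hsub : (((Finset.Icc 1 X) ×ˢ (Finset.Icc 1 X)).filter (fun p : ℕ × ℕ => IsSquare (p.1 * p.2))) ⊆
      (Finset.Icc 1 X).biUnion (fun s => ((s ^ 2).divisors).image (fun d => (d, s ^ 2 / d))) := by
    rintro ⟨a, b⟩ h
    simp only [Finset.mem_filter, Finset.mem_product, Finset.mem_Icc] at h
    obtain ⟨⟨⟨ha1, ha2⟩, hb1, hb2⟩, s, hs⟩ := h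
    simp only [Finset.mem_biUnion, Finset.mem_image, Finset.mem_Icc, Nat.mem_divisors, Prod.mk.injEq]
    have hs0 : 0 < s := by
      rcases Nat.eq_zero_or_pos s with rfl | h
      · have := Nat.mul_pos ha1 hb1; omega
      · exact h
    refine ⟨s, ⟨hs0, ?_⟩, a, ⟨⟨b, by rw [hs]; ring⟩, by positivity⟩, rfl, ?_⟩
    · by_contra hc
      push Not at hc
      have : a * b ≤ X * X := Nat.mul_le_mul ha2 hb2
      nlinarith
    · rw [sq, ← hs]; exact Nat.mul_div_cancel_left _ ha1
  calc _ ≤ ((Finset.biUnion (Finset.Icc 1 X) (fun s => ((s ^ 2).divisors).image (fun d => (d, s ^ 2 / d)))).card : ℝ) := by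
        exact_mod_cast Finset.card_le_card hsub
    _ ≤ ∑ s ∈ Finset.Icc 1 X, ((((s ^ 2).divisors).image (fun d => (d, s ^ 2 / d))).card : ℝ) := by
        exact_mod_cast Finset.card_biUnion_le
    _ ≤ ∑ s ∈ Finset.Icc 1 X, Dv := by
        apply Finset.sum_le_sum
        intro s hs
        rw [Finset.mem_Icc] at hs
        refine le_trans ?_ (hD (s ^ 2) (by have := hs.1; positivity) (Nat.pow_le_pow_left hs.2 2))
        exact_mod_cast Finset.card_image_le
    _ = _ := by simp

/-- the Type I kernel bound -/
theorem kernel1 (X : ℕ) (hX : 1 ≤ X) (Dv : ℝ) (hD : ∀ n : ℕ, n ≠ 0 → n ≤ X ^ 6 → (n.divisors.card : ℝ) ≤ Dv)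
    (α : ℕ → ℝ) (hα : ∀ u, |α u| ≤ 1) :
    (∑ B ∈ (Finset.Icc 1 X).filter (fun B => B % 2 = 1), |∑ u ∈ Finset.Icc 1 X, α u * (jacobiSym u B : ℤ)|) ^ 12
      ≤ 2 * Dv ^ 7 * (X:ℝ) ^ 23 := by
  classical
  set N := (Finset.Icc 1 X).filter (fun B => B % 2 = 1) with hN
  have hXr : (1:ℝ) ≤ X := by exact_mod_cast hX
  have hDv : 1 ≤ Dv := by
    have := hD 1 (by norm_num) (Nat.one_le_pow _ _ hX); simpa using this
  have hNc : (N.card : ℝ) ≤ X := by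
    have : N.card ≤ (Finset.Icc 1 X).card := Finset.card_filter_le _ _
    simp at this; exact_mod_cast this
  have H := holder N (Finset.Icc 1 X) (Finset.Icc 1 (X ^ 6)) α (fun u B => ((jacobiSym u B : ℤ):ℝ))
    (fun w B => ((jacobiSym w B : ℤ):ℝ)) (fun t => ∏ i, t i) (Dv ^ 6) (fun m _ => hα m) ?_ ?_ ?_
  · refine H.trans ?_
    have hcorr : ∑ n ∈ N, ∑ n' ∈ N, |∑ w ∈ Finset.Icc 1 (X ^ 6), ((jacobiSym w n : ℤ):ℝ) * ((jacobiSym w n' : ℤ):ℝ)|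
        ≤ 2 * Dv * (X:ℝ) ^ 7 := by
      have hterm : ∀ n ∈ N, ∀ n' ∈ N, |∑ w ∈ Finset.Icc 1 (X ^ 6), ((jacobiSym w n : ℤ):ℝ) * ((jacobiSym w n' : ℤ):ℝ)|
          ≤ (X:ℝ) ^ 2 + if IsSquare (n * n') then (X:ℝ) ^ 6 else 0 := by
        intro n hn n' hn'
        simp only [hN, Finset.mem_filter, Finset.mem_Icc] at hn hn'
        have : NeZero n := ⟨by omega⟩
        have : NeZero n' := ⟨by omega⟩
        have e : ∀ w : ℕ, ((jacobiSym w n : ℤ):ℝ) * ((jacobiSym w n' : ℤ):ℝ) = ((jacobiSym w (n * n') : ℤ):ℝ) := by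
          intro w; rw [jacobiSym.mul_right]; push_cast; rfl
        simp_rw [e]
        have hb : ∀ x : ℤ, |((jacobiSym x (n * n') : ℤ):ℝ)| ≤ 1 := by
          intro x
          rcases jacobiSym.trichotomy x (n * n') with h | h | h <;> rw [h] <;> norm_num
        split_ifs with hsq
        · calc _ ≤ ∑ w ∈ Finset.Icc 1 (X ^ 6), |((jacobiSym w (n * n') : ℤ):ℝ)| := Finset.abs_sum_le_sum_abs _ _
            _ ≤ ∑ w ∈ Finset.Icc 1 (X ^ 6), 1 := Finset.sum_le_sum fun _ _ => hb _
            _ = (X:ℝ) ^ 6 := by simp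
            _ ≤ _ := by have : (0:ℝ) ≤ (X:ℝ) ^ 2 := by positivity
                        linarith
        · rw [add_zero]
          have hodd : n * n' % 2 = 1 := by rw [Nat.mul_mod, hn.2, hn'.2]
          have h := incomplete (n * n') (by omega) (fun x => ((jacobiSym x (n * n') : ℤ):ℝ))
            (by intro x; simp only [jac_period]) 1 hb 1 (X ^ 6)
          rw [jac_sum_zero hodd hsq, mul_zero, sub_zero, mul_one] at h
          have e2 : ∑ w ∈ Finset.Icc 1 (X ^ 6), ((jacobiSym w (n * n') : ℤ):ℝ) =
              ∑ i ∈ Finset.range (X ^ 6), ((jacobiSym (1 + (i:ℤ)) (n * n') : ℤ):ℝ) := by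
            have : Finset.Icc 1 (X ^ 6) = Finset.Ico 1 (X ^ 6 + 1) := by ext; simp
            rw [this, Finset.sum_Ico_eq_sum_range]
            apply Finset.sum_congr (by simp)
            intro i _; push_cast; rfl
          rw [e2]
          refine h.trans ?_
          have h1 : (n:ℝ) ≤ X := by exact_mod_cast hn.1.2
          have h2 : (n':ℝ) ≤ X := by exact_mod_cast hn'.1.2
          push_cast
          rw [sq]; exact mul_le_mul h1 h2 (by positivity) (by positivity)
      calc _ ≤ ∑ n ∈ N, ∑ n' ∈ N, ((X:ℝ) ^ 2 + if IsSquare (n * n') then (X:ℝ) ^ 6 else 0) :=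
            Finset.sum_le_sum fun n hn => Finset.sum_le_sum fun n' hn' => hterm n hn n' hn'
        _ = (N.card:ℝ) ^ 2 * (X:ℝ) ^ 2 + ∑ p ∈ N ×ˢ N, if IsSquare (p.1 * p.2) then (X:ℝ) ^ 6 else 0 := by
            rw [Finset.sum_product]
            simp only [Finset.sum_add_distrib, Finset.sum_const, nsmul_eq_mul]
            ring
        _ ≤ (X:ℝ) ^ 2 * (X:ℝ) ^ 2 + (X * Dv) * (X:ℝ) ^ 6 := by
            apply add_le_add
            · apply mul_le_mul_of_nonneg_right _ (by positivity)
              exact pow_le_pow_left₀ (by positivity) hNc 2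
            · rw [← Finset.sum_filter, Finset.sum_const, nsmul_eq_mul]
              apply mul_le_mul_of_nonneg_right _ (by positivity)
              refine le_trans ?_ (sq_pairs_card X Dv (fun n hn hn2 => hD n hn (hn2.trans (Nat.pow_le_pow_right hX (by norm_num)))))
              have : N ⊆ Finset.Icc 1 X := Finset.filter_subset _ _
              exact_mod_cast Finset.card_le_card (Finset.filter_subset_filter _ (Finset.product_subset_product this this))
        _ ≤ _ := by
            have h4 : (X:ℝ) ^ 2 * (X:ℝ) ^ 2 ≤ Dv * (X:ℝ) ^ 7 := by
              have : (X:ℝ) ^ 4 ≤ (X:ℝ) ^ 7 := pow_le_pow_right₀ hXr (by norm_num)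
              have h7 : 0 ≤ (X:ℝ) ^ 7 := by positivity
              nlinarith
            have h5 : (X * Dv) * (X:ℝ) ^ 6 = Dv * (X:ℝ) ^ 7 := by ring
            linarith
    have hc2 : ((Finset.Icc 1 X).card : ℝ) = X := by simp
    rw [hc2]
    calc _ ≤ (X:ℝ) ^ 10 * (Dv ^ 6 * (X:ℝ) ^ 6 * (2 * Dv * (X:ℝ) ^ 7)) := by
          apply mul_le_mul
          · exact pow_le_pow_left₀ (by positivity) hNc _
          · exact mul_le_mul_of_nonneg_left hcorr (by positivity)
          · have : 0 ≤ Dv := by linarith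
            exact mul_nonneg (by positivity) (Finset.sum_nonneg fun _ _ => Finset.sum_nonneg fun _ _ => abs_nonneg _)
          · positivity
      _ = _ := by ring
  · intro t ht
    simp only [Finset.mem_Icc] at ht ⊢
    constructor
    · exact Finset.one_le_prod' fun i _ => (ht i).1
    · calc ∏ i, t i ≤ ∏ i : Fin 6, X := Finset.prod_le_prod' fun i _ => (ht i).2
        _ = X ^ 6 := by simp
  · intro w hw
    rw [Finset.mem_Icc] at hw
    have hsub : ((Fintype.piFinset (fun _ : Fin 6 => Finset.Icc 1 X)).filter (fun t => ∏ i, t i = w)) ⊆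
        Fintype.piFinset (fun _ : Fin 6 => w.divisors) := by
      intro t ht
      rw [Finset.mem_filter] at ht
      rw [Fintype.mem_piFinset]
      intro i
      rw [Nat.mem_divisors]
      exact ⟨ht.2 ▸ Finset.dvd_prod_of_mem t (Finset.mem_univ i), by omega⟩
    calc _ ≤ ((Fintype.piFinset (fun _ : Fin 6 => w.divisors)).card : ℝ) := by exact_mod_cast Finset.card_le_card hsub
      _ = (w.divisors.card : ℝ) ^ 6 := by simp
      _ ≤ Dv ^ 6 := pow_le_pow_left₀ (by positivity) (hD w (by omega) hw.2) 6
  · intro t _ n hn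
    rw [← Int.cast_prod]
    congr 1
    push_cast
    have : ∀ s : Finset (Fin 6), ∏ i ∈ s, jacobiSym (t i) n = jacobiSym (∏ i ∈ s, (t i:ℤ)) n := by
      intro s
      induction s using Finset.induction_on with
      | empty => simp
      | insert a s ha ih => rw [Finset.prod_insert ha, Finset.prod_insert ha, ih, jacobiSym.mul_left]
    exact this _

end QSpin

namespace QSpin

noncomputable def Dle (M : ℕ) : Finset (Zsqrtd 2) := by
  classical
  exact ((Finset.Icc 1 M).filter (fun m => m % 2 = 1)).biUnion Dn

lemma mem_Dle {M : ℕ} {w : Zsqrtd 2} : w ∈ Dle M ↔ ∃ m, 1 ≤ m ∧ m ≤ M ∧ m % 2 = 1 ∧ w ∈ Dn m := by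
  unfold Dle
  simp only [Finset.mem_biUnion, Finset.mem_filter, Finset.mem_Icc]
  constructor
  · rintro ⟨m, ⟨⟨h1, h2⟩, h3⟩, h4⟩; exact ⟨m, h1, h2, h3, h4⟩
  · rintro ⟨m, h1, h2, h3, h4⟩; exact ⟨m, ⟨⟨h1, h2⟩, h3⟩, h4⟩

def nm (w : Zsqrtd 2) : ℕ := (w.re ^ 2 - 2 * w.im ^ 2).natAbs

lemma nm_of_mem {n : ℕ} {w : Zsqrtd 2} (h : w ∈ Dn n) : nm w = n := by
  obtain ⟨-, -, -, h4⟩ := mem_Dn.mp h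
  unfold nm; rw [h4]; simp

lemma nm_mul (w z : Zsqrtd 2) : nm (w * z) = nm w * nm z := by
  unfold nm; rw [norm_mul'', Int.natAbs_mul]

lemma nm_prod {ι : Type*} (s : Finset ι) (t : ι → Zsqrtd 2) : nm (∏ i ∈ s, t i) = ∏ i ∈ s, nm (t i) := by
  classical
  induction s using Finset.induction_on with
  | empty => simp [nm]
  | insert a s ha ih => rw [Finset.prod_insert ha, Finset.prod_insert ha, nm_mul, ih]

def sz (w : Zsqrtd 2) : ℤ := |w.re| + 2 * |w.im|

lemma sz_nonneg (w : Zsqrtd 2) : 0 ≤ sz w := by unfold sz; positivity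

lemma sz_mul (w z : Zsqrtd 2) : sz (w * z) ≤ sz w * sz z := by
  unfold sz; rw [mul_re', mul_im']
  have h1 := abs_add_le (w.re * z.re) (2 * w.im * z.im)
  have h2 := abs_add_le (w.re * z.im) (w.im * z.re)
  rw [abs_mul, abs_mul (2 * w.im), abs_mul 2, abs_two] at h1
  rw [abs_mul, abs_mul] at h2
  have : 0 ≤ |w.im| * |z.im| := by positivity
  nlinarith

lemma sz_prod {ι : Type*} (s : Finset ι) (t : ι → Zsqrtd 2) : sz (∏ i ∈ s, t i) ≤ ∏ i ∈ s, sz (t i) := by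
  classical
  induction s using Finset.induction_on with
  | empty => simp [sz]
  | insert a s ha ih =>
    rw [Finset.prod_insert ha, Finset.prod_insert ha]
    exact (sz_mul _ _).trans (mul_le_mul_of_nonneg_left ih (sz_nonneg _))

lemma sz_sq_le {n : ℕ} {w : Zsqrtd 2} (h : w ∈ Dn n) : sz w ^ 2 ≤ 8 * n := by
  obtain ⟨h1, h2, -, h4⟩ := mem_Dn.mp h
  have h5 := re_sq_lt h2
  rw [h4] at h5
  unfold sz
  rw [abs_of_pos h1]
  have : 0 ≤ |w.im| := abs_nonneg _
  nlinarith

def Kj (w z : Zsqrtd 2) : ℤ := jacobiSym (w.re * z.re + 2 * w.im * z.im) (nm z)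

def Xj (w z : Zsqrtd 2) : ℤ := jacobiSym z.re (nm z) * Kj w z

lemma dvd_of_int {q : ℕ} {a b : ℤ} (h : (q:ℤ) ∣ a - b) : jacobiSym a q = jacobiSym b q :=
  jacobiSym.mod_left' (Int.emod_eq_emod_iff_emod_sub_eq_zero.mpr (Int.emod_eq_zero_of_dvd h))

lemma re_sq_one {n : ℕ} (hn : n % 2 = 1) {z : Zsqrtd 2} (hz : z ∈ Dn n) :
    jacobiSym z.re (nm z) * jacobiSym z.re (nm z) = 1 := by
  obtain ⟨-, -, h3, h4⟩ := mem_Dn.mp hz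
  have := cop_re h3 h4 (good_of_mem hn hz).odd
  have := jac_sq_one this
  rw [nm_of_mem hz]; simpa using this

lemma Xj_one {n : ℕ} (hn : n % 2 = 1) {z : Zsqrtd 2} (hz : z ∈ Dn n) : Xj 1 z = 1 := by
  unfold Xj Kj
  simp only [Zsqrtd.re_one, Zsqrtd.im_one]
  have e : (1:ℤ) * z.re + 2 * 0 * z.im = z.re := by ring
  rw [e]; exact re_sq_one hn hz

lemma Xj_mul {n : ℕ} (hn : n % 2 = 1) {z : Zsqrtd 2} (hz : z ∈ Dn n) (w w' : Zsqrtd 2) :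
    Xj (w * w') z = Xj w z * Xj w' z := by
  have hs := re_sq_one hn hz
  have h : jacobiSym z.re (nm z) * Kj (w * w') z = Kj w z * Kj w' z := by
    unfold Kj
    rw [← jacobiSym.mul_left, ← jacobiSym.mul_left]
    apply dvd_of_int
    rw [mul_re', mul_im', nm_of_mem hz]
    obtain ⟨-, -, -, h4⟩ := mem_Dn.mp hz
    exact ⟨2 * w.im * w'.im, by rw [← h4]; ring⟩
  unfold Xj
  rw [h]
  linear_combination (-(Kj w z * Kj w' z)) * hs

lemma Xj_prod {n : ℕ} (hn : n % 2 = 1) {z : Zsqrtd 2} (hz : z ∈ Dn n) {ι : Type*} (s : Finset ι)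
    (t : ι → Zsqrtd 2) : Xj (∏ i ∈ s, t i) z = ∏ i ∈ s, Xj (t i) z := by
  classical
  induction s using Finset.induction_on with
  | empty => simp [Xj_one hn hz]
  | insert a s ha ih => rw [Finset.prod_insert ha, Finset.prod_insert ha, Xj_mul hn hz, ih]

lemma Kj_prod {n : ℕ} (hn : n % 2 = 1) {z : Zsqrtd 2} (hz : z ∈ Dn n) (t : Fin 6 → Zsqrtd 2) :
    ∏ i, Kj (t i) z = Xj (∏ i, t i) z := by
  rw [Xj_prod hn hz]
  unfold Xj
  rw [Finset.prod_mul_distrib, Finset.prod_const]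
  simp only [Finset.card_univ, Fintype.card_fin]
  have : jacobiSym z.re (nm z) ^ 6 = 1 := by
    calc _ = (jacobiSym z.re (nm z) * jacobiSym z.re (nm z)) ^ 3 := by ring
      _ = 1 := by rw [re_sq_one hn hz]; norm_num
  rw [this, one_mul]

lemma abs_Kj_le (w z : Zsqrtd 2) : |Kj w z| ≤ 1 := abs_jac_le _ _

lemma abs_Xj_le (w z : Zsqrtd 2) : |Xj w z| ≤ 1 := by
  unfold Xj; rw [abs_mul]
  exact mul_le_one₀ (abs_jac_le _ _) (abs_nonneg _) (abs_Kj_le _ _)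

lemma Xj_per1 (x y : ℤ) (z : Zsqrtd 2) (k : ℤ) : Xj ⟨x + nm z * k, y⟩ z = Xj ⟨x, y⟩ z := by
  unfold Xj Kj
  congr 1
  apply dvd_of_int
  exact ⟨k * z.re, by simp only; ring⟩

lemma Xj_per2 (x y : ℤ) (z : Zsqrtd 2) (k : ℤ) : Xj ⟨x, y + nm z * k⟩ z = Xj ⟨x, y⟩ z := by
  unfold Xj Kj
  congr 1
  apply dvd_of_int
  exact ⟨2 * k * z.im, by simp only; ring⟩

lemma Xj_scale (t x y : ℤ) (z : Zsqrtd 2) : Xj ⟨t * x, t * y⟩ z = jacobiSym t (nm z) * Xj ⟨x, y⟩ z := by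
  unfold Xj Kj
  simp only
  have : t * x * z.re + 2 * (t * y) * z.im = t * (x * z.re + 2 * y * z.im) := by ring
  rw [this, jacobiSym.mul_left]; ring

lemma corr_bound {z z' : Zsqrtd 2} (hz : nm z % 2 = 1) (hz' : nm z' % 2 = 1) (hs : ¬ IsSquare (nm z * nm z'))
    (a : ℤ) (l : ℕ) : |∑ i ∈ Finset.range l, ∑ j ∈ Finset.range l,
      ((Xj ⟨a + i, a + j⟩ z : ℤ) : ℝ) * ((Xj ⟨a + i, a + j⟩ z' : ℤ) : ℝ)| ≤ 2 * (nm z * nm z' : ℕ) * l := by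
  have hodd : nm z * nm z' % 2 = 1 := by rw [Nat.mul_mod, hz, hz']
  have hpos : 0 < nm z * nm z' := by omega
  set q := nm z * nm z' with hq
  set f : ℤ → ℤ → ℝ := fun x y => ((Xj ⟨x, y⟩ z : ℤ) : ℝ) * ((Xj ⟨x, y⟩ z' : ℤ) : ℝ) with hf
  have p1 : ∀ x y, f (x + q) y = f x y := by
    intro x y
    simp only [hf]
    have e1 := Xj_per1 x y z (nm z')
    have e2 := Xj_per1 x y z' (nm z)
    rw [← e1, ← e2, hq]; push_cast
    rw [mul_comm (nm z' : ℤ)]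
  have p2 : ∀ x y, f x (y + q) = f x y := by
    intro x y
    simp only [hf]
    have e1 := Xj_per2 x y z (nm z')
    have e2 := Xj_per2 x y z' (nm z)
    rw [← e1, ← e2, hq]; push_cast
    rw [mul_comm (nm z' : ℤ)]
  refine incomplete2 q hpos f p1 p2 ?_ ?_ a l
  · intro x y
    simp only [hf]
    rw [abs_mul]
    have h1 : |((Xj ⟨x, y⟩ z : ℤ) : ℝ)| ≤ 1 := by exact_mod_cast abs_Xj_le ⟨x, y⟩ z
    have h2 : |((Xj ⟨x, y⟩ z' : ℤ) : ℝ)| ≤ 1 := by exact_mod_cast abs_Xj_le ⟨x, y⟩ z'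
    exact mul_le_one₀ h1 (abs_nonneg _) h2
  · obtain ⟨t, ht⟩ := exists_nonres hodd hs
    obtain ⟨s, hts⟩ := inv_of_jac ht
    have e1 : ∑ i ∈ Finset.range q, ∑ j ∈ Finset.range q, f (t * i) (t * j) =
        ∑ i ∈ Finset.range q, ∑ j ∈ Finset.range q, f i j := by
      have : ∀ x : ℤ, ∑ j ∈ Finset.range q, f x (t * j) = ∑ j ∈ Finset.range q, f x j :=
        fun x => scale_sum hpos (f x) (p2 x) t s hts
      simp_rw [this]
      exact scale_sum hpos (fun x => ∑ j ∈ Finset.range q, f x j)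
        (by intro x; exact Finset.sum_congr rfl fun _ _ => p1 _ _) t s hts
    have e2 : ∀ x y : ℤ, f (t * x) (t * y) = - f x y := by
      intro x y
      simp only [hf]
      rw [Xj_scale, Xj_scale]
      have : NeZero (nm z) := ⟨by omega⟩
      have : NeZero (nm z') := ⟨by omega⟩
      rw [hq, jacobiSym.mul_right] at ht
      have ht' : ((jacobiSym t (nm z) : ℤ) : ℝ) * ((jacobiSym t (nm z') : ℤ) : ℝ) = -1 := by exact_mod_cast ht
      push_cast
      linear_combination ((Xj ⟨x, y⟩ z : ℤ) : ℝ) * ((Xj ⟨x, y⟩ z' : ℤ) : ℝ) * ht'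
    simp_rw [e2, Finset.sum_neg_distrib] at e1
    linarith

lemma card_Dle_le {M Dv : ℕ} (hD : ∀ n : ℕ, n ≠ 0 → n ≤ M → n.divisors.card ≤ Dv) : (Dle M).card ≤ M * Dv := by
  classical
  unfold Dle
  calc _ ≤ ∑ m ∈ (Finset.Icc 1 M).filter (fun m => m % 2 = 1), (Dn m).card := Finset.card_biUnion_le
    _ ≤ ∑ m ∈ (Finset.Icc 1 M).filter (fun m => m % 2 = 1), Dv := by
      apply Finset.sum_le_sum
      intro m hm
      simp only [Finset.mem_filter, Finset.mem_Icc] at hm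
      exact (card_Dn_le hm.2).trans (hD m (by omega) hm.1.2)
    _ = ((Finset.Icc 1 M).filter (fun m => m % 2 = 1)).card * Dv := by simp
    _ ≤ M * Dv := by
      apply Nat.mul_le_mul_right
      calc _ ≤ (Finset.Icc 1 M).card := Finset.card_filter_le _ _
        _ = M := by simp

/-- the Type II kernel bound -/
theorem kernel2 (N M Dv : ℕ) (hN : 1 ≤ N) (hNM : N ≤ M)
    (hD : ∀ n : ℕ, n ≠ 0 → n ≤ M ^ 6 → n.divisors.card ≤ Dv)
    (A B : Finset (Zsqrtd 2)) (hA : A ⊆ Dle N) (hB : B ⊆ Dle M)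
    (α : Zsqrtd 2 → ℝ) (hα : ∀ u, |α u| ≤ 1) :
    (∑ z ∈ A, |∑ w ∈ B, α w * (Kj w z : ℤ)|) ^ 12
      ≤ 10 ^ 7 * (N:ℝ) ^ 11 * (M:ℝ) ^ 12 * (Dv : ℝ) ^ 31 := by
  classical
  have hM : 1 ≤ M := hN.trans hNM
  have hMM : M ≤ M ^ 6 := Nat.le_self_pow (by norm_num) M
  have hDv : 1 ≤ Dv := by simpa using hD 1 (by norm_num) (Nat.one_le_pow _ _ hM)
  have hcA : A.card ≤ N * Dv := (Finset.card_le_card hA).trans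
    (card_Dle_le fun n h0 hn => hD n h0 (hn.trans (hNM.trans hMM)))
  have hcB : B.card ≤ M * Dv := (Finset.card_le_card hB).trans
    (card_Dle_le fun n h0 hn => hD n h0 (hn.trans hMM))
  have pA : ∀ z ∈ A, 1 ≤ nm z ∧ nm z ≤ N ∧ nm z % 2 = 1 ∧ z ∈ Dn (nm z) := by
    intro z hz
    obtain ⟨n, h1, h2, h3, h4⟩ := mem_Dle.mp (hA hz)
    rw [nm_of_mem h4]; exact ⟨h1, h2, h3, h4⟩
  have pB : ∀ z ∈ B, 1 ≤ nm z ∧ nm z ≤ M ∧ nm z % 2 = 1 ∧ z ∈ Dn (nm z) := by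
    intro z hz
    obtain ⟨n, h1, h2, h3, h4⟩ := mem_Dle.mp (hB hz)
    rw [nm_of_mem h4]; exact ⟨h1, h2, h3, h4⟩
  set L : ℕ := 512 * M ^ 3 + 1 with hL
  set emb : ℕ × ℕ → Zsqrtd 2 := fun p => ⟨-(L:ℤ) + p.1, -(L:ℤ) + p.2⟩ with hemb
  have hinj : Function.Injective emb := by
    intro p q h
    have h1 := congrArg Zsqrtd.re h
    have h2 := congrArg Zsqrtd.im h
    simp only [hemb] at h1 h2
    ext <;> omega
  set W : Finset (Zsqrtd 2) := (Finset.range (2 * L) ×ˢ Finset.range (2 * L)).image emb with hW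
  have memW : ∀ w : Zsqrtd 2, sz w ≤ 512 * M ^ 3 → w ∈ W := by
    intro w hw
    unfold sz at hw
    have h1 := abs_le.mp (show |w.re| ≤ 512 * M ^ 3 by have := abs_nonneg w.im; linarith)
    have h2 := abs_le.mp (show |w.im| ≤ 512 * M ^ 3 by have := abs_nonneg w.im; have := abs_nonneg w.re; linarith)
    rw [hW, Finset.mem_image]
    have hLz : (L:ℤ) = 512 * M ^ 3 + 1 := by rw [hL]; push_cast; ring
    refine ⟨((w.re + L).toNat, (w.im + L).toNat), ?_, ?_⟩
    · rw [Finset.mem_product, Finset.mem_range, Finset.mem_range]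
      constructor
      · simp only; omega
      · simp only; omega
    · simp only [hemb]
      ext
      · simp only; omega
      · simp only; omega
  have H := holder A B W α (fun w z => ((Kj w z : ℤ):ℝ)) (fun w z => ((Xj w z : ℤ):ℝ)) (fun t => ∏ i, t i)
    ((Dv:ℝ) ^ 12) (fun m _ => hα m) ?_ ?_ ?_
  · refine H.trans ?_
    have hL2 : (L:ℝ) ≤ 513 * (M:ℝ) ^ 3 := by
      have : (1:ℝ) ≤ (M:ℝ) ^ 3 := by exact_mod_cast Nat.one_le_pow _ _ hM
      rw [hL]; push_cast; linarith
    have hterm : ∀ z ∈ A, ∀ z' ∈ A, |∑ w ∈ W, ((Xj w z : ℤ):ℝ) * ((Xj w z' : ℤ):ℝ)| ≤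
        4 * (N:ℝ) ^ 2 * L + if IsSquare (nm z * nm z') then (4 * (L:ℝ) ^ 2) else 0 := by
      intro z hz z' hz'
      obtain ⟨a1, a2, a3, a4⟩ := pA z hz
      obtain ⟨b1, b2, b3, b4⟩ := pA z' hz'
      rw [hW, Finset.sum_image (fun _ _ _ _ h => hinj h), Finset.sum_product]
      split_ifs with hs
      · calc _ ≤ ∑ i ∈ Finset.range (2 * L), ∑ j ∈ Finset.range (2 * L), (1:ℝ) := by
              refine (Finset.abs_sum_le_sum_abs _ _).trans (Finset.sum_le_sum fun i _ => ?_)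
              refine (Finset.abs_sum_le_sum_abs _ _).trans (Finset.sum_le_sum fun j _ => ?_)
              rw [abs_mul]
              have h1 : |((Xj (emb (i, j)) z : ℤ) : ℝ)| ≤ 1 := by exact_mod_cast abs_Xj_le _ z
              have h2 : |((Xj (emb (i, j)) z' : ℤ) : ℝ)| ≤ 1 := by exact_mod_cast abs_Xj_le _ z'
              exact mul_le_one₀ h1 (abs_nonneg _) h2
          _ = 4 * (L:ℝ) ^ 2 := by simp; ring
          _ ≤ _ := by
            have : 0 ≤ 4 * (N:ℝ) ^ 2 * L := by positivity
            linarith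
      · rw [add_zero]
        refine (corr_bound a3 b3 hs (-(L:ℤ)) (2 * L)).trans ?_
        have h1 : (nm z : ℝ) ≤ N := by exact_mod_cast a2
        have h2 : (nm z' : ℝ) ≤ N := by exact_mod_cast b2
        have h3 : (nm z : ℝ) * nm z' ≤ N * N := mul_le_mul h1 h2 (by positivity) (by positivity)
        push_cast
        have : (0:ℝ) ≤ L := by positivity
        nlinarith
    have hpairs : (((A ×ˢ A).filter (fun p => IsSquare (nm p.1 * nm p.2))).card : ℝ) ≤ N * (Dv:ℝ) ^ 3 := by
      set T := ((Finset.Icc 1 N) ×ˢ (Finset.Icc 1 N)).filter (fun p : ℕ × ℕ => IsSquare (p.1 * p.2)) with hT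
      have h1 : ((A ×ˢ A).filter (fun p => IsSquare (nm p.1 * nm p.2))).card ≤ Dv ^ 2 * T.card := by
        apply Finset.card_le_mul_card_image_of_maps_to (f := fun p => (nm p.1, nm p.2))
        · intro p hp
          rw [Finset.mem_filter, Finset.mem_product] at hp
          obtain ⟨a1, a2, a3, a4⟩ := pA _ hp.1.1
          obtain ⟨b1, b2, b3, b4⟩ := pA _ hp.1.2
          simp only [hT, Finset.mem_filter, Finset.mem_product, Finset.mem_Icc]
          exact ⟨⟨⟨a1, a2⟩, b1, b2⟩, hp.2⟩
        · intro b _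
          rcases Finset.eq_empty_or_nonempty (((A ×ˢ A).filter (fun p => IsSquare (nm p.1 * nm p.2))).filter
            (fun p => (nm p.1, nm p.2) = b)) with he | ⟨p0, hp0⟩
          · rw [he]; simp
          · simp only [Finset.mem_filter, Finset.mem_product] at hp0
            obtain ⟨a1, a2, a3, a4⟩ := pA _ hp0.1.1.1
            obtain ⟨b1, b2, b3, b4⟩ := pA _ hp0.1.1.2
            obtain ⟨-, rfl⟩ := hp0
            calc _ ≤ (Dn (nm p0.1) ×ˢ Dn (nm p0.2)).card := by
                  apply Finset.card_le_card
                  intro p hp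
                  simp only [Finset.mem_filter, Finset.mem_product, Prod.mk.injEq] at hp
                  rw [Finset.mem_product, ← hp.2.1, ← hp.2.2]
                  exact ⟨(pA _ hp.1.1.1).2.2.2, (pA _ hp.1.1.2).2.2.2⟩
              _ ≤ Dv * Dv := by
                rw [Finset.card_product]
                apply Nat.mul_le_mul
                · exact (card_Dn_le a3).trans (hD _ (by omega) (a2.trans (hNM.trans hMM)))
                · exact (card_Dn_le b3).trans (hD _ (by omega) (b2.trans (hNM.trans hMM)))
              _ = Dv ^ 2 := by ring
      have h2 := sq_pairs_card N (Dv:ℝ) (fun n h0 hn => by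
        exact_mod_cast hD n h0 (hn.trans ((Nat.pow_le_pow_left hNM 2).trans (Nat.pow_le_pow_right hM (by norm_num)))))
      calc (((A ×ˢ A).filter (fun p => IsSquare (nm p.1 * nm p.2))).card : ℝ) ≤ (Dv:ℝ) ^ 2 * (T.card : ℝ) := by
            exact_mod_cast h1
        _ ≤ (Dv:ℝ) ^ 2 * (N * Dv) := mul_le_mul_of_nonneg_left h2 (by positivity)
        _ = _ := by ring
    have hNr : (1:ℝ) ≤ N := by exact_mod_cast hN
    have hNMr : (N:ℝ) ≤ M := by exact_mod_cast hNM
    have hDr : (1:ℝ) ≤ Dv := by exact_mod_cast hDv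
    have hcA' : (A.card : ℝ) ≤ N * Dv := by exact_mod_cast hcA
    have hcB' : (B.card : ℝ) ≤ M * Dv := by exact_mod_cast hcB
    have hcorr : ∑ z ∈ A, ∑ z' ∈ A, |∑ w ∈ W, ((Xj w z : ℤ):ℝ) * ((Xj w z' : ℤ):ℝ)| ≤
        10 ^ 7 * (N * (M:ℝ) ^ 6 * (Dv:ℝ) ^ 3) := by
      calc _ ≤ ∑ z ∈ A, ∑ z' ∈ A, (4 * (N:ℝ) ^ 2 * L + if IsSquare (nm z * nm z') then (4 * (L:ℝ) ^ 2) else 0) :=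
            Finset.sum_le_sum fun n hn => Finset.sum_le_sum fun n' hn' => hterm n hn n' hn'
        _ = (A.card:ℝ) ^ 2 * (4 * (N:ℝ) ^ 2 * L) + ∑ p ∈ A ×ˢ A, if IsSquare (nm p.1 * nm p.2) then (4 * (L:ℝ) ^ 2) else 0 := by
            rw [Finset.sum_product]
            simp only [Finset.sum_add_distrib, Finset.sum_const, nsmul_eq_mul]
            ring
        _ ≤ (N * Dv) ^ 2 * (4 * (N:ℝ) ^ 2 * (513 * (M:ℝ) ^ 3)) + (N * (Dv:ℝ) ^ 3) * (4 * (513 * (M:ℝ) ^ 3) ^ 2) := by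
            apply add_le_add
            · gcongr
            · rw [← Finset.sum_filter, Finset.sum_const, nsmul_eq_mul]
              gcongr
        _ ≤ _ := by
            have h1 : (N * Dv : ℝ) ^ 2 * (4 * (N:ℝ) ^ 2 * (513 * (M:ℝ) ^ 3)) ≤ 2052 * (N * (M:ℝ) ^ 6 * (Dv:ℝ) ^ 3) := by
              calc (N * Dv : ℝ) ^ 2 * (4 * (N:ℝ) ^ 2 * (513 * (M:ℝ) ^ 3))
                  = 2052 * (N * ((N:ℝ) ^ 3 * (M:ℝ) ^ 3) * (Dv:ℝ) ^ 2) := by ring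
                _ ≤ 2052 * (N * ((M:ℝ) ^ 3 * (M:ℝ) ^ 3) * (Dv:ℝ) ^ 3) := by
                  gcongr
                  norm_num
                _ = _ := by ring
            have h2 : (N * (Dv:ℝ) ^ 3) * (4 * (513 * (M:ℝ) ^ 3) ^ 2) = 1052676 * (N * (M:ℝ) ^ 6 * (Dv:ℝ) ^ 3) := by ring
            have h3 : 0 ≤ (N * (M:ℝ) ^ 6 * (Dv:ℝ) ^ 3) := by positivity
            rw [h2]; linarith
    calc _ ≤ (N * Dv : ℝ) ^ 10 * ((Dv:ℝ) ^ 12 * (M * Dv : ℝ) ^ 6 * (10 ^ 7 * (N * (M:ℝ) ^ 6 * (Dv:ℝ) ^ 3))) := by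
          gcongr
      _ = _ := by ring
  · intro t ht
    apply memW
    refine (sz_prod _ _).trans ?_
    have h1 : (∏ i, sz (t i)) ^ 2 ≤ (512 * (M:ℤ) ^ 3) ^ 2 := by
      rw [← Finset.prod_pow]
      calc ∏ i, sz (t i) ^ 2 ≤ ∏ i : Fin 6, (8 * (M:ℤ)) := by
            apply Finset.prod_le_prod (fun _ _ => sq_nonneg _)
            intro i _
            obtain ⟨a1, a2, a3, a4⟩ := pB _ (ht i)
            refine (sz_sq_le a4).trans ?_
            have : (nm (t i) : ℤ) ≤ M := by exact_mod_cast a2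
            linarith
        _ = _ := by simp; ring
    exact abs_le_of_sq_le_sq' h1 (by positivity) |>.2
  · intro w _
    rcases Finset.eq_empty_or_nonempty ((Fintype.piFinset (fun _ : Fin 6 => B)).filter (fun t => ∏ i, t i = w)) with he | ⟨t0, ht0⟩
    · rw [he]; simp
    · rw [Finset.mem_filter, Fintype.mem_piFinset] at ht0
      have hnw : nm w = ∏ i, nm (t0 i) := by rw [← ht0.2, nm_prod]
      have hn1 : nm w ≤ M ^ 6 := by
        rw [hnw]
        calc _ ≤ ∏ i : Fin 6, M := Finset.prod_le_prod' fun i _ => (pB _ (ht0.1 i)).2.1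
          _ = _ := by simp
      have hnodd : nm w % 2 = 1 := by
        rw [hnw, ← Nat.odd_iff]
        apply Finset.prod_induction _ Odd (fun a b => Odd.mul) odd_one
        intro i _; exact Nat.odd_iff.mpr (pB _ (ht0.1 i)).2.2.1
      have hsub : ((Fintype.piFinset (fun _ : Fin 6 => B)).filter (fun t => ∏ i, t i = w)) ⊆
          Fintype.piFinset (fun _ : Fin 6 => (nm w).divisors.biUnion Dn) := by
        intro t ht
        rw [Finset.mem_filter, Fintype.mem_piFinset] at ht
        rw [Fintype.mem_piFinset]
        intro i
        rw [Finset.mem_biUnion]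
        refine ⟨nm (t i), ?_, (pB _ (ht.1 i)).2.2.2⟩
        rw [Nat.mem_divisors]
        refine ⟨?_, by omega⟩
        rw [← ht.2, nm_prod]
        exact Finset.dvd_prod_of_mem _ (Finset.mem_univ i)
      have hcard : ((nm w).divisors.biUnion Dn).card ≤ Dv * Dv := by
        calc _ ≤ ∑ d ∈ (nm w).divisors, (Dn d).card := Finset.card_biUnion_le
          _ ≤ ∑ d ∈ (nm w).divisors, Dv := by
            apply Finset.sum_le_sum
            intro d hd
            have hdv := Nat.dvd_of_mem_divisors hd
            have hd0 : d ≠ 0 := by rintro rfl; rw [zero_dvd_iff] at hdv; omega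
            have hdodd : d % 2 = 1 := Nat.odd_iff.mp ((Nat.odd_iff.mpr hnodd).of_dvd_nat hdv)
            exact (card_Dn_le hdodd).trans (hD d hd0 ((Nat.le_of_dvd (by omega) hdv).trans hn1))
          _ = (nm w).divisors.card * Dv := by simp
          _ ≤ Dv * Dv := Nat.mul_le_mul_right _ (hD _ (by omega) hn1)
      calc _ ≤ ((Fintype.piFinset (fun _ : Fin 6 => (nm w).divisors.biUnion Dn)).card : ℝ) := by
            exact_mod_cast Finset.card_le_card hsub
        _ = ((((nm w).divisors.biUnion Dn).card ^ 6 : ℕ) : ℝ) := by simp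
        _ ≤ (((Dv * Dv) ^ 6 : ℕ) : ℝ) := by exact_mod_cast Nat.pow_le_pow_left hcard 6
        _ = _ := by push_cast; ring
  · intro t _ z hz
    obtain ⟨a1, a2, a3, a4⟩ := pA z hz
    have := Kj_prod a3 a4 t
    exact_mod_cast this

end QSpin

namespace QSpin

lemma block (g : ℕ → ℝ) (F : ℝ) (hF : ∀ i, |g i| ≤ F) (l : ℕ) (hl : 1 ≤ l) (X c : ℕ) (hc : c ≤ X) :
    |∑ i ∈ Finset.range c, g i| ≤ ∑ j ∈ Finset.range (X / l), |∑ i ∈ Finset.Ico (j * l) ((j + 1) * l), g i| + l * F := by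
  have main : ∀ k : ℕ, ∑ i ∈ Finset.range (k * l), g i = ∑ j ∈ Finset.range k, ∑ i ∈ Finset.Ico (j * l) ((j + 1) * l), g i := by
    intro k
    induction k with
    | zero => simp
    | succ k ih =>
      rw [Finset.sum_range_succ, ← ih, Finset.sum_range_add_sum_Ico _ (Nat.mul_le_mul_right _ (Nat.le_succ k))]
  have hF0 : 0 ≤ F := (abs_nonneg _).trans (hF 0)
  have hk : c / l * l ≤ c := Nat.div_mul_le_self c l
  rw [← Finset.sum_range_add_sum_Ico _ hk, main]
  refine (abs_add_le _ _).trans (add_le_add ?_ ?_)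
  · refine (Finset.abs_sum_le_sum_abs _ _).trans ?_
    apply Finset.sum_le_sum_of_subset_of_nonneg
    · exact Finset.range_subset_range.mpr (Nat.div_le_div_right hc)
    · intros; positivity
  · calc _ ≤ ∑ i ∈ Finset.Ico (c / l * l) c, |g i| := Finset.abs_sum_le_sum_abs _ _
      _ ≤ ∑ i ∈ Finset.Ico (c / l * l) c, F := Finset.sum_le_sum fun _ _ => hF _
      _ = (c - c / l * l : ℕ) * F := by simp
      _ ≤ l * F := by
        apply mul_le_mul_of_nonneg_right _ hF0
        have h1 := Nat.mod_add_div' c l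
        have h2 := Nat.mod_lt c (by omega : l > 0)
        have : c - c / l * l ≤ l := by omega
        exact_mod_cast this

lemma block_Ico (g : ℕ → ℝ) (F : ℝ) (hF : ∀ i, |g i| ≤ F) (l : ℕ) (hl : 1 ≤ l) (X a b : ℕ) (hb : b ≤ X) :
    |∑ i ∈ Finset.Ico a b, g i| ≤ 2 * (∑ j ∈ Finset.range (X / l), |∑ i ∈ Finset.Ico (j * l) ((j + 1) * l), g i| + l * F) := by
  have hF0 : 0 ≤ F := (abs_nonneg _).trans (hF 0)
  rcases le_total b a with h | h
  · rw [Finset.Ico_eq_empty (by omega)]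
    simp only [Finset.sum_empty, abs_zero]
    have : 0 ≤ ∑ j ∈ Finset.range (X / l), |∑ i ∈ Finset.Ico (j * l) ((j + 1) * l), g i| :=
      Finset.sum_nonneg fun _ _ => abs_nonneg _
    positivity
  · have e := Finset.sum_range_add_sum_Ico g h
    have h1 := block g F hF l hl X b hb
    have h2 := block g F hF l hl X a (h.trans hb)
    have : ∑ i ∈ Finset.Ico a b, g i = ∑ i ∈ Finset.range b, g i - ∑ i ∈ Finset.range a, g i := by linarith
    rw [this]
    refine (abs_sub _ _).trans ?_
    linarith

def cnd (d y : ℕ) (u v : ℤ) : Prop := 2 * |v| < u ∧ u ^ 2 - 2 * v ^ 2 ≤ y ∧ (u ^ 2 - 2 * v ^ 2) % 16 = 15 ∧ (d:ℤ) ∣ u ^ 2 - 2 * v ^ 2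

lemma sp_zero_of_not_coprime {u v : ℤ} (hv : v ≠ 0) (h : ¬ IsCoprime u v) : sp ⟨u, v⟩ = 0 := by
  unfold sp
  have : NeZero v.natAbs := ⟨by omega⟩
  simp only
  rw [jacobiSym.mul_left]
  have : jacobiSym u v.natAbs = 0 := by
    rw [jacobiSym.eq_zero_iff_not_coprime]
    intro hc
    apply h
    rw [Int.isCoprime_iff_gcd_eq_one]
    rw [Int.gcd_def] at hc ⊢
    rwa [Int.natAbs_natCast] at hc
  rw [this, mul_zero]

lemma odd_of_cnd {u v : ℤ} (h : (u ^ 2 - 2 * v ^ 2) % 16 = 15) : v % 2 = 1 := by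
  by_contra hv
  have hu : u % 2 = 1 := by
    rcases Int.emod_two_eq_zero_or_one u with h' | h'
    · exfalso
      obtain ⟨k, rfl⟩ : ∃ k, u = 2 * k := ⟨u / 2, by omega⟩
      have e : (2 * k) ^ 2 - 2 * v ^ 2 = 2 * (2 * k ^ 2 - v ^ 2) := by ring
      omega
    · exact h'
  have := (norm_mod u v hu).2 (by omega)
  omega

open Classical in
lemma typeI_expand (d y X : ℕ) (hX : 2 * y ≤ X ^ 2) :
    ∑ n ∈ (Finset.Icc 1 y).filter (fun n => d ∣ n), Aa n =
    ∑ v ∈ Finset.Icc (-(X:ℤ)) X, ∑ u ∈ Finset.Icc 1 X, if cnd d y u v then sp ⟨u, v⟩ else 0 := by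
  set S := ((Finset.Icc (-(X:ℤ)) X) ×ˢ (Finset.Icc 1 X)).filter (fun p : ℤ × ℕ => cnd d y p.2 p.1) with hS
  set T := (Finset.Icc 1 y).filter (fun n => d ∣ n) with hT
  have memS : ∀ p, p ∈ S ↔ ((-(X:ℤ) ≤ p.1 ∧ p.1 ≤ X) ∧ 1 ≤ p.2 ∧ p.2 ≤ X) ∧ cnd d y p.2 p.1 := by
    intro p; rw [hS, Finset.mem_filter, Finset.mem_product, Finset.mem_Icc, Finset.mem_Icc]
  have e1 : ∑ v ∈ Finset.Icc (-(X:ℤ)) X, ∑ u ∈ Finset.Icc 1 X, (if cnd d y u v then sp ⟨u, v⟩ else 0) =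
      ∑ p ∈ S, sp ⟨p.2, p.1⟩ := by
    rw [hS, Finset.sum_filter, Finset.sum_product]
  have pos : ∀ (u : ℕ) (v : ℤ), 2 * |v| < u → 0 < (u:ℤ) ^ 2 - 2 * v ^ 2 := by
    intro u v h
    have h0 : (0:ℤ) < u := by have := abs_nonneg v; omega
    have := re_sq_lt h
    nlinarith
  rw [e1, ← Finset.sum_fiberwise_of_maps_to (t := T) (g := fun p : ℤ × ℕ => ((p.2:ℤ) ^ 2 - 2 * p.1 ^ 2).toNat)]
  · apply Finset.sum_congr rfl
    intro n hn
    simp only [hT, Finset.mem_filter, Finset.mem_Icc] at hn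
    by_cases h15 : n % 16 = 15
    · unfold Aa
      rw [if_pos h15]
      have e2 : ∑ w ∈ Dn n, sp w = ∑ p ∈ (Dn n).image (fun w => ((w.im, w.re.toNat) : ℤ × ℕ)), sp ⟨p.2, p.1⟩ := by
        rw [Finset.sum_image]
        · apply Finset.sum_congr rfl
          intro w hw
          obtain ⟨h1, -⟩ := mem_Dn.mp hw
          simp only [Int.toNat_of_nonneg h1.le]
        · intro w hw z hz h
          obtain ⟨h1, -⟩ := mem_Dn.mp (Finset.mem_coe.mp hw)
          obtain ⟨h2, -⟩ := mem_Dn.mp (Finset.mem_coe.mp hz)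
          simp only [Prod.mk.injEq] at h
          ext
          · omega
          · exact h.1
      rw [e2]
      apply Finset.sum_subset
      · intro p hp
        rw [Finset.mem_image] at hp
        obtain ⟨w, hw, rfl⟩ := hp
        obtain ⟨h1, h2, h3, h4⟩ := mem_Dn.mp hw
        have h5 := re_sq_lt h2
        rw [h4] at h5
        have hyX : (2:ℤ) * y ≤ X ^ 2 := by exact_mod_cast hX
        have hny : (n:ℤ) ≤ y := by exact_mod_cast hn.1.2
        have hre : w.re ≤ X := by
          by_contra hc
          push Not at hc
          nlinarith
        have him := abs_le.mp (show |w.im| ≤ X by have := abs_nonneg w.im; linarith)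
        rw [Finset.mem_filter, memS]
        simp only [cnd, Int.toNat_of_nonneg h1.le]
        refine ⟨⟨⟨him, by omega, by omega⟩, h2, by rw [h4]; exact hny, by rw [h4]; omega, by rw [h4]; exact_mod_cast hn.2⟩, ?_⟩
        rw [h4]; simp
      · intro p hp hnot
        rw [Finset.mem_filter, memS] at hp
        obtain ⟨⟨⟨hv, hu1, hu2⟩, c1, c2, c3, c4⟩, hpn⟩ := hp
        have hodd := odd_of_cnd c3
        apply sp_zero_of_not_coprime (by omega)
        intro hcop
        apply hnot
        rw [Finset.mem_image]
        refine ⟨⟨p.2, p.1⟩, mem_Dn.mpr ⟨by simp only; omega, c1, hcop, ?_⟩, by simp⟩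
        have := pos p.2 p.1 c1
        simp only; omega
    · unfold Aa
      rw [if_neg h15]
      symm
      apply Finset.sum_eq_zero
      intro p hp
      exfalso
      rw [Finset.mem_filter, memS] at hp
      obtain ⟨⟨-, c1, c2, c3, c4⟩, hpn⟩ := hp
      omega
  · intro p hp
    rw [memS] at hp
    obtain ⟨-, c1, c2, c3, c4⟩ := hp
    have := pos p.2 p.1 c1
    simp only [hT, Finset.mem_filter, Finset.mem_Icc]
    refine ⟨⟨by omega, by omega⟩, ?_⟩
    have : (d:ℤ) ∣ (((p.2:ℤ) ^ 2 - 2 * p.1 ^ 2).toNat : ℤ) := by rw [Int.toNat_of_nonneg this.le]; exact c4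
    exact_mod_cast this

/-- the truncated class function -/
noncomputable def gcl (X q r B u : ℕ) : ℝ := if 1 ≤ u ∧ u ≤ X ∧ u % q = r then ((jacobiSym u B : ℤ) : ℝ) else 0

lemma abs_gcl_le (X q r B u : ℕ) : |gcl X q r B u| ≤ 1 := by
  unfold gcl
  split_ifs
  · exact_mod_cast abs_jac_le _ _
  · simp

lemma cnd_class {d : ℕ} {u u' v : ℤ} (h : ((16 * d : ℕ) : ℤ) ∣ u - u') :
    ((u ^ 2 - 2 * v ^ 2) % 16 = 15 ∧ (d:ℤ) ∣ u ^ 2 - 2 * v ^ 2) ↔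
    ((u' ^ 2 - 2 * v ^ 2) % 16 = 15 ∧ (d:ℤ) ∣ u' ^ 2 - 2 * v ^ 2) := by
  obtain ⟨k, hk⟩ := h
  push_cast at hk
  have e : u ^ 2 - 2 * v ^ 2 = (u' ^ 2 - 2 * v ^ 2) + 16 * (d * k * (u + u')) := by
    linear_combination (u + u') * hk
  rw [e]
  refine and_congr (by omega) ?_
  have : (d:ℤ) ∣ 16 * (d * k * (u + u')) := ⟨16 * k * (u + u'), by ring⟩
  exact (Int.dvd_add_left this)

open Classical in
lemma typeI_inner (d y X : ℕ) (hd : 1 ≤ d) (hX : 2 * y ≤ X ^ 2) (v : ℤ) (l : ℕ) (hl : 1 ≤ l) :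
    |(∑ u ∈ Finset.Icc 1 X, if cnd d y u v then sp ⟨u, v⟩ else 0 : ℤ)| ≤
    (if v % 2 = 1 then ∑ r ∈ Finset.range (16 * d), 2 * (∑ j ∈ Finset.range ((X + 1) / l),
      |∑ u ∈ Finset.Ico (j * l) ((j + 1) * l), gcl X (16 * d) r v.natAbs u| + l) else (0:ℝ)) := by
  split_ifs with hv
  · set B := v.natAbs with hB
    have hBv : |v| = B := by rw [hB]; exact (Int.natCast_natAbs v).symm
    set c := min (Nat.sqrt (y + 2 * B ^ 2)) X with hc
    set q := 16 * d with hq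
    have hv2 : v ^ 2 = (B:ℤ) ^ 2 := by rw [← hBv, sq_abs]
    -- rewrite
    have e1 : ((∑ u ∈ Finset.Icc 1 X, if cnd d y u v then sp ⟨u, v⟩ else 0 : ℤ) : ℝ) =
        ∑ r ∈ Finset.range q, ∑ u ∈ Finset.Ico (2 * B + 1) (c + 1),
          (if ((r:ℤ) ^ 2 - 2 * v ^ 2) % 16 = 15 ∧ (d:ℤ) ∣ (r:ℤ) ^ 2 - 2 * v ^ 2 then ((jacobiSym 2 B : ℤ):ℝ) else 0) *
            gcl X q r B u := by
      rw [Finset.sum_comm]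
      push_cast
      have inner : ∀ u ∈ Finset.Ico (2 * B + 1) (c + 1), ∑ r ∈ Finset.range q,
          (if ((r:ℤ) ^ 2 - 2 * v ^ 2) % 16 = 15 ∧ (d:ℤ) ∣ (r:ℤ) ^ 2 - 2 * v ^ 2 then ((jacobiSym 2 B : ℤ):ℝ) else 0) *
            gcl X q r B u = if cnd d y u v then ((sp ⟨u, v⟩ : ℤ):ℝ) else 0 := by
        intro u hu
        rw [Finset.mem_Ico] at hu
        have hu1 : u ≤ Nat.sqrt (y + 2 * B ^ 2) := by have := min_le_left (Nat.sqrt (y + 2 * B ^ 2)) X; omega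
        have hu2 : u ≤ X := by have := min_le_right (Nat.sqrt (y + 2 * B ^ 2)) X; omega
        rw [Nat.le_sqrt'] at hu1
        rw [Finset.sum_eq_single (u % q)]
        · have hcl := cnd_class (d := d) (u := (u:ℤ)) (u' := ((u % q : ℕ):ℤ)) (v := v)
            (by rw [← hq]; push_cast; exact Int.dvd_self_sub_of_emod_eq rfl)
          have hcnd : cnd d y u v ↔ (((u % q : ℕ):ℤ) ^ 2 - 2 * v ^ 2) % 16 = 15 ∧ (d:ℤ) ∣ ((u % q : ℕ):ℤ) ^ 2 - 2 * v ^ 2 := by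
            rw [← hcl]; unfold cnd
            constructor
            · exact fun h => h.2.2
            · refine fun h => ⟨by rw [hBv]; omega, ?_, h⟩
              rw [hv2]
              have : ((u ^ 2 : ℕ):ℤ) ≤ ((y + 2 * B ^ 2 : ℕ):ℤ) := by exact_mod_cast hu1
              push_cast at this; linarith
          have hg : gcl X q (u % q) B u = ((jacobiSym u B : ℤ):ℝ) := by
            unfold gcl; rw [if_pos ⟨by omega, hu2, rfl⟩]
          rw [hg]
          by_cases h : cnd d y u v
          · rw [if_pos h, if_pos (hcnd.mp h)]
            unfold sp; simp only
            rw [jacobiSym.mul_left]; push_cast; rfl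
          · rw [if_neg h, if_neg (fun hh => h (hcnd.mpr hh)), zero_mul]
        · intro r _ hr
          have hz : gcl X q r B u = 0 := by
            unfold gcl
            rw [if_neg (fun h => hr h.2.2.symm)]
          rw [hz, mul_zero]
        · intro h
          exfalso; apply h
          rw [Finset.mem_range]; exact Nat.mod_lt _ (by omega)
      rw [Finset.sum_congr rfl inner]
      symm
      apply Finset.sum_subset
      · intro u hu
        rw [Finset.mem_Ico] at hu
        rw [Finset.mem_Icc]
        have := min_le_right (Nat.sqrt (y + 2 * B ^ 2)) X
        omega
      · intro u hu hnot
        rw [Finset.mem_Icc] at hu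
        rw [if_neg]
        rintro ⟨h1, h2, -⟩
        apply hnot
        rw [hBv] at h1
        rw [Finset.mem_Ico]
        have h3 : u ≤ Nat.sqrt (y + 2 * B ^ 2) := by
          rw [Nat.le_sqrt']
          rw [hv2] at h2
          have : ((u ^ 2 : ℕ):ℤ) ≤ ((y + 2 * B ^ 2 : ℕ):ℤ) := by push_cast; linarith
          exact_mod_cast this
        have := le_min h3 hu.2
        omega
    rw [Int.cast_abs, e1]
    refine (Finset.abs_sum_le_sum_abs _ _).trans (Finset.sum_le_sum fun r _ => ?_)
    rw [← Finset.mul_sum, abs_mul]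
    have hb := block_Ico (gcl X q r B) 1 (abs_gcl_le X q r B) l hl (X + 1) (2 * B + 1) (c + 1)
      (by have := min_le_right (Nat.sqrt (y + 2 * B ^ 2)) X; omega)
    rw [mul_one] at hb
    refine le_trans ?_ hb
    apply mul_le_of_le_one_left (abs_nonneg _)
    split_ifs
    · exact_mod_cast abs_jac_le 2 B
    · simp
  · rw [Finset.sum_eq_zero]
    · simp
    · intro u _
      rw [if_neg]
      rintro ⟨-, -, h, -⟩
      exact hv (odd_of_cnd h)

theorem typeI (x h Dv : ℕ) (hh : 1 ≤ h) (hx : h ^ 7000 ≤ x)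
    (hD : ∀ n : ℕ, n ≠ 0 → n ≤ 1000 * x ^ 6 → n.divisors.card ≤ Dv) (d y : ℕ) (hd : 1 ≤ d) (hy : y ≤ x) :
    |((∑ n ∈ (Finset.Icc 1 y).filter (fun n => d ∣ n), Aa n : ℤ) : ℝ)| ≤ 20000 * d * Dv * x / (h:ℝ) ^ 145 := by
  classical
  have hx1 : 1 ≤ x := (Nat.one_le_pow _ _ hh).trans hx
  set X := Nat.sqrt (2 * x) + 1 with hXdef
  have hX2 : 2 * x ≤ X ^ 2 := by
    have := Nat.lt_succ_sqrt' (2 * x); rw [hXdef]; exact this.le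
  have hX9 : X ^ 2 ≤ 9 * x := by
    have h1 := Nat.sqrt_le' (2 * x)
    have h2 : Nat.sqrt (2 * x) ≤ 2 * x := Nat.sqrt_le_self _
    rw [hXdef]; nlinarith
  have hX1 : 1 ≤ X := by omega
  have hXh : h ^ 3480 ≤ X := by
    by_contra hc
    push Not at hc
    have h1 : X ^ 2 < (h ^ 3480) ^ 2 := Nat.pow_lt_pow_left hc (by norm_num)
    have h2 : (h ^ 3480) ^ 2 ≤ h ^ 7000 := by
      rw [← pow_mul]; exact Nat.pow_le_pow_right hh (by norm_num)
    omega
  have hX6 : X ^ 6 ≤ 1000 * x ^ 6 := by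
    calc X ^ 6 = (X ^ 2) ^ 3 := by ring
      _ ≤ (9 * x) ^ 3 := Nat.pow_le_pow_left hX9 3
      _ = 729 * x ^ 3 := by ring
      _ ≤ 1000 * x ^ 6 := Nat.mul_le_mul (by norm_num) (Nat.pow_le_pow_right hx1 (by norm_num))
  have hDv : 1 ≤ Dv := by
    simpa using hD 1 (by norm_num) ((Nat.one_le_pow _ _ hX1).trans hX6)
  have hDr : (1:ℝ) ≤ Dv := by exact_mod_cast hDv
  have hhr : (1:ℝ) ≤ h := by exact_mod_cast hh
  have hXr : (1:ℝ) ≤ X := by exact_mod_cast hX1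
  -- kernel
  have hker : ∀ α : ℕ → ℝ, (∀ u, |α u| ≤ 1) →
      ∑ B ∈ (Finset.Icc 1 X).filter (fun B => B % 2 = 1), |∑ u ∈ Finset.Icc 1 X, α u * (jacobiSym u B : ℤ)| ≤
      2 * Dv * (X:ℝ) ^ 2 / (h:ℝ) ^ 290 := by
    intro α hα
    have hk := kernel1 X hX1 Dv (fun n h0 hn => by exact_mod_cast hD n h0 (hn.trans hX6)) α hα
    have h12 : 2 * (Dv:ℝ) ^ 7 * (X:ℝ) ^ 23 ≤ (2 * Dv * (X:ℝ) ^ 2 / (h:ℝ) ^ 290) ^ 12 := by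
      rw [div_pow, le_div_iff₀ (by positivity)]
      have a1 : (h:ℝ) ^ 3480 ≤ X := by exact_mod_cast hXh
      have a2 : (Dv:ℝ) ^ 7 ≤ (Dv:ℝ) ^ 12 := pow_le_pow_right₀ hDr (by norm_num)
      calc 2 * (Dv:ℝ) ^ 7 * (X:ℝ) ^ 23 * ((h:ℝ) ^ 290) ^ 12 = 2 * (Dv:ℝ) ^ 7 * (X:ℝ) ^ 23 * (h:ℝ) ^ 3480 := by
            rw [← pow_mul]
        _ ≤ 4096 * (Dv:ℝ) ^ 12 * (X:ℝ) ^ 23 * X := by gcongr; norm_num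
        _ = _ := by ring
    exact le_of_pow_le_pow_left₀ (by norm_num) (by positivity) (hk.trans h12)
  -- blocks
  set l := X / h ^ 145 with hldef
  have h145 : h ^ 145 ≤ X := (Nat.pow_le_pow_right hh (by norm_num)).trans hXh
  have hl : 1 ≤ l := Nat.div_pos h145 (Nat.pow_pos hh)
  have hl1 : (l:ℝ) ≤ X / (h:ℝ) ^ 145 := by
    have := @Nat.cast_div_le ℝ _ _ _ X (h ^ 145)
    rw [hldef]; push_cast at this; exact this
  have hJ : (((X + 1) / l : ℕ) : ℝ) ≤ 4 * (h:ℝ) ^ 145 := by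
    have : (X + 1) / l ≤ 4 * h ^ 145 := by
      apply Nat.div_le_of_le_mul
      have h1 : X < h ^ 145 * (l + 1) := Nat.lt_mul_div_succ X (Nat.pow_pos hh)
      have h2 : 1 ≤ h ^ 145 := Nat.pow_pos hh
      nlinarith
    exact_mod_cast this
  rw [typeI_expand d y X (by omega)]
  set q := 16 * d with hq
  set G : ℕ → ℝ := fun B => ∑ r ∈ Finset.range q, 2 * (∑ j ∈ Finset.range ((X + 1) / l),
      |∑ u ∈ Finset.Ico (j * l) ((j + 1) * l), gcl X q r B u| + l) with hG
  set NB := (Finset.Icc 1 X).filter (fun B => B % 2 = 1) with hNB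
  have hG0 : ∀ B, 0 ≤ G B := by
    intro B
    apply Finset.sum_nonneg; intro r _
    have : 0 ≤ ∑ j ∈ Finset.range ((X + 1) / l), |∑ u ∈ Finset.Ico (j * l) ((j + 1) * l), gcl X q r B u| :=
      Finset.sum_nonneg fun _ _ => abs_nonneg _
    positivity
  have s1 : |((∑ v ∈ Finset.Icc (-(X:ℤ)) X, ∑ u ∈ Finset.Icc 1 X, (if cnd d y u v then sp ⟨u, v⟩ else 0) : ℤ) : ℝ)| ≤
      2 * ∑ B ∈ NB, G B := by
    calc _ ≤ ∑ v ∈ Finset.Icc (-(X:ℤ)) X, |((∑ u ∈ Finset.Icc 1 X, (if cnd d y u v then sp ⟨u, v⟩ else 0) : ℤ) : ℝ)| := by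
          push_cast; exact Finset.abs_sum_le_sum_abs _ _
      _ ≤ ∑ v ∈ Finset.Icc (-(X:ℤ)) X, if v % 2 = 1 then G v.natAbs else 0 := by
          apply Finset.sum_le_sum; intro v _
          have := typeI_inner d y X hd (by omega) v l hl
          rw [Int.cast_abs] at this
          exact this
      _ = ∑ v ∈ (Finset.Icc (-(X:ℤ)) X).filter (fun v => v % 2 = 1), G v.natAbs := by rw [Finset.sum_filter]
      _ = ∑ B ∈ NB, ∑ v ∈ ((Finset.Icc (-(X:ℤ)) X).filter (fun v => v % 2 = 1)).filter (fun v => v.natAbs = B), G v.natAbs := by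
          rw [Finset.sum_fiberwise_of_maps_to]
          intro v hv
          simp only [hNB, Finset.mem_filter, Finset.mem_Icc] at hv ⊢
          omega
      _ ≤ ∑ B ∈ NB, 2 * G B := by
          apply Finset.sum_le_sum
          intro B _
          have e : ∑ v ∈ ((Finset.Icc (-(X:ℤ)) X).filter (fun v => v % 2 = 1)).filter (fun v => v.natAbs = B), G v.natAbs =
              ∑ v ∈ ((Finset.Icc (-(X:ℤ)) X).filter (fun v => v % 2 = 1)).filter (fun v => v.natAbs = B), G B := by
            apply Finset.sum_congr rfl
            intro v hv
            rw [(Finset.mem_filter.mp hv).2]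
          rw [e, Finset.sum_const, nsmul_eq_mul]
          apply mul_le_mul_of_nonneg_right _ (hG0 B)
          have : (((Finset.Icc (-(X:ℤ)) X).filter (fun v => v % 2 = 1)).filter (fun v => v.natAbs = B)).card ≤ ({(B:ℤ), -(B:ℤ)} : Finset ℤ).card := by
            apply Finset.card_le_card
            intro v hv
            have := (Finset.mem_filter.mp hv).2
            simp only [Finset.mem_insert, Finset.mem_singleton]
            omega
          have h2 := Finset.card_le_two (a := (B:ℤ)) (b := -(B:ℤ))
          exact_mod_cast this.trans h2
      _ = _ := by rw [Finset.mul_sum]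
  refine s1.trans ?_
  have hcell : ∀ r, ∀ j ∈ Finset.range ((X + 1) / l), ∑ B ∈ NB, |∑ u ∈ Finset.Ico (j * l) ((j + 1) * l), gcl X q r B u| ≤
      2 * Dv * (X:ℝ) ^ 2 / (h:ℝ) ^ 290 := by
    intro r j hj
    have := hker (fun u => if u ∈ Finset.Ico (j * l) ((j + 1) * l) ∧ u % q = r then 1 else 0)
      (by intro u; split_ifs <;> simp)
    refine le_trans (le_of_eq ?_) this
    apply Finset.sum_congr rfl
    intro B _
    congr 1
    unfold gcl
    rw [← Finset.sum_filter]
    simp only [ite_mul, one_mul, zero_mul]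
    rw [← Finset.sum_filter]
    apply Finset.sum_congr _ (fun _ _ => rfl)
    ext u
    simp only [Finset.mem_filter, Finset.mem_Icc, Finset.mem_Ico]
    tauto
  have hNBc : (NB.card : ℝ) ≤ X := by
    have : NB.card ≤ (Finset.Icc 1 X).card := Finset.card_filter_le _ _
    simp at this; exact_mod_cast this
  have s2 : ∑ B ∈ NB, G B ≤ q * (2 * (4 * (h:ℝ) ^ 145 * (2 * Dv * (X:ℝ) ^ 2 / (h:ℝ) ^ 290) + X * (X / (h:ℝ) ^ 145))) := by
    simp only [hG]
    rw [Finset.sum_comm]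
    calc _ ≤ ∑ r ∈ Finset.range q, (2 * (4 * (h:ℝ) ^ 145 * (2 * Dv * (X:ℝ) ^ 2 / (h:ℝ) ^ 290) + X * (X / (h:ℝ) ^ 145))) := by
          apply Finset.sum_le_sum
          intro r _
          rw [← Finset.mul_sum, Finset.sum_add_distrib, Finset.sum_comm, Finset.sum_const, nsmul_eq_mul]
          apply mul_le_mul_of_nonneg_left _ (by norm_num)
          apply add_le_add
          · refine (Finset.sum_le_sum (hcell r)).trans ?_
            rw [Finset.sum_const, nsmul_eq_mul, Finset.card_range]
            exact mul_le_mul_of_nonneg_right hJ (by positivity)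
          · exact mul_le_mul hNBc hl1 (by positivity) (by positivity)
      _ = _ := by simp
  have hX9r : (X:ℝ) ^ 2 ≤ 9 * x := by exact_mod_cast hX9
  have e3 : 2 * (q * (2 * (4 * (h:ℝ) ^ 145 * (2 * Dv * (X:ℝ) ^ 2 / (h:ℝ) ^ 290) + X * (X / (h:ℝ) ^ 145)))) =
      64 * d * (8 * Dv + 1) * (X:ℝ) ^ 2 / (h:ℝ) ^ 145 := by
    have e4 : (h:ℝ) ^ 290 = (h:ℝ) ^ 145 * (h:ℝ) ^ 145 := by rw [← pow_add]
    have e5 : (h:ℝ) ^ 145 ≠ 0 := by positivity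
    rw [e4, hq]
    generalize (h:ℝ) ^ 145 = H at *
    push_cast
    field_simp
    ring
  calc 2 * ∑ B ∈ NB, G B ≤ 2 * (q * (2 * (4 * (h:ℝ) ^ 145 * (2 * Dv * (X:ℝ) ^ 2 / (h:ℝ) ^ 290) + X * (X / (h:ℝ) ^ 145)))) := by
        linarith
    _ = 64 * d * (8 * Dv + 1) * (X:ℝ) ^ 2 / (h:ℝ) ^ 145 := e3
    _ ≤ 64 * d * (8 * Dv + Dv) * (9 * x) / (h:ℝ) ^ 145 := by gcongr
    _ = 5184 * (d * Dv * x) / (h:ℝ) ^ 145 := by ring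
    _ ≤ 20000 * (d * Dv * x) / (h:ℝ) ^ 145 := by gcongr; norm_num
    _ = _ := by ring

end QSpin

namespace QSpin

def Kk (w z : Zsqrtd 2) : ℤ := if (nm w * nm z) % 16 = 15 then sp (w * z) else 0

lemma Kk_comm (w z : Zsqrtd 2) : Kk w z = Kk z w := by
  unfold Kk; rw [mul_comm (nm w), mul_comm w]

lemma abs_Kk_le (w z : Zsqrtd 2) : |Kk w z| ≤ 1 := by
  unfold Kk; split_ifs
  · exact abs_sp_le _
  · simp

lemma Kk_eq {N M : ℕ} {w z : Zsqrtd 2} (hw : w ∈ Dle M) (hz : z ∈ Dle N) :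
    Kk w z = Phi (w.re % 16) (w.im % 16) (z.re % 16) (z.im % 16) * Fw w * Fw z * Kj w z := by
  obtain ⟨m, hm1, hm2, hm3, hm4⟩ := mem_Dle.mp hw
  obtain ⟨n, hn1, hn2, hn3, hn4⟩ := mem_Dle.mp hz
  have ht := twist w z (good_of_mem hm3 hm4) (good_of_mem hn3 hn4)
  rw [← Phi_mod]
  unfold Kj
  unfold nm at *
  rw [← ht]
  unfold Kk
  obtain ⟨-, -, -, e1⟩ := mem_Dn.mp hm4
  obtain ⟨-, -, -, e2⟩ := mem_Dn.mp hn4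
  unfold nm
  rw [e1, e2]
  simp only [Int.natAbs_natCast]
  have : (m * n) % 16 = 15 ↔ ((m:ℤ) * n) % 16 = 15 := by
    have : ((m:ℤ) * n) = ((m * n : ℕ) : ℤ) := by push_cast; rfl
    rw [this]; omega
  simp only [this]

lemma BL1 (N M Dv h : ℕ) (hh : 1 ≤ h) (hN : h ^ 24 ≤ N) (hNM : N ≤ M)
    (hD : ∀ n : ℕ, n ≠ 0 → n ≤ M ^ 6 → n.divisors.card ≤ Dv)
    (A B : Finset (Zsqrtd 2)) (hA : A ⊆ Dle N) (hB : B ⊆ Dle M)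
    (α : Zsqrtd 2 → ℝ) (hα : ∀ u, |α u| ≤ 1) :
    ∑ z ∈ A, |∑ w ∈ B, α w * (Kk w z : ℤ)| ≤ 1024 * (Dv:ℝ) ^ 3 * N * M / (h:ℝ) ^ 2 := by
  classical
  have hN1 : 1 ≤ N := (Nat.one_le_pow _ _ hh).trans hN
  have hDv : 1 ≤ Dv := by
    simpa using hD 1 (by norm_num) (Nat.one_le_pow _ _ (hN1.trans hNM))
  have hDr : (1:ℝ) ≤ Dv := by exact_mod_cast hDv
  have hhr : (1:ℝ) ≤ h := by exact_mod_cast hh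
  have hker : ∀ (B' : Finset (Zsqrtd 2)), B' ⊆ B → ∀ α : Zsqrtd 2 → ℝ, (∀ u, |α u| ≤ 1) →
      ∑ z ∈ A, |∑ w ∈ B', α w * (Kj w z : ℤ)| ≤ 4 * (Dv:ℝ) ^ 3 * N * M / (h:ℝ) ^ 2 := by
    intro B' hB' α hα
    have hk := kernel2 N M Dv hN1 hNM hD A B' hA (hB'.trans hB) α hα
    have h12 : 10 ^ 7 * (N:ℝ) ^ 11 * (M:ℝ) ^ 12 * (Dv : ℝ) ^ 31 ≤ (4 * (Dv:ℝ) ^ 3 * N * M / (h:ℝ) ^ 2) ^ 12 := by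
      rw [div_pow, le_div_iff₀ (by positivity)]
      have a1 : (h:ℝ) ^ 24 ≤ N := by exact_mod_cast hN
      have a2 : (Dv:ℝ) ^ 31 ≤ (Dv:ℝ) ^ 36 := pow_le_pow_right₀ hDr (by norm_num)
      calc 10 ^ 7 * (N:ℝ) ^ 11 * (M:ℝ) ^ 12 * (Dv : ℝ) ^ 31 * ((h:ℝ) ^ 2) ^ 12
          = 10 ^ 7 * (N:ℝ) ^ 11 * (M:ℝ) ^ 12 * (Dv : ℝ) ^ 31 * (h:ℝ) ^ 24 := by rw [← pow_mul]
        _ ≤ 4 ^ 12 * (N:ℝ) ^ 11 * (M:ℝ) ^ 12 * (Dv : ℝ) ^ 36 * N := by gcongr; norm_num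
        _ = _ := by ring
    exact le_of_pow_le_pow_left₀ (by norm_num) (by positivity) (hk.trans h12)
  set I : Finset (ℤ × ℤ) := (Finset.Icc 0 15) ×ˢ (Finset.Icc 0 15) with hI
  set cl : Zsqrtd 2 → ℤ × ℤ := fun w => (w.re % 16, w.im % 16) with hcl
  have step : ∀ z ∈ A, |∑ w ∈ B, α w * (Kk w z : ℤ)| ≤
      ∑ c ∈ I, |∑ w ∈ B.filter (fun w => cl w = c), (α w * Fw w) * (Kj w z : ℤ)| := by
    intro z hz
    rw [← Finset.sum_fiberwise_of_maps_to (t := I) (g := cl)]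
    · refine (Finset.abs_sum_le_sum_abs _ _).trans (Finset.sum_le_sum fun c _ => ?_)
      have : ∑ w ∈ B.filter (fun w => cl w = c), α w * ((Kk w z : ℤ):ℝ) =
          ((Phi c.1 c.2 (z.re % 16) (z.im % 16) * Fw z : ℤ) : ℝ) * ∑ w ∈ B.filter (fun w => cl w = c), (α w * Fw w) * (Kj w z : ℤ) := by
        rw [Finset.mul_sum]
        apply Finset.sum_congr rfl
        intro w hw
        rw [Finset.mem_filter] at hw
        rw [Kk_eq (hB hw.1) (hA hz), ← hw.2]
        simp only [hcl]
        push_cast; ring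
      rw [this, abs_mul]
      apply mul_le_of_le_one_left (abs_nonneg _)
      have h1 := abs_Phi_le c.1 c.2 (z.re % 16) (z.im % 16)
      have h2 := abs_Fw_le z
      have : |Phi c.1 c.2 (z.re % 16) (z.im % 16) * Fw z| ≤ 1 := by
        rw [abs_mul]; exact mul_le_one₀ h1 (abs_nonneg _) h2
      exact_mod_cast this
    · intro w _
      simp only [hI, hcl, Finset.mem_product, Finset.mem_Icc]
      omega
  have hIc : I.card = 256 := by simp [hI]
  calc _ ≤ ∑ z ∈ A, ∑ c ∈ I, |∑ w ∈ B.filter (fun w => cl w = c), (α w * Fw w) * (Kj w z : ℤ)| := Finset.sum_le_sum step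
    _ = ∑ c ∈ I, ∑ z ∈ A, |∑ w ∈ B.filter (fun w => cl w = c), (α w * Fw w) * (Kj w z : ℤ)| := Finset.sum_comm
    _ ≤ ∑ c ∈ I, 4 * (Dv:ℝ) ^ 3 * N * M / (h:ℝ) ^ 2 := by
        apply Finset.sum_le_sum
        intro c _
        apply hker _ (Finset.filter_subset _ _) (fun w => α w * Fw w)
        intro u
        rw [abs_mul]
        have := abs_Fw_le u
        exact mul_le_one₀ (hα u) (abs_nonneg _) (by exact_mod_cast this)
    _ = _ := by rw [Finset.sum_const, hIc]; simp; ring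

/-- dualize: from one side to the other -/
lemma dual {ι κ : Type*} (A : Finset ι) (B : Finset κ) (K : ι → κ → ℝ) (T : ℝ)
    (H : ∀ α : κ → ℝ, (∀ u, |α u| ≤ 1) → ∑ z ∈ A, |∑ w ∈ B, α w * K z w| ≤ T)
    (β : ι → ℝ) (hβ : ∀ u, |β u| ≤ 1) : ∑ w ∈ B, |∑ z ∈ A, β z * K z w| ≤ T := by
  set s : κ → ℝ := fun w => SignType.sign (∑ z ∈ A, β z * K z w) with hs
  have hs1 : ∀ w, |s w| ≤ 1 := by
    intro w
    simp only [hs]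
    rcases SignType.trichotomy (SignType.sign (∑ z ∈ A, β z * K z w)) with h | h | h <;> rw [h] <;> simp
  refine le_trans ?_ (H s hs1)
  calc ∑ w ∈ B, |∑ z ∈ A, β z * K z w| = ∑ w ∈ B, s w * ∑ z ∈ A, β z * K z w := by
        apply Finset.sum_congr rfl; intro w _; rw [← sign_mul_self]
    _ = ∑ z ∈ A, β z * ∑ w ∈ B, s w * K z w := by
        simp only [Finset.mul_sum]
        rw [Finset.sum_comm]
        apply Finset.sum_congr rfl; intro z _
        apply Finset.sum_congr rfl; intro w _; ring
    _ ≤ ∑ z ∈ A, |∑ w ∈ B, s w * K z w| := by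
        apply Finset.sum_le_sum; intro z _
        refine (le_abs_self _).trans ?_
        rw [abs_mul]
        exact mul_le_of_le_one_left (abs_nonneg _) (hβ z)

lemma BL (N M Dv h : ℕ) (hh : 1 ≤ h) (hN : h ^ 24 ≤ N) (hM : h ^ 24 ≤ M)
    (hD : ∀ n : ℕ, n ≠ 0 → n ≤ (max N M) ^ 6 → n.divisors.card ≤ Dv)
    (A B : Finset (Zsqrtd 2)) (hA : A ⊆ Dle N) (hB : B ⊆ Dle M)
    (α : Zsqrtd 2 → ℝ) (hα : ∀ u, |α u| ≤ 1) :
    ∑ z ∈ A, |∑ w ∈ B, α w * (Kk z w : ℤ)| ≤ 1024 * (Dv:ℝ) ^ 3 * N * M / (h:ℝ) ^ 2 := by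
  rcases le_total N M with hNM | hNM
  · have := BL1 N M Dv h hh hN hNM (by rwa [max_eq_right hNM] at hD) A B hA hB α hα
    simpa only [Kk_comm] using this
  · apply dual B A (fun w z => ((Kk z w : ℤ):ℝ)) _ _ α hα
    intro β hβ
    have := BL1 M N Dv h hh hM hNM (by rwa [max_eq_left hNM] at hD) B A hB hA β hβ
    refine this.trans (le_of_eq ?_)
    ring

end QSpin

namespace QSpin

noncomputable def Gm (m n : ℕ) : ℤ := ∑ w ∈ Dn m, ∑ z ∈ Dn n, Kk w z

lemma Gm_zero {m n : ℕ} (h : (m * n) % 16 ≠ 15) : Gm m n = 0 := by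
  apply Finset.sum_eq_zero; intro w hw
  apply Finset.sum_eq_zero; intro z hz
  unfold Kk
  rw [nm_of_mem hw, nm_of_mem hz, if_neg h]

lemma odd_of_mul {m n : ℕ} (h : (m * n) % 16 = 15) : m % 2 = 1 ∧ n % 2 = 1 := by
  have h2 : (m * n) % 2 = 1 := by omega
  constructor
  · by_contra hc
    have : m % 2 = 0 := by omega
    rw [Nat.mul_mod, this] at h2; simp at h2
  · by_contra hc
    have : n % 2 = 0 := by omega
    rw [Nat.mul_mod, this] at h2; simp at h2

lemma Aa_eq_Gm {m n : ℕ} (h : m.Coprime n) : Aa (m * n) = Gm m n := by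
  by_cases h15 : (m * n) % 16 = 15
  · obtain ⟨h1, h2⟩ := odd_of_mul h15
    unfold Aa
    rw [if_pos h15, sum_sp_mul h1 h2 h (by omega)]
    apply Finset.sum_congr rfl; intro w hw
    apply Finset.sum_congr rfl; intro z hz
    unfold Kk
    rw [nm_of_mem hw, nm_of_mem hz, if_pos h15]
  · rw [Gm_zero h15]
    unfold Aa; rw [if_neg h15]

lemma abs_Gm_le (m n Dv : ℕ) (hm : m.divisors.card ≤ Dv) (hn : n.divisors.card ≤ Dv) : |Gm m n| ≤ (Dv:ℤ) ^ 2 := by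
  by_cases h15 : (m * n) % 16 = 15
  · obtain ⟨h1, h2⟩ := odd_of_mul h15
    have c1 : (Dn m).card ≤ Dv := (card_Dn_le h1).trans hm
    have c2 : (Dn n).card ≤ Dv := (card_Dn_le h2).trans hn
    unfold Gm
    calc _ ≤ ∑ w ∈ Dn m, ∑ z ∈ Dn n, |Kk w z| :=
          (Finset.abs_sum_le_sum_abs _ _).trans (Finset.sum_le_sum fun _ _ => Finset.abs_sum_le_sum_abs _ _)
      _ ≤ ∑ w ∈ Dn m, ∑ z ∈ Dn n, 1 := Finset.sum_le_sum fun _ _ => Finset.sum_le_sum fun _ _ => abs_Kk_le _ _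
      _ = ((Dn m).card * (Dn n).card : ℕ) := by simp
      _ ≤ (Dv * Dv : ℕ) := by exact_mod_cast Nat.mul_le_mul c1 c2
      _ = _ := by push_cast; ring
  · rw [Gm_zero h15]; simp

noncomputable def Un (S : Finset ℕ) : Finset (Zsqrtd 2) := by
  classical
  exact S.biUnion Dn

lemma mem_Un {S : Finset ℕ} {w : Zsqrtd 2} : w ∈ Un S ↔ ∃ m ∈ S, w ∈ Dn m := by
  unfold Un; simp

lemma sum_Un (S : Finset ℕ) (f : ℕ → Zsqrtd 2 → ℝ) : ∑ m ∈ S, ∑ w ∈ Dn m, f m w = ∑ w ∈ Un S, f (nm w) w := by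
  classical
  unfold Un
  rw [Finset.sum_biUnion]
  · apply Finset.sum_congr rfl; intro m _
    apply Finset.sum_congr rfl; intro w hw
    rw [nm_of_mem hw]
  · intro m _ n _ hmn
    simp only [Function.onFun]
    rw [Finset.disjoint_left]
    intro w h1 h2
    exact hmn ((nm_of_mem h1).symm.trans (nm_of_mem h2))

lemma dyadic (x h Dv : ℕ) (hh : 1 ≤ h)
    (hD : ∀ n : ℕ, n ≠ 0 → n ≤ 1000 * x ^ 6 → n.divisors.card ≤ Dv) (a c : ℕ → ℝ)
    (ha : ∀ m, |a m| ≤ 1) (hc : ∀ m, |c m| ≤ 1) (j : ℕ) (S : Finset ℕ)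
    (hS : ∀ m ∈ S, h ^ 24 < m ∧ m ≤ x ∧ 2 ^ j ≤ m ∧ m < 2 ^ (j + 1)) :
    |∑ m ∈ S, a m * ∑ n ∈ Finset.Ico (h ^ 24 + 1) (x / m + 1), c n * (Gm m n : ℤ)| ≤ 20000 * (Dv:ℝ) ^ 3 * x / h := by
  classical
  rcases S.eq_empty_or_nonempty with rfl | ⟨m0, hm0⟩
  · simp; positivity
  obtain ⟨u1, u2, u3, u4⟩ := hS m0 hm0
  set M := 2 ^ (j + 1) with hM
  set Y := x / 2 ^ j with hY
  have hM2 : M = 2 * 2 ^ j := by rw [hM, pow_succ]; ring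
  have hMx : M ≤ 2 * x := by omega
  have hjp : 0 < 2 ^ j := by positivity
  have hYx : Y ≤ x := Nat.div_le_self _ _
  have hx1 : 1 ≤ x := by omega
  have hYm : ∀ m ∈ S, x / m ≤ Y := fun m hm => Nat.div_le_div_left (hS m hm).2.2.1 hjp
  by_cases hYU : Y ≤ h ^ 24
  · rw [Finset.sum_eq_zero]
    · simp; positivity
    · intro m hm
      rw [Finset.Ico_eq_empty (by have := hYm m hm; omega)]
      simp
  push Not at hYU
  have hD6 : ∀ n : ℕ, n ≠ 0 → n ≤ (max M Y) ^ 6 → n.divisors.card ≤ Dv := by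
    intro n h0 hn
    apply hD n h0
    have : max M Y ≤ 2 * x := by simp only [max_le_iff]; omega
    have := Nat.pow_le_pow_left this 6
    have e : (2 * x) ^ 6 = 64 * x ^ 6 := by ring
    omega
  have hDx : ∀ n : ℕ, n ≠ 0 → n ≤ 2 * x → n.divisors.card ≤ Dv := by
    intro n h0 hn
    apply hD n h0
    have : x ≤ x ^ 6 := Nat.le_self_pow (by norm_num) x
    omega
  have hDv : 1 ≤ Dv := by simpa using hDx 1 (by norm_num) (by omega)
  have hDr : (1:ℝ) ≤ Dv := by exact_mod_cast hDv
  have hhr : (1:ℝ) ≤ h := by exact_mod_cast hh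
  set B := Un (S.filter (fun m => m % 2 = 1)) with hB
  have memB : ∀ w ∈ B, nm w ∈ S ∧ nm w % 2 = 1 ∧ w ∈ Dn (nm w) := by
    intro w hw
    obtain ⟨m, hm, hwm⟩ := mem_Un.mp hw
    rw [Finset.mem_filter] at hm
    rw [nm_of_mem hwm]
    exact ⟨hm.1, hm.2, hwm⟩
  have hBM : B ⊆ Dle M := by
    intro w hw
    obtain ⟨h1, h2, h3⟩ := memB w hw
    have := hS _ h1
    exact mem_Dle.mpr ⟨nm w, by omega, by omega, h2, h3⟩
  set g : Zsqrtd 2 → ℕ → ℝ := fun w n => if n % 2 = 1 ∧ n ≤ Y then c n * ∑ z ∈ Dn n, ((Kk w z : ℤ):ℝ) else 0 with hg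
  have hgF : ∀ w n, |g w n| ≤ Dv := by
    intro w n
    simp only [hg]
    split_ifs with hn
    · rw [abs_mul]
      have hcard : (Dn n).card ≤ Dv := (card_Dn_le hn.1).trans (hDx n (by omega) (by omega))
      have : |∑ z ∈ Dn n, ((Kk w z : ℤ):ℝ)| ≤ Dv := by
        calc _ ≤ ∑ z ∈ Dn n, |((Kk w z : ℤ):ℝ)| := Finset.abs_sum_le_sum_abs _ _
          _ ≤ ∑ z ∈ Dn n, (1:ℝ) := Finset.sum_le_sum fun z _ => by exact_mod_cast abs_Kk_le w z
          _ = (Dn n).card := by simp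
          _ ≤ Dv := by exact_mod_cast hcard
      exact (mul_le_of_le_one_left (abs_nonneg _) (hc n)).trans this
    · simp
  have e1 : ∑ m ∈ S, a m * ∑ n ∈ Finset.Ico (h ^ 24 + 1) (x / m + 1), c n * ((Gm m n : ℤ):ℝ) =
      ∑ w ∈ B, a (nm w) * ∑ n ∈ Finset.Ico (h ^ 24 + 1) (x / nm w + 1), g w n := by
    rw [hB, ← sum_Un _ (fun m w => a m * ∑ n ∈ Finset.Ico (h ^ 24 + 1) (x / m + 1), g w n)]
    rw [Finset.sum_filter]
    apply Finset.sum_congr rfl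
    intro m hm
    split_ifs with hodd
    · rw [← Finset.mul_sum, Finset.sum_comm]
      congr 1
      apply Finset.sum_congr rfl
      intro n hn
      rw [Finset.mem_Ico] at hn
      have hnY : n ≤ Y := by have := hYm m hm; omega
      by_cases hn2 : n % 2 = 1
      · simp only [hg, hn2, hnY, and_self, if_true]
        rw [← Finset.mul_sum]; unfold Gm; push_cast; rfl
      · rw [Gm_zero (fun h => hn2 (odd_of_mul h).2)]
        simp [hg, hn2]
    · rw [Finset.sum_eq_zero, mul_zero]
      intro n _
      rw [Gm_zero (fun h => hodd (odd_of_mul h).1)]; simp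
  rw [e1]
  set l := Y / h with hl
  have hhY : h ≤ Y := (Nat.le_self_pow (by norm_num) h).trans hYU.le
  have hl1 : 1 ≤ l := Nat.div_pos hhY hh
  have hlr : (l:ℝ) ≤ Y / h := Nat.cast_div_le
  have hJ : (((Y + 1) / l : ℕ) : ℝ) ≤ 4 * h := by
    have : (Y + 1) / l ≤ 4 * h := by
      apply Nat.div_le_of_le_mul
      have h1 : Y < h * (l + 1) := Nat.lt_mul_div_succ Y hh
      nlinarith
    exact_mod_cast this
  have hcell : ∀ i ∈ Finset.range ((Y + 1) / l), ∑ w ∈ B, |∑ n ∈ Finset.Ico (i * l) ((i + 1) * l), g w n| ≤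
      1024 * (Dv:ℝ) ^ 3 * M * Y / (h:ℝ) ^ 2 := by
    intro i _
    set A := Un ((Finset.Ico (i * l) ((i + 1) * l)).filter (fun n => n % 2 = 1 ∧ n ≤ Y)) with hA
    have hAY : A ⊆ Dle Y := by
      intro z hz
      obtain ⟨m, hm, hwm⟩ := mem_Un.mp hz
      rw [Finset.mem_filter] at hm
      exact mem_Dle.mpr ⟨m, by omega, hm.2.2, hm.2.1, hwm⟩
    refine le_trans (le_of_eq ?_) (BL M Y Dv h hh (by omega) hYU.le hD6 B A hBM hAY (fun z => c (nm z)) (fun z => hc _))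
    apply Finset.sum_congr rfl
    intro w _
    congr 1
    rw [hA, ← sum_Un _ (fun n z => c n * ((Kk w z : ℤ):ℝ)), Finset.sum_filter]
    apply Finset.sum_congr rfl
    intro n _
    simp only [hg]
    rw [← Finset.mul_sum]
  have hBc : (B.card : ℝ) ≤ M * Dv := by
    have := (Finset.card_le_card hBM).trans (card_Dle_le (M := M) (Dv := Dv) (fun n h0 hn => hDx n h0 (by omega)))
    exact_mod_cast this
  have hMY : (M:ℝ) * Y ≤ 2 * x := by
    have : 2 ^ j * Y ≤ x := Nat.mul_div_le x (2 ^ j)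
    have : M * Y ≤ 2 * x := by rw [hM2]; nlinarith
    exact_mod_cast this
  calc _ ≤ ∑ w ∈ B, |∑ n ∈ Finset.Ico (h ^ 24 + 1) (x / nm w + 1), g w n| := by
        refine (Finset.abs_sum_le_sum_abs _ _).trans (Finset.sum_le_sum fun w _ => ?_)
        rw [abs_mul]
        exact mul_le_of_le_one_left (abs_nonneg _) (ha _)
    _ ≤ ∑ w ∈ B, 2 * (∑ i ∈ Finset.range ((Y + 1) / l), |∑ n ∈ Finset.Ico (i * l) ((i + 1) * l), g w n| + l * Dv) := by
        apply Finset.sum_le_sum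
        intro w hw
        exact block_Ico (g w) Dv (hgF w) l hl1 (Y + 1) _ _ (by have := hYm _ (memB w hw).1; omega)
    _ = 2 * (∑ i ∈ Finset.range ((Y + 1) / l), ∑ w ∈ B, |∑ n ∈ Finset.Ico (i * l) ((i + 1) * l), g w n| + B.card * (l * Dv)) := by
        rw [← Finset.mul_sum, Finset.sum_add_distrib, Finset.sum_comm, Finset.sum_const, nsmul_eq_mul]
    _ ≤ 2 * ((4 * h) * (1024 * (Dv:ℝ) ^ 3 * M * Y / (h:ℝ) ^ 2) + (M * Dv) * (Y / h * Dv)) := by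
        have t1 : ∑ i ∈ Finset.range ((Y + 1) / l), ∑ w ∈ B, |∑ n ∈ Finset.Ico (i * l) ((i + 1) * l), g w n| ≤
            (4 * h) * (1024 * (Dv:ℝ) ^ 3 * M * Y / (h:ℝ) ^ 2) := by
          refine (Finset.sum_le_sum hcell).trans ?_
          rw [Finset.sum_const, nsmul_eq_mul, Finset.card_range]
          exact mul_le_mul_of_nonneg_right hJ (by positivity)
        have t2 : (B.card:ℝ) * (l * Dv) ≤ (M * Dv) * (Y / h * Dv) := by gcongr
        linarith
    _ = (8192 * (Dv:ℝ) ^ 3 + 2 * (Dv:ℝ) ^ 2) * (M * Y) / h := by field_simp; ring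
    _ ≤ (8192 * (Dv:ℝ) ^ 3 + 2 * (Dv:ℝ) ^ 3) * (2 * x) / h := by gcongr <;> first | exact hDr | norm_num
    _ = 16388 * ((Dv:ℝ) ^ 3 * x / h) := by ring
    _ ≤ 20000 * ((Dv:ℝ) ^ 3 * x / h) := by gcongr; norm_num
    _ = _ := by ring

end QSpin

namespace QSpin

lemma log_le_Dv {x Dv m : ℕ} (hDx : ∀ n : ℕ, n ≠ 0 → n ≤ x → n.divisors.card ≤ Dv) (hm : 1 ≤ m) (hmx : m ≤ x) :
    Nat.log 2 m + 1 ≤ Dv ∧ Real.log m ≤ Dv := by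
  have h1 : 2 ^ Nat.log 2 m ≤ m := Nat.pow_log_le_self 2 (by omega)
  have h2 : Nat.log 2 m + 1 ≤ Dv := by
    have := hDx (2 ^ Nat.log 2 m) (by positivity) (h1.trans hmx)
    rwa [Nat.divisors_prime_pow Nat.prime_two, Finset.card_map, Finset.card_range] at this
  refine ⟨h2, ?_⟩
  have h3 : m < 2 ^ (Nat.log 2 m + 1) := Nat.lt_pow_succ_log_self (by norm_num) m
  have h4 : (m:ℝ) ≤ 2 ^ (Nat.log 2 m + 1) := by exact_mod_cast h3.le
  have h5 := Real.log_le_log (by exact_mod_cast hm) h4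
  rw [Real.log_pow] at h5
  have h6 : Real.log 2 ≤ 1 := by have := Real.log_two_lt_d9; linarith
  have h7 : ((Nat.log 2 m + 1 : ℕ):ℝ) ≤ Dv := by exact_mod_cast h2
  have h8 : (0:ℝ) ≤ ((Nat.log 2 m + 1 : ℕ):ℝ) := by positivity
  nlinarith

lemma bad_sq {m n : ℕ} (hm : IsPrimePow m) (h : ¬ m.Coprime n) : ∃ s, s ^ 2 ∣ m * n ∧ m ≤ s ^ 2 := by
  obtain ⟨p, k, hp, hk, rfl⟩ := hm
  have hp' : p.Prime := hp.nat_prime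
  have hpn : p ∣ n := by
    by_contra hc
    exact h (Nat.Coprime.pow_left k ((Nat.Prime.coprime_iff_not_dvd hp').mpr hc))
  rcases Nat.even_or_odd' k with ⟨i, rfl | rfl⟩
  · exact ⟨p ^ i, by rw [← pow_mul, mul_comm i 2]; exact Dvd.intro _ rfl, by rw [← pow_mul, mul_comm i 2]⟩
  · refine ⟨p ^ (i + 1), ?_, ?_⟩
    · have : (p ^ (i + 1)) ^ 2 = p ^ (2 * i + 1) * p := by ring
      rw [this]; exact Nat.mul_dvd_mul_left _ hpn
    · rw [← pow_mul]; exact Nat.pow_le_pow_right hp'.pos (by omega)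

open Classical in
lemma bad_count (x t : ℕ) (ht : 1 ≤ t) : ((((Finset.Icc 1 x).filter (fun N => ∃ s, t < s ∧ s ^ 2 ∣ N)).card : ℕ) : ℝ) ≤ x / t := by
  classical
  by_cases hxt : x ≤ t
  · rw [Finset.filter_eq_empty_iff.mpr]
    · simp; positivity
    · rintro N hN ⟨s, hs, hd⟩
      rw [Finset.mem_Icc] at hN
      have := Nat.le_of_dvd (by omega) hd
      have : s ≤ s ^ 2 := Nat.le_self_pow (by norm_num) s
      omega
  push Not at hxt
  have hsub : (Finset.Icc 1 x).filter (fun N => ∃ s, t < s ∧ s ^ 2 ∣ N) ⊆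
      (Finset.Ioc t x).biUnion (fun s => (Finset.Ioc 0 x).filter (fun N => s ^ 2 ∣ N)) := by
    intro N hN
    rw [Finset.mem_filter, Finset.mem_Icc] at hN
    obtain ⟨hN, s, hs, hd⟩ := hN
    have h1 := Nat.le_of_dvd (by omega) hd
    have h2 : s ≤ s ^ 2 := Nat.le_self_pow (by norm_num) s
    simp only [Finset.mem_biUnion, Finset.mem_filter, Finset.mem_Ioc]
    exact ⟨s, by omega, by omega, hd⟩
  have h1 := (Finset.card_le_card hsub).trans Finset.card_biUnion_le
  calc _ ≤ ((∑ s ∈ Finset.Ioc t x, ((Finset.Ioc 0 x).filter (fun N => s ^ 2 ∣ N)).card : ℕ) : ℝ) := by exact_mod_cast h1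
    _ ≤ ∑ s ∈ Finset.Ioc t x, x * ((s:ℝ) ^ 2)⁻¹ := by
        push_cast
        apply Finset.sum_le_sum
        intro s _
        rw [Nat.Ioc_filter_dvd_card_eq_div]
        have := @Nat.cast_div_le ℝ _ _ _ x (s ^ 2)
        rw [← div_eq_mul_inv]; push_cast at this; exact this
    _ = x * ∑ s ∈ Finset.Ioc t x, ((s:ℝ) ^ 2)⁻¹ := by rw [Finset.mul_sum]
    _ ≤ x * ((t:ℝ)⁻¹ - (x:ℝ)⁻¹) := by
        apply mul_le_mul_of_nonneg_left _ (by positivity)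
        exact sum_Ioc_inv_sq_le_sub (by omega) hxt.le
    _ ≤ x / t := by
        rw [div_eq_mul_inv]
        apply mul_le_mul_of_nonneg_left _ (by positivity)
        have : (0:ℝ) ≤ (x:ℝ)⁻¹ := by positivity
        linarith

open ArithmeticFunction in
theorem typeII (x h Dv : ℕ) (hh : 1 ≤ h)
    (hD : ∀ n : ℕ, n ≠ 0 → n ≤ 1000 * x ^ 6 → n.divisors.card ≤ Dv) (c : ℕ → ℝ)
    (hc : ∀ n, 1 ≤ n → n ≤ x → |c n| ≤ Dv) :
    |∑ m ∈ Finset.Ioc (h ^ 24) x, vonMangoldt m * ∑ n ∈ Finset.Ico (h ^ 24 + 1) (x / m + 1), c n * (Aa (m * n) : ℤ)|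
      ≤ 20002 * (Dv:ℝ) ^ 6 * x / h := by
  classical
  rcases Nat.eq_zero_or_pos x with rfl | hx1
  · simp
  have hDx : ∀ n : ℕ, n ≠ 0 → n ≤ x → n.divisors.card ≤ Dv := by
    intro n h0 hn
    apply hD n h0
    have : x ≤ x ^ 6 := Nat.le_self_pow (by norm_num) x
    omega
  have hDv : 1 ≤ Dv := by simpa using hDx 1 (by norm_num) (by omega)
  have hDr : (1:ℝ) ≤ Dv := by exact_mod_cast hDv
  have hD0 : (Dv:ℝ) ≠ 0 := by positivity
  have hhr : (1:ℝ) ≤ h := by exact_mod_cast hh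
  have hL : ∀ m, 1 ≤ m → m ≤ x → |(vonMangoldt m : ℝ)| ≤ Dv := by
    intro m h1 h2
    rw [abs_of_nonneg vonMangoldt_nonneg]
    exact vonMangoldt_le_log.trans (log_le_Dv hDx h1 h2).2
  have hsplit : ∑ m ∈ Finset.Ioc (h ^ 24) x, vonMangoldt m * ∑ n ∈ Finset.Ico (h ^ 24 + 1) (x / m + 1), c n * ((Aa (m * n) : ℤ):ℝ)
      = ∑ m ∈ Finset.Ioc (h ^ 24) x, vonMangoldt m * ∑ n ∈ Finset.Ico (h ^ 24 + 1) (x / m + 1), c n * ((Gm m n : ℤ):ℝ)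
      + ∑ m ∈ Finset.Ioc (h ^ 24) x, ∑ n ∈ Finset.Ico (h ^ 24 + 1) (x / m + 1), vonMangoldt m * c n * (((Aa (m * n) - Gm m n : ℤ)):ℝ) := by
    rw [← Finset.sum_add_distrib]
    apply Finset.sum_congr rfl; intro m _
    rw [Finset.mul_sum, Finset.mul_sum, ← Finset.sum_add_distrib]
    apply Finset.sum_congr rfl; intro n _
    push_cast; ring
  have main : |∑ m ∈ Finset.Ioc (h ^ 24) x, vonMangoldt m * ∑ n ∈ Finset.Ico (h ^ 24 + 1) (x / m + 1), c n * ((Gm m n : ℤ):ℝ)|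
      ≤ 20000 * (Dv:ℝ) ^ 6 * x / h := by
    rw [← Finset.sum_fiberwise_of_maps_to (t := Finset.range Dv) (g := fun m => Nat.log 2 m)]
    · set a' : ℕ → ℝ := fun m => if 1 ≤ m ∧ m ≤ x then vonMangoldt m / Dv else 0 with ha'
      set c' : ℕ → ℝ := fun m => if 1 ≤ m ∧ m ≤ x then c m / Dv else 0 with hc'
      have ha1 : ∀ m, |a' m| ≤ 1 := by
        intro m; simp only [ha']; split_ifs with hm
        · rw [abs_div, Nat.abs_cast, div_le_one (by positivity)]; exact hL m hm.1 hm.2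
        · simp
      have hc1 : ∀ m, |c' m| ≤ 1 := by
        intro m; simp only [hc']; split_ifs with hm
        · rw [abs_div, Nat.abs_cast, div_le_one (by positivity)]; exact hc m hm.1 hm.2
        · simp
      calc _ ≤ ∑ j ∈ Finset.range Dv, (Dv:ℝ) ^ 2 * (20000 * (Dv:ℝ) ^ 3 * x / h) := by
            refine (Finset.abs_sum_le_sum_abs _ _).trans (Finset.sum_le_sum fun j _ => ?_)
            have := dyadic x h Dv hh hD a' c' ha1 hc1 j ((Finset.Ioc (h ^ 24) x).filter (fun m => Nat.log 2 m = j)) (by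
              intro m hm
              rw [Finset.mem_filter, Finset.mem_Ioc] at hm
              obtain ⟨⟨h1, h2⟩, rfl⟩ := hm
              exact ⟨h1, h2, Nat.pow_log_le_self 2 (by omega), Nat.lt_pow_succ_log_self (by norm_num) m⟩)
            have e : ∑ m ∈ (Finset.Ioc (h ^ 24) x).filter (fun m => Nat.log 2 m = j), vonMangoldt m * ∑ n ∈ Finset.Ico (h ^ 24 + 1) (x / m + 1), c n * ((Gm m n : ℤ):ℝ)
                = (Dv:ℝ) ^ 2 * ∑ m ∈ (Finset.Ioc (h ^ 24) x).filter (fun m => Nat.log 2 m = j), a' m * ∑ n ∈ Finset.Ico (h ^ 24 + 1) (x / m + 1), c' n * ((Gm m n : ℤ):ℝ) := by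
              rw [Finset.mul_sum]
              apply Finset.sum_congr rfl
              intro m hm
              rw [Finset.mem_filter, Finset.mem_Ioc] at hm
              rw [Finset.mul_sum, Finset.mul_sum, Finset.mul_sum]
              apply Finset.sum_congr rfl
              intro n hn
              rw [Finset.mem_Ico] at hn
              have h3 : x / m ≤ x := Nat.div_le_self _ _
              simp only [ha', hc']
              rw [if_pos ⟨by omega, by omega⟩, if_pos ⟨by omega, by omega⟩]
              field_simp
            rw [e, abs_mul, abs_of_nonneg (by positivity : (0:ℝ) ≤ (Dv:ℝ) ^ 2)]
            exact mul_le_mul_of_nonneg_left this (by positivity)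
        _ = 20000 * (Dv:ℝ) ^ 6 * x / h := by simp; ring
    · intro m hm
      rw [Finset.mem_Ioc] at hm
      rw [Finset.mem_range]
      have := (log_le_Dv hDx (m := m) (by omega) hm.2).1
      omega
  have err : |∑ m ∈ Finset.Ioc (h ^ 24) x, ∑ n ∈ Finset.Ico (h ^ 24 + 1) (x / m + 1), vonMangoldt m * c n * (((Aa (m * n) - Gm m n : ℤ)):ℝ)|
      ≤ 2 * (Dv:ℝ) ^ 6 * x / h := by
    set P : Finset (ℕ × ℕ) := ((Finset.Ioc (h ^ 24) x) ×ˢ (Finset.Icc 1 x)).filter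
      (fun p => p.1 * p.2 ≤ x ∧ IsPrimePow p.1 ∧ ¬ p.1.Coprime p.2) with hP
    have t1 : |∑ m ∈ Finset.Ioc (h ^ 24) x, ∑ n ∈ Finset.Ico (h ^ 24 + 1) (x / m + 1), vonMangoldt m * c n * (((Aa (m * n) - Gm m n : ℤ)):ℝ)|
        ≤ ∑ m ∈ Finset.Ioc (h ^ 24) x, ∑ n ∈ Finset.Icc 1 x, if m * n ≤ x ∧ IsPrimePow m ∧ ¬ m.Coprime n then 2 * (Dv:ℝ) ^ 4 else 0 := by
      refine (Finset.abs_sum_le_sum_abs _ _).trans (Finset.sum_le_sum fun m hm => ?_)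
      rw [Finset.mem_Ioc] at hm
      refine (Finset.abs_sum_le_sum_abs _ _).trans ?_
      have hsub : Finset.Ico (h ^ 24 + 1) (x / m + 1) ⊆ Finset.Icc 1 x := by
        intro n hn
        rw [Finset.mem_Ico] at hn
        have := Nat.div_le_self x m
        rw [Finset.mem_Icc]; omega
      refine le_trans ?_ (Finset.sum_le_sum_of_subset_of_nonneg hsub (fun _ _ _ => by split_ifs <;> positivity))
      apply Finset.sum_le_sum
      intro n hn
      have hn' := Finset.mem_Icc.mp (hsub hn)
      rw [Finset.mem_Ico] at hn
      have hmn : m * n ≤ x := by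
        have : n ≤ x / m := by omega
        calc m * n ≤ m * (x / m) := Nat.mul_le_mul_left _ this
          _ ≤ x := Nat.mul_div_le x m
      by_cases hpp : IsPrimePow m
      · by_cases hco : m.Coprime n
        · rw [Aa_eq_Gm hco]; simp [hco]
        · rw [if_pos ⟨hmn, hpp, hco⟩, abs_mul, abs_mul]
          have b1 := hL m (by omega) hm.2
          have b2 := hc n hn'.1 hn'.2
          have b3 : |(((Aa (m * n) - Gm m n : ℤ)):ℝ)| ≤ 2 * (Dv:ℝ) ^ 2 := by
            have i1 := abs_Aa_le (m * n)
            have i2 : (m * n).divisors.card ≤ Dv := hDx _ (Nat.mul_ne_zero (by omega) (by omega)) hmn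
            have i3 := abs_Gm_le m n Dv (hDx m (by omega) hm.2) (hDx n (by omega) hn'.2)
            have i4 : (Dv:ℤ) ≤ (Dv:ℤ) ^ 2 := by nlinarith [(by exact_mod_cast hDv : (1:ℤ) ≤ Dv)]
            have i2' : (((m * n).divisors.card : ℕ):ℤ) ≤ Dv := by exact_mod_cast i2
            have i5 : |Aa (m * n) - Gm m n| ≤ 2 * (Dv:ℤ) ^ 2 := (abs_sub _ _).trans (by linarith)
            exact_mod_cast i5
          calc _ ≤ (Dv:ℝ) * Dv * (2 * (Dv:ℝ) ^ 2) := by gcongr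
            _ = _ := by ring
      · rw [vonMangoldt_eq_zero_iff.mpr hpp]; simp [hpp]
    have t2 : ∑ m ∈ Finset.Ioc (h ^ 24) x, ∑ n ∈ Finset.Icc 1 x, (if m * n ≤ x ∧ IsPrimePow m ∧ ¬ m.Coprime n then 2 * (Dv:ℝ) ^ 4 else 0)
        = P.card * (2 * (Dv:ℝ) ^ 4) := by
      rw [← Finset.sum_product' (f := fun m n => if m * n ≤ x ∧ IsPrimePow m ∧ ¬ m.Coprime n then 2 * (Dv:ℝ) ^ 4 else 0),
        ← Finset.sum_filter, Finset.sum_const, nsmul_eq_mul]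
    set Q := (Finset.Icc 1 x).filter (fun N => ∃ s, h ^ 12 < s ∧ s ^ 2 ∣ N) with hQ
    have t3 : P.card ≤ Dv * Q.card := by
      apply Finset.card_le_mul_card_image_of_maps_to (f := fun p : ℕ × ℕ => p.1 * p.2)
      · intro p hp
        simp only [hP, Finset.mem_filter, Finset.mem_product, Finset.mem_Ioc, Finset.mem_Icc] at hp
        obtain ⟨⟨p1, p2⟩, p3, p4, p5⟩ := hp
        obtain ⟨s, hs1, hs2⟩ := bad_sq p4 p5
        simp only [hQ, Finset.mem_filter, Finset.mem_Icc]
        refine ⟨⟨Nat.mul_pos (by omega) (by omega), p3⟩, s, ?_, hs1⟩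
        by_contra hcon
        push Not at hcon
        have := Nat.pow_le_pow_left hcon 2
        rw [← pow_mul] at this
        norm_num at this
        omega
      · intro N hN
        simp only [hQ, Finset.mem_filter, Finset.mem_Icc] at hN
        refine le_trans ?_ (hDx N (by omega) hN.1.2)
        apply Finset.card_le_card_of_injOn (fun p => p.1)
        · intro p hp
          simp only [Finset.coe_filter, Set.mem_ofPred_eq] at hp
          simp only [Finset.mem_coe, Nat.mem_divisors]
          exact ⟨⟨p.2, hp.2.symm⟩, by omega⟩
        · intro p hp q hq hpq
          simp only [Finset.coe_filter, Set.mem_ofPred_eq] at hp hq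
          have hpq' : p.1 = q.1 := hpq
          have h1 : 0 < q.1 := by
            rcases Nat.eq_zero_or_pos q.1 with h0 | h0
            · rw [h0, zero_mul] at hq; omega
            · exact h0
          refine Prod.ext hpq' ?_
          have : q.1 * p.2 = q.1 * q.2 := by rw [hq.2, ← hpq', hp.2]
          exact Nat.eq_of_mul_eq_mul_left h1 this
    have t4 := bad_count x (h ^ 12) (Nat.one_le_pow _ _ hh)
    rw [← hQ] at t4
    have t5 : (P.card:ℝ) ≤ Dv * (x / h) := by
      have : (P.card:ℝ) ≤ Dv * Q.card := by exact_mod_cast t3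
      refine this.trans (mul_le_mul_of_nonneg_left (t4.trans ?_) (by positivity))
      apply div_le_div_of_nonneg_left (by positivity) (by positivity)
      push_cast
      exact le_self_pow₀ hhr (by norm_num)
    refine t1.trans ?_
    rw [t2]
    calc (P.card:ℝ) * (2 * (Dv:ℝ) ^ 4) ≤ (Dv * (x / h)) * (2 * (Dv:ℝ) ^ 4) := by gcongr
      _ = 2 * (Dv:ℝ) ^ 5 * x / h := by ring
      _ ≤ 2 * (Dv:ℝ) ^ 6 * x / h := by gcongr <;> first | exact hDr | norm_num
  rw [hsplit]
  refine (abs_add_le _ _).trans ?_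
  calc _ ≤ 20000 * (Dv:ℝ) ^ 6 * x / h + 2 * (Dv:ℝ) ^ 6 * x / h := add_le_add main err
    _ = _ := by ring

end QSpin

namespace QSpin

lemma abel_id (g a : ℕ → ℝ) (n : ℕ) : ∑ i ∈ Finset.Ioc 0 n, g i * a i =
    g (n + 1) * ∑ i ∈ Finset.Ioc 0 n, a i - ∑ k ∈ Finset.Ioc 0 n, (g (k + 1) - g k) * ∑ i ∈ Finset.Ioc 0 k, a i := by
  induction n with
  | zero => simp
  | succ n ih =>
    rw [Finset.sum_Ioc_succ_top (Nat.zero_le n), Finset.sum_Ioc_succ_top (Nat.zero_le n) (fun k => (g (k + 1) - g k) * ∑ i ∈ Finset.Ioc 0 k, a i), ih,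
      Finset.sum_Ioc_succ_top (Nat.zero_le n) a]
    ring

lemma abel (g a : ℕ → ℝ) (n : ℕ) (T : ℝ) (hT : ∀ k ≤ n, |∑ i ∈ Finset.Ioc 0 k, a i| ≤ T) :
    |∑ i ∈ Finset.Ioc 0 n, g i * a i| ≤ T * (|g (n + 1)| + ∑ i ∈ Finset.Ioc 0 n, |g (i + 1) - g i|) := by
  rw [abel_id, mul_add]
  refine (abs_sub _ _).trans (add_le_add ?_ ?_)
  · rw [abs_mul, mul_comm]
    exact mul_le_mul_of_nonneg_right (hT n le_rfl) (abs_nonneg _)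
  · rw [Finset.mul_sum]
    refine (Finset.abs_sum_le_sum_abs _ _).trans (Finset.sum_le_sum fun k hk => ?_)
    rw [abs_mul, mul_comm]
    exact mul_le_mul_of_nonneg_right (hT k (Finset.mem_Ioc.mp hk).2) (abs_nonneg _)

lemma tele (g : ℕ → ℝ) (n : ℕ) : ∑ i ∈ Finset.Ioc 0 n, (g (i + 1) - g i) = g (n + 1) - g 1 := by
  induction n with
  | zero => simp
  | succ n ih => rw [Finset.sum_Ioc_succ_top (Nat.zero_le n), ih]; ring

lemma abel_mono (g a : ℕ → ℝ) (n : ℕ) (T : ℝ) (hT : ∀ k ≤ n, |∑ i ∈ Finset.Ioc 0 k, a i| ≤ T)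
    (hg : ∀ i, 1 ≤ i → 0 ≤ g i ∧ g i ≤ g (i + 1)) : |∑ i ∈ Finset.Ioc 0 n, g i * a i| ≤ T * (2 * g (n + 1)) := by
  refine (abel g a n T hT).trans ?_
  have hT0 : 0 ≤ T := (abs_nonneg _).trans (hT 0 (Nat.zero_le _))
  apply mul_le_mul_of_nonneg_left _ hT0
  have e : ∑ i ∈ Finset.Ioc 0 n, |g (i + 1) - g i| = ∑ i ∈ Finset.Ioc 0 n, (g (i + 1) - g i) := by
    apply Finset.sum_congr rfl
    intro i hi
    rw [Finset.mem_Ioc] at hi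
    rw [abs_of_nonneg]; linarith [(hg i (by omega)).2]
  rw [e, tele, abs_of_nonneg (hg (n + 1) (by omega)).1]
  linarith [(hg 1 le_rfl).1]

lemma abel_anti (g a : ℕ → ℝ) (n : ℕ) (T : ℝ) (hT : ∀ k ≤ n, |∑ i ∈ Finset.Ioc 0 k, a i| ≤ T)
    (hg : ∀ i, 1 ≤ i → 0 ≤ g i ∧ g (i + 1) ≤ g i) : |∑ i ∈ Finset.Ioc 0 n, g i * a i| ≤ T * g 1 := by
  refine (abel g a n T hT).trans ?_
  have hT0 : 0 ≤ T := (abs_nonneg _).trans (hT 0 (Nat.zero_le _))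
  apply mul_le_mul_of_nonneg_left _ hT0
  have e : ∑ i ∈ Finset.Ioc 0 n, |g (i + 1) - g i| = -∑ i ∈ Finset.Ioc 0 n, (g (i + 1) - g i) := by
    rw [← Finset.sum_neg_distrib]
    apply Finset.sum_congr rfl
    intro i hi
    rw [Finset.mem_Ioc] at hi
    rw [abs_of_nonpos]; linarith [(hg i (by omega)).2]
  rw [e, tele, abs_of_nonneg (hg (n + 1) (by omega)).1]
  linarith

open ArithmeticFunction in
lemma conv_sum (f g : ArithmeticFunction ℝ) (a : ℕ → ℝ) (N : ℕ) :
    ∑ n ∈ Finset.Ioc 0 N, (f * g) n * a n = ∑ m ∈ Finset.Ioc 0 N, f m * ∑ n ∈ Finset.Ioc 0 (N / m), g n * a (m * n) := by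
  have e1 : ∑ n ∈ Finset.Ioc 0 N, (f * g) n * a n =
      ∑ x ∈ Finset.Ioc 0 N ×ˢ Finset.Ioc 0 N with x.1 * x.2 ≤ N, f x.1 * g x.2 * a (x.1 * x.2) := by
    simp only [mul_apply]
    trans ∑ n ∈ Finset.Ioc 0 N, ∑ x ∈ Finset.Ioc 0 N ×ˢ Finset.Ioc 0 N with x.1 * x.2 = n, f x.1 * g x.2 * a (x.1 * x.2)
    · refine Finset.sum_congr rfl fun n hn ↦ ?_
      simp only [Finset.mem_Ioc] at hn
      rw [Nat.divisorsAntidiagonal_eq_prod_filter_of_le hn.1.ne' hn.2, Finset.sum_mul]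
      apply Finset.sum_congr rfl
      intro p hp
      rw [(Finset.mem_filter.mp hp).2]
    · simp_rw [Finset.sum_filter]
      rw [Finset.sum_comm]
      exact Finset.sum_congr rfl fun _ _ ↦ (by simp_all)
  rw [e1, Finset.sum_filter, Finset.sum_product]
  refine Finset.sum_congr rfl fun m hm ↦ ?_
  rw [← Finset.sum_filter, Finset.mul_sum]
  rw [Finset.mem_Ioc] at hm
  apply Finset.sum_congr
  · ext n
    simp only [Finset.mem_filter, Finset.mem_Ioc]
    rw [Nat.le_div_iff_mul_le (by omega), mul_comm n m]
    constructor
    · rintro ⟨⟨h1, -⟩, h3⟩; exact ⟨h1, h3⟩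
    · rintro ⟨h1, h3⟩; refine ⟨⟨h1, ?_⟩, h3⟩; nlinarith
  · intro n _; ring

lemma typeI' (x h Dv : ℕ) (hh : 1 ≤ h) (hx : h ^ 7000 ≤ x)
    (hD : ∀ n : ℕ, n ≠ 0 → n ≤ 1000 * x ^ 6 → n.divisors.card ≤ Dv) (d y : ℕ) (hd : 1 ≤ d) (hy : d * y ≤ x) :
    |∑ n ∈ Finset.Ioc 0 y, ((Aa (d * n) : ℤ) : ℝ)| ≤ 20000 * d * Dv * x / (h:ℝ) ^ 145 := by
  refine le_trans (le_of_eq ?_) (typeI x h Dv hh hx hD d (d * y) hd hy)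
  rw [Int.cast_sum]
  congr 1
  have : (Finset.Icc 1 (d * y)).filter (fun n => d ∣ n) = (Finset.Ioc 0 y).image (fun n => d * n) := by
    ext n
    simp only [Finset.mem_filter, Finset.mem_Icc, Finset.mem_image, Finset.mem_Ioc]
    constructor
    · rintro ⟨⟨h1, h2⟩, k, rfl⟩
      refine ⟨k, ⟨?_, Nat.le_of_mul_le_mul_left h2 (by omega)⟩, rfl⟩
      rcases Nat.eq_zero_or_pos k with rfl | h0
      · simp at h1
      · exact h0
    · rintro ⟨k, ⟨h1, h2⟩, rfl⟩
      exact ⟨⟨Nat.mul_pos (by omega) h1, Nat.mul_le_mul_left _ h2⟩, Dvd.intro _ rfl⟩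
  rw [this, Finset.sum_image]
  intro a _ b _ hab
  exact Nat.eq_of_mul_eq_mul_left (by omega) hab

open ArithmeticFunction in
noncomputable def lo (U : ℕ) (f : ArithmeticFunction ℝ) : ArithmeticFunction ℝ :=
  ⟨fun n => if n ≤ U then f n else 0, by simp⟩

open ArithmeticFunction in
noncomputable def hi (U : ℕ) (f : ArithmeticFunction ℝ) : ArithmeticFunction ℝ :=
  ⟨fun n => if U < n then f n else 0, by simp⟩

lemma lo_apply (U : ℕ) (f : ArithmeticFunction ℝ) (n : ℕ) : lo U f n = if n ≤ U then f n else 0 := rfl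
lemma hi_apply (U : ℕ) (f : ArithmeticFunction ℝ) (n : ℕ) : hi U f n = if U < n then f n else 0 := rfl

lemma lo_add_hi (U : ℕ) (f : ArithmeticFunction ℝ) : lo U f + hi U f = f := by
  ext n
  rw [ArithmeticFunction.add_apply, lo_apply, hi_apply]
  by_cases h : n ≤ U
  · rw [if_pos h, if_neg (by omega), add_zero]
  · rw [if_neg h, if_pos (by omega), zero_add]

noncomputable def Lam : ArithmeticFunction ℝ := ArithmeticFunction.vonMangoldt
noncomputable def mu : ArithmeticFunction ℝ := ((ArithmeticFunction.moebius : ArithmeticFunction ℤ) : ArithmeticFunction ℝ)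
noncomputable def ze : ArithmeticFunction ℝ := ((ArithmeticFunction.zeta : ArithmeticFunction ℕ) : ArithmeticFunction ℝ)

lemma vaughan (U : ℕ) : Lam = lo U Lam + lo U mu * ArithmeticFunction.log
    - lo U mu * lo U Lam * ze + hi U Lam * (hi U mu * ze) := by
  have h1 := lo_add_hi U Lam
  have h2 := lo_add_hi U mu
  have h3 : mu * ze = 1 := ArithmeticFunction.coe_moebius_mul_coe_zeta
  have h5 : Lam * ze = ArithmeticFunction.log := ArithmeticFunction.vonMangoldt_mul_zeta
  rw [← h5]
  generalize lo U Lam = L1 at *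
  generalize hi U Lam = L2 at *
  generalize lo U mu = m1 at *
  generalize hi U mu = m2 at *
  have h4 : L2 = L2 * ((m1 + m2) * ze) := by rw [h2, h3, mul_one]
  rw [← h1]
  conv_lhs => rw [h4]
  ring

lemma abs_mu_le (n : ℕ) : |mu n| ≤ 1 := by
  have : mu n = ((ArithmeticFunction.moebius n : ℤ) : ℝ) := rfl
  rw [this]; exact_mod_cast ArithmeticFunction.abs_moebius_le_one

lemma Lam_nonneg (n : ℕ) : 0 ≤ Lam n := ArithmeticFunction.vonMangoldt_nonneg

lemma ze_one {n : ℕ} (hn : 1 ≤ n) : ze n = 1 := by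
  have : ze n = ((ArithmeticFunction.zeta n : ℕ) : ℝ) := rfl
  rw [this, ArithmeticFunction.zeta_apply_ne (by omega)]; simp

theorem psiA (x h Dv : ℕ) (hh : 1 ≤ h) (hx : h ^ 7000 ≤ x)
    (hD : ∀ n : ℕ, n ≠ 0 → n ≤ 1000 * x ^ 6 → n.divisors.card ≤ Dv) :
    |∑ n ∈ Finset.Ioc 0 x, Lam n * ((Aa n : ℤ) : ℝ)| ≤ 200000 * (Dv:ℝ) ^ 6 * x / h := by
  set U := h ^ 24 with hU
  have hx1 : 1 ≤ x := (Nat.one_le_pow _ _ hh).trans hx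
  have hDx2 : ∀ n : ℕ, n ≠ 0 → n ≤ 2 * x → n.divisors.card ≤ Dv := by
    intro n h0 hn
    apply hD n h0
    have : x ≤ x ^ 6 := Nat.le_self_pow (by norm_num) x
    omega
  have hDx : ∀ n : ℕ, n ≠ 0 → n ≤ x → n.divisors.card ≤ Dv := fun n h0 hn => hDx2 n h0 (by omega)
  have hDv : 1 ≤ Dv := by simpa using hDx 1 (by norm_num) (by omega)
  have hDr : (1:ℝ) ≤ Dv := by exact_mod_cast hDv
  have hhr : (1:ℝ) ≤ h := by exact_mod_cast hh
  have hU1 : 1 ≤ U := Nat.one_le_pow _ _ hh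
  have hUx : U * h ≤ x := by
    refine le_trans ?_ hx
    rw [hU, ← pow_succ]; exact Nat.pow_le_pow_right hh (by norm_num)
  have hUr : (U:ℝ) = (h:ℝ) ^ 24 := by rw [hU]; push_cast; rfl
  have hAa : ∀ n, 1 ≤ n → n ≤ x → |((Aa n : ℤ):ℝ)| ≤ Dv := by
    intro n h1 h2
    have := (abs_Aa_le n).trans (by exact_mod_cast hDx n (by omega) h2 : ((n.divisors.card : ℕ):ℤ) ≤ Dv)
    exact_mod_cast this
  have hL : ∀ m, 1 ≤ m → m ≤ x → |Lam m| ≤ Dv := by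
    intro m h1 h2
    rw [abs_of_nonneg (Lam_nonneg m)]
    exact ArithmeticFunction.vonMangoldt_le_log.trans (log_le_Dv hDx h1 h2).2
  set E := (Dv:ℝ) ^ 6 * x / h with hE
  have hE0 : 0 ≤ E := by positivity
  -- term 1
  have T1 : |∑ n ∈ Finset.Ioc 0 x, lo U Lam n * ((Aa n : ℤ) : ℝ)| ≤ E := by
    calc _ ≤ ∑ n ∈ Finset.Ioc 0 x, if n ≤ U then (Dv:ℝ) ^ 2 else 0 := by
          refine (Finset.abs_sum_le_sum_abs _ _).trans (Finset.sum_le_sum fun n hn => ?_)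
          rw [Finset.mem_Ioc] at hn
          rw [lo_apply]
          split_ifs
          · rw [abs_mul, sq]
            exact mul_le_mul (hL n hn.1 hn.2) (hAa n hn.1 hn.2) (abs_nonneg _) (by positivity)
          · simp
      _ = (((Finset.Ioc 0 x).filter (fun n => n ≤ U)).card : ℝ) * (Dv:ℝ) ^ 2 := by
          rw [← Finset.sum_filter, Finset.sum_const, nsmul_eq_mul]
      _ ≤ U * (Dv:ℝ) ^ 2 := by
          gcongr
          have : ((Finset.Ioc 0 x).filter (fun n => n ≤ U)).card ≤ (Finset.Ioc 0 U).card := by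
            apply Finset.card_le_card
            intro n hn
            simp only [Finset.mem_filter, Finset.mem_Ioc] at hn ⊢
            omega
          simpa using this
      _ ≤ (x / h) * (Dv:ℝ) ^ 6 := by
          have : (U:ℝ) ≤ x / h := by
            rw [le_div_iff₀ (by positivity)]; exact_mod_cast hUx
          gcongr
          norm_num
      _ = E := by rw [hE]; ring
  -- term 2
  have hpow : ∀ k ≤ 144, (h:ℝ) ^ k / (h:ℝ) ^ 145 ≤ 1 / h := by
    intro k hk
    rw [div_le_div_iff₀ (by positivity) (by positivity), one_mul, ← pow_succ]
    exact pow_le_pow_right₀ hhr (by omega)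
  have T2 : |∑ n ∈ Finset.Ioc 0 x, (lo U mu * ArithmeticFunction.log) n * ((Aa n : ℤ) : ℝ)| ≤ 40000 * E := by
    rw [conv_sum]
    calc _ ≤ ∑ m ∈ Finset.Ioc 0 x, if m ≤ U then 20000 * (U:ℝ) * Dv * x / (h:ℝ) ^ 145 * (2 * Dv) else 0 := by
          refine (Finset.abs_sum_le_sum_abs _ _).trans (Finset.sum_le_sum fun m hm => ?_)
          rw [Finset.mem_Ioc] at hm
          rw [lo_apply]
          split_ifs with hmU
          · rw [abs_mul]
            refine (mul_le_of_le_one_left (abs_nonneg _) (abs_mu_le m)).trans ?_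
            have hmr : (m:ℝ) ≤ U := by exact_mod_cast hmU
            refine (abel_mono (fun n => Real.log n) (fun n => ((Aa (m * n) : ℤ) : ℝ)) (x / m)
              (20000 * m * Dv * x / (h:ℝ) ^ 145) ?_ ?_).trans ?_
            · intro k hk
              apply typeI' x h Dv hh hx hD m k hm.1
              calc m * k ≤ m * (x / m) := Nat.mul_le_mul_left _ hk
                _ ≤ x := Nat.mul_div_le x m
            · intro i hi
              have : (1:ℝ) ≤ i := by exact_mod_cast hi
              refine ⟨Real.log_nonneg this, Real.log_le_log (by linarith) ?_⟩
              push_cast; linarith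
            · have : Real.log ((x / m + 1 : ℕ)) ≤ Dv := (log_le_Dv hDx2 (Nat.le_add_left 1 (x / m)) (by have := Nat.div_le_self x m; omega)).2
              gcongr
          · simp
      _ = (((Finset.Ioc 0 x).filter (fun n => n ≤ U)).card : ℝ) * (20000 * (U:ℝ) * Dv * x / (h:ℝ) ^ 145 * (2 * Dv)) := by
          rw [← Finset.sum_filter, Finset.sum_const, nsmul_eq_mul]
      _ ≤ U * (20000 * (U:ℝ) * Dv * x / (h:ℝ) ^ 145 * (2 * Dv)) := by
          gcongr
          have : ((Finset.Ioc 0 x).filter (fun n => n ≤ U)).card ≤ (Finset.Ioc 0 U).card := by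
            apply Finset.card_le_card
            intro n hn
            simp only [Finset.mem_filter, Finset.mem_Ioc] at hn ⊢
            omega
          simpa using this
      _ = 40000 * (Dv:ℝ) ^ 2 * x * ((h:ℝ) ^ 48 / (h:ℝ) ^ 145) := by rw [hUr]; ring
      _ ≤ 40000 * (Dv:ℝ) ^ 6 * x * (1 / h) := by
          gcongr 40000 * ?_ * x * ?_
          · exact pow_le_pow_right₀ hDr (by norm_num)
          · exact hpow 48 (by norm_num)
      _ = 40000 * E := by rw [hE]; ring
  -- term 3
  have hcoef : ∀ m, 1 ≤ m → m ≤ x → |(lo U mu * lo U Lam) m| ≤ Dv := by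
    intro m h1 h2
    rw [ArithmeticFunction.mul_apply]
    calc _ ≤ ∑ p ∈ m.divisorsAntidiagonal, Lam p.2 := by
          refine (Finset.abs_sum_le_sum_abs _ _).trans (Finset.sum_le_sum fun p _ => ?_)
          rw [abs_mul, lo_apply, lo_apply]
          have a1 : |if p.1 ≤ U then mu p.1 else 0| ≤ 1 := by split_ifs; exacts [abs_mu_le _, by simp]
          have a2 : |if p.2 ≤ U then Lam p.2 else 0| ≤ Lam p.2 := by
            split_ifs
            · rw [abs_of_nonneg (Lam_nonneg _)]
            · simpa using Lam_nonneg _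
          exact (mul_le_of_le_one_left (abs_nonneg _) a1).trans a2
      _ = ∑ i ∈ m.divisors, Lam i := by rw [Nat.sum_divisorsAntidiagonal' (f := fun _ b => Lam b)]
      _ = Real.log m := ArithmeticFunction.vonMangoldt_sum
      _ ≤ Dv := (log_le_Dv hDx h1 h2).2
  have hsupp : ∀ m, U ^ 2 < m → (lo U mu * lo U Lam) m = 0 := by
    intro m hm
    rw [ArithmeticFunction.mul_apply]
    apply Finset.sum_eq_zero
    intro p hp
    rw [Nat.mem_divisorsAntidiagonal] at hp
    rw [lo_apply, lo_apply]
    by_cases h1 : p.1 ≤ U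
    · have h2 : ¬ p.2 ≤ U := by
        intro h2
        have := Nat.mul_le_mul h1 h2
        rw [hp.1] at this
        nlinarith
      rw [if_neg h2, mul_zero]
    · rw [if_neg h1, zero_mul]
  have T3 : |∑ n ∈ Finset.Ioc 0 x, (lo U mu * lo U Lam * ze) n * ((Aa n : ℤ) : ℝ)| ≤ 20000 * E := by
    rw [conv_sum]
    calc _ ≤ ∑ m ∈ Finset.Ioc 0 x, if m ≤ U ^ 2 then Dv * (20000 * (U:ℝ) ^ 2 * Dv * x / (h:ℝ) ^ 145) else 0 := by
          refine (Finset.abs_sum_le_sum_abs _ _).trans (Finset.sum_le_sum fun m hm => ?_)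
          rw [Finset.mem_Ioc] at hm
          split_ifs with hmU
          · rw [abs_mul]
            have hmr : (m:ℝ) ≤ (U:ℝ) ^ 2 := by exact_mod_cast hmU
            refine mul_le_mul (hcoef m hm.1 hm.2) ?_ (abs_nonneg _) (by positivity)
            have e : ∑ n ∈ Finset.Ioc 0 (x / m), ze n * ((Aa (m * n) : ℤ):ℝ) = ∑ n ∈ Finset.Ioc 0 (x / m), ((Aa (m * n) : ℤ):ℝ) := by
              apply Finset.sum_congr rfl
              intro n hn
              rw [ze_one (Finset.mem_Ioc.mp hn).1, one_mul]
            rw [e]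
            refine (typeI' x h Dv hh hx hD m (x / m) hm.1 (Nat.mul_div_le x m)).trans ?_
            gcongr
          · rw [hsupp m (by omega)]; simp
      _ = (((Finset.Ioc 0 x).filter (fun n => n ≤ U ^ 2)).card : ℝ) * (Dv * (20000 * (U:ℝ) ^ 2 * Dv * x / (h:ℝ) ^ 145)) := by
          rw [← Finset.sum_filter, Finset.sum_const, nsmul_eq_mul]
      _ ≤ (U:ℝ) ^ 2 * (Dv * (20000 * (U:ℝ) ^ 2 * Dv * x / (h:ℝ) ^ 145)) := by
          gcongr
          have : ((Finset.Ioc 0 x).filter (fun n => n ≤ U ^ 2)).card ≤ (Finset.Ioc 0 (U ^ 2)).card := by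
            apply Finset.card_le_card
            intro n hn
            simp only [Finset.mem_filter, Finset.mem_Ioc] at hn ⊢
            omega
          rw [Nat.card_Ioc, Nat.sub_zero] at this
          exact_mod_cast this
      _ = 20000 * (Dv:ℝ) ^ 2 * x * ((h:ℝ) ^ 96 / (h:ℝ) ^ 145) := by rw [hUr]; ring
      _ ≤ 20000 * (Dv:ℝ) ^ 6 * x * (1 / h) := by
          gcongr 20000 * ?_ * x * ?_
          · exact pow_le_pow_right₀ hDr (by norm_num)
          · exact hpow 96 (by norm_num)
      _ = 20000 * E := by rw [hE]; ring
  -- term 4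
  have hc : ∀ n, 1 ≤ n → n ≤ x → |(hi U mu * ze) n| ≤ Dv := by
    intro n h1 h2
    have : (hi U mu * ze) n = ∑ i ∈ n.divisors, hi U mu i := ArithmeticFunction.coe_mul_zeta_apply
    rw [this]
    calc _ ≤ ∑ i ∈ n.divisors, (1:ℝ) := by
          refine (Finset.abs_sum_le_sum_abs _ _).trans (Finset.sum_le_sum fun i _ => ?_)
          rw [hi_apply]; split_ifs; exacts [abs_mu_le _, by simp]
      _ = n.divisors.card := by simp
      _ ≤ Dv := by exact_mod_cast hDx n (by omega) h2
  have hc0 : ∀ n, 1 ≤ n → n ≤ U → (hi U mu * ze) n = 0 := by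
    intro n h1 h2
    have : (hi U mu * ze) n = ∑ i ∈ n.divisors, hi U mu i := ArithmeticFunction.coe_mul_zeta_apply
    rw [this]
    apply Finset.sum_eq_zero
    intro i hi'
    have := Nat.divisor_le hi'
    rw [hi_apply, if_neg (by omega)]
  have T4 : |∑ n ∈ Finset.Ioc 0 x, (hi U Lam * (hi U mu * ze)) n * ((Aa n : ℤ) : ℝ)| ≤ 20002 * E := by
    rw [conv_sum]
    have := typeII x h Dv hh hD (fun n => (hi U mu * ze) n) hc
    rw [← hU] at this
    refine le_trans (le_of_eq ?_) (this.trans (le_of_eq (by rw [hE]; ring)))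
    congr 1
    have hUx' : U ≤ x := by nlinarith
    rw [← Finset.sum_subset (s₁ := Finset.Ioc U x) (s₂ := Finset.Ioc 0 x)
      (f := fun m => hi U Lam m * ∑ n ∈ Finset.Ioc 0 (x / m), (hi U mu * ze) n * ((Aa (m * n) : ℤ):ℝ))]
    · apply Finset.sum_congr rfl
      intro m hm
      rw [Finset.mem_Ioc] at hm
      rw [hi_apply, if_pos hm.1]
      congr 1
      symm
      apply Finset.sum_subset
      · intro n hn
        rw [Finset.mem_Ico] at hn; rw [Finset.mem_Ioc]; omega
      · intro n hn hnot
        rw [Finset.mem_Ioc] at hn; rw [Finset.mem_Ico] at hnot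
        rw [hc0 n (by omega) (by omega), zero_mul]
    · intro m hm
      rw [Finset.mem_Ioc] at hm ⊢; omega
    · intro m hm hnot
      rw [Finset.mem_Ioc] at hm hnot
      rw [hi_apply, if_neg (by omega), zero_mul]
  have hsum : ∑ n ∈ Finset.Ioc 0 x, Lam n * ((Aa n : ℤ) : ℝ) =
      ∑ n ∈ Finset.Ioc 0 x, lo U Lam n * ((Aa n : ℤ) : ℝ)
      + ∑ n ∈ Finset.Ioc 0 x, (lo U mu * ArithmeticFunction.log) n * ((Aa n : ℤ) : ℝ)
      - ∑ n ∈ Finset.Ioc 0 x, (lo U mu * lo U Lam * ze) n * ((Aa n : ℤ) : ℝ)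
      + ∑ n ∈ Finset.Ioc 0 x, (hi U Lam * (hi U mu * ze)) n * ((Aa n : ℤ) : ℝ) := by
    rw [← Finset.sum_add_distrib, ← Finset.sum_sub_distrib, ← Finset.sum_add_distrib]
    apply Finset.sum_congr rfl
    intro n _
    have hv := congrArg (fun f : ArithmeticFunction ℝ => f n) (vaughan U)
    have hv' : Lam n = lo U Lam n + (lo U mu * ArithmeticFunction.log) n - (lo U mu * lo U Lam * ze) n + (hi U Lam * (hi U mu * ze)) n := hv
    rw [hv']; ring
  rw [hsum]
  rw [abs_le] at T1 T2 T3 T4 ⊢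
  have eE : 200000 * (Dv:ℝ) ^ 6 * x / h = 200000 * E := by rw [hE]; ring
  rw [eE]
  constructor <;> linarith [T1.1, T1.2, T2.1, T2.2, T3.1, T3.2, T4.1, T4.2]

end QSpin

namespace QSpin

theorem root_floor (k : ℕ) (hk : 1 ≤ k) (x : ℕ) (hx : 1 ≤ x) :
    ∃ h : ℕ, 1 ≤ h ∧ h ^ k ≤ x ∧ (x:ℝ) ^ ((1:ℝ) / k) ≤ 2 * h := by
  have hxr : (1:ℝ) ≤ x := by exact_mod_cast hx
  have hkr : (0:ℝ) < k := by exact_mod_cast hk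
  set y := (x:ℝ) ^ ((1:ℝ) / k) with hy
  have hy1 : 1 ≤ y := Real.one_le_rpow hxr (by positivity)
  have h1 : 1 ≤ ⌊y⌋₊ := Nat.le_floor (by simpa using hy1)
  refine ⟨⌊y⌋₊, h1, ?_, ?_⟩
  · have : ((⌊y⌋₊ : ℕ):ℝ) ^ k ≤ x := by
      calc ((⌊y⌋₊ : ℕ):ℝ) ^ k ≤ y ^ k := by
            gcongr; exact Nat.floor_le (by linarith)
        _ = x := by
            rw [hy, ← Real.rpow_natCast, ← Real.rpow_mul (by positivity), one_div_mul_cancel hkr.ne', Real.rpow_one]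
    exact_mod_cast this
  · have := Nat.lt_floor_add_one y
    have h2 : (1:ℝ) ≤ (⌊y⌋₊ : ℕ) := by exact_mod_cast h1
    linarith

theorem psiA_pow : ∃ C : ℝ, 0 ≤ C ∧ ∀ x : ℕ, 1 ≤ x →
    |∑ n ∈ Finset.Ioc 0 x, Lam n * ((Aa n : ℤ):ℝ)| ≤ C * (x:ℝ) ^ (1 - 1/8000 : ℝ) := by
  obtain ⟨ε, hε⟩ : ∃ ε : ℝ, ε = 1/2016000 := ⟨_, rfl⟩
  obtain ⟨C, hC, ht⟩ := tau_bound ε (by rw [hε]; norm_num)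
  set B := C * (1000:ℝ) ^ ε with hB
  have hB0 : 0 ≤ B := by positivity
  refine ⟨400000 * B ^ 6, by positivity, fun x hx => ?_⟩
  have hxr : (1:ℝ) ≤ x := by exact_mod_cast hx
  have hx0 : (0:ℝ) < x := by linarith
  obtain ⟨h, h1, h2, h3⟩ := root_floor 7000 (by norm_num) x hx
  have hhr : (1:ℝ) ≤ h := by exact_mod_cast h1
  set Y := C * ((1000 * x ^ 6 : ℕ) : ℝ) ^ ε with hY
  have hY0 : 0 ≤ Y := by positivity
  have hYB : Y = B * (x:ℝ) ^ (6 * ε) := by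
    rw [hY, hB]
    push_cast
    rw [Real.mul_rpow (by norm_num) (by positivity), ← Real.rpow_natCast (x:ℝ) 6, ← Real.rpow_mul (by positivity)]
    rw [mul_assoc]; congr 3
  have hD : ∀ n : ℕ, n ≠ 0 → n ≤ 1000 * x ^ 6 → n.divisors.card ≤ ⌊Y⌋₊ := by
    intro n h0 hn
    apply Nat.le_floor
    refine (ht n h0).trans ?_
    rw [hY]
    gcongr
  refine (psiA x h ⌊Y⌋₊ h1 h2 hD).trans ?_
  have hfl : ((⌊Y⌋₊ : ℕ):ℝ) ≤ Y := Nat.floor_le hY0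
  have hxh : (x:ℝ) / h ≤ 2 * (x:ℝ) ^ (1 - 1/7000 : ℝ) := by
    rw [div_le_iff₀ (by linarith)]
    have e : (x:ℝ) = (x:ℝ) ^ (1 - 1/7000 : ℝ) * (x:ℝ) ^ ((1:ℝ)/(7000:ℕ)) := by
      rw [← Real.rpow_add hx0]
      have : (1 - 1/7000 : ℝ) + (1:ℝ)/(7000:ℕ) = 1 := by push_cast; ring
      rw [this, Real.rpow_one]
    calc (x:ℝ) = (x:ℝ) ^ (1 - 1/7000 : ℝ) * (x:ℝ) ^ ((1:ℝ)/(7000:ℕ)) := e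
      _ ≤ (x:ℝ) ^ (1 - 1/7000 : ℝ) * (2 * h) := by gcongr
      _ = _ := by ring
  calc 200000 * ((⌊Y⌋₊ : ℕ):ℝ) ^ 6 * x / h = 200000 * ((⌊Y⌋₊ : ℕ):ℝ) ^ 6 * (x / h) := by ring
    _ ≤ 200000 * Y ^ 6 * (2 * (x:ℝ) ^ (1 - 1/7000 : ℝ)) := by gcongr
    _ = 400000 * B ^ 6 * (((x:ℝ) ^ (6 * ε)) ^ 6 * (x:ℝ) ^ (1 - 1/7000 : ℝ)) := by rw [hYB]; ring
    _ = _ := by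
        congr 1
        rw [← Real.rpow_natCast, ← Real.rpow_mul (by positivity), ← Real.rpow_add hx0]
        congr 1
        rw [hε]; norm_num

open Chebyshev in
theorem nonprime_sum (x : ℕ) (hx : 1 ≤ x) :
    ∑ n ∈ Finset.Ioc 0 x, (if n.Prime then 0 else Lam n) ≤ 2 * √(x:ℝ) * Real.log x := by
  have h := psi_sub_theta_le (x := (x:ℝ)) (by exact_mod_cast hx)
  refine le_trans (le_of_eq ?_) h
  rw [psi_sub_theta_eq_sum_not_prime, Nat.floor_natCast, Finset.sum_filter]
  apply Finset.sum_congr rfl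
  intro n _
  by_cases hn : n.Prime <;> simp [hn, Lam]

theorem thetaA_pow : ∃ C : ℝ, 0 ≤ C ∧ ∀ x : ℕ,
    |∑ n ∈ Finset.Ioc 0 x, if n.Prime then Real.log n * ((Aa n : ℤ):ℝ) else 0| ≤ C * (x:ℝ) ^ (1 - 1/8000 : ℝ) := by
  obtain ⟨C, hC, hψ⟩ := psiA_pow
  obtain ⟨D, hD, ht⟩ := tau_bound (1/10) (by norm_num)
  refine ⟨C + D * 20, by positivity, fun x => ?_⟩
  rcases Nat.eq_zero_or_pos x with rfl | hx
  · simp; positivity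
  have hxr : (1:ℝ) ≤ x := by exact_mod_cast hx
  have hx0 : (0:ℝ) < x := by linarith
  have e : ∑ n ∈ Finset.Ioc 0 x, (if n.Prime then Real.log n * ((Aa n : ℤ):ℝ) else 0) =
      ∑ n ∈ Finset.Ioc 0 x, Lam n * ((Aa n : ℤ):ℝ) - ∑ n ∈ Finset.Ioc 0 x, (if n.Prime then 0 else Lam n) * ((Aa n : ℤ):ℝ) := by
    rw [← Finset.sum_sub_distrib]
    apply Finset.sum_congr rfl
    intro n _
    by_cases hn : n.Prime
    · have : Lam n = Real.log n := ArithmeticFunction.vonMangoldt_apply_prime hn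
      simp [hn, this]
    · simp [hn]
  have e2 : |∑ n ∈ Finset.Ioc 0 x, (if n.Prime then 0 else Lam n) * ((Aa n : ℤ):ℝ)| ≤ D * 20 * (x:ℝ) ^ (1 - 1/8000 : ℝ) := by
    calc _ ≤ ∑ n ∈ Finset.Ioc 0 x, (if n.Prime then 0 else Lam n) * (D * (x:ℝ) ^ (1/10:ℝ)) := by
          refine (Finset.abs_sum_le_sum_abs _ _).trans (Finset.sum_le_sum fun n hn => ?_)
          rw [Finset.mem_Ioc] at hn
          have h0 : 0 ≤ (if n.Prime then 0 else Lam n) := by split_ifs; exacts [le_rfl, Lam_nonneg n]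
          rw [abs_mul, abs_of_nonneg h0]
          refine mul_le_mul_of_nonneg_left ?_ h0
          have a1 : |((Aa n : ℤ):ℝ)| ≤ (n.divisors.card : ℝ) := by exact_mod_cast abs_Aa_le n
          refine a1.trans ((ht n (by omega)).trans ?_)
          have : (n:ℝ) ≤ x := by exact_mod_cast hn.2
          gcongr
      _ = (∑ n ∈ Finset.Ioc 0 x, (if n.Prime then 0 else Lam n)) * (D * (x:ℝ) ^ (1/10:ℝ)) := by rw [Finset.sum_mul]
      _ ≤ (2 * √(x:ℝ) * Real.log x) * (D * (x:ℝ) ^ (1/10:ℝ)) := by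
          gcongr; exact nonprime_sum x hx
      _ ≤ (2 * (x:ℝ) ^ (1/2:ℝ) * ((x:ℝ) ^ (1/10:ℝ) / (1/10))) * (D * (x:ℝ) ^ (1/10:ℝ)) := by
          rw [Real.sqrt_eq_rpow]
          gcongr
          exact Real.log_le_rpow_div hx0.le (by norm_num)
      _ = D * 20 * ((x:ℝ) ^ (1/2:ℝ) * (x:ℝ) ^ (1/10:ℝ) * (x:ℝ) ^ (1/10:ℝ)) := by ring
      _ = D * 20 * (x:ℝ) ^ (7/10:ℝ) := by
          rw [← Real.rpow_add hx0, ← Real.rpow_add hx0]; norm_num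
      _ ≤ _ := by
          gcongr
          norm_num
  rw [e]
  refine (abs_sub _ _).trans ?_
  have := hψ x hx
  linarith

theorem primeA_pow : ∃ C : ℝ, 0 ≤ C ∧ ∀ x : ℕ,
    |∑ n ∈ Finset.Ioc 0 x, if n.Prime then ((Aa n : ℤ):ℝ) else 0| ≤ C * (x:ℝ) ^ (1 - 1/8000 : ℝ) := by
  obtain ⟨C, hC, hψ⟩ := thetaA_pow
  refine ⟨C * (Real.log 2)⁻¹, by positivity, fun x => ?_⟩
  have key := abel_anti (fun n => (Real.log (max n 2 : ℕ))⁻¹)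
    (fun n => if n.Prime then Real.log n * ((Aa n : ℤ):ℝ) else 0) x (C * (x:ℝ) ^ (1 - 1/8000 : ℝ)) ?_ ?_
  · refine le_trans (le_of_eq ?_) (key.trans (le_of_eq ?_))
    · congr 1
      apply Finset.sum_congr rfl
      intro n _
      by_cases hn : n.Prime
      · have h2 := hn.two_le
        have : Real.log n ≠ 0 := (Real.log_pos (by exact_mod_cast hn.one_lt)).ne'
        rw [if_pos hn, if_pos hn, max_eq_left h2]
        field_simp
      · simp [hn]
    · norm_num; ring
  · intro k hk
    refine (hψ k).trans ?_
    have : (k:ℝ) ≤ x := by exact_mod_cast hk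
    gcongr
  · intro i _
    have : (2:ℝ) ≤ (max i 2 : ℕ) := by exact_mod_cast le_max_right i 2
    have hp : 0 < Real.log (max i 2 : ℕ) := Real.log_pos (by linarith)
    refine ⟨by positivity, ?_⟩
    apply inv_anti₀ hp
    apply Real.log_le_log (by linarith)
    exact_mod_cast max_le_max_right 2 (Nat.le_succ i)

end QSpin

namespace QSpin
open ArithmeticFunction.vonMangoldt Filter Topology Polynomial

noncomputable def rr (n : ℕ) : ℝ := residueClass (15 : ZMod 16) n

lemma rr_nonneg (n : ℕ) : 0 ≤ rr n := residueClass_nonneg _ n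
lemma rr_zero : rr 0 = 0 := residueClass_apply_zero (15 : ZMod 16)

lemma rr_eq (n : ℕ) : rr n = if n % 16 = 15 then ArithmeticFunction.vonMangoldt n else 0 := by
  have : ((n : ZMod 16) = 15) ↔ n % 16 = 15 := by
    have := ZMod.natCast_eq_natCast_iff' n 15 16
    simpa using this
  unfold rr residueClass
  simp only [Set.indicator_apply]
  by_cases h : n % 16 = 15
  · simp [h, this]
  · simp [h, this]

lemma unit15 : IsUnit (15 : ZMod 16) := by decide +revert

lemma rr_summable (x : ℝ) (hx : 1 < x) : Summable fun n : ℕ => rr n / (n:ℝ) ^ x := by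
  have h := LSeriesSummable_of_abscissaOfAbsConv_lt_re (f := fun n => ((residueClass (15 : ZMod 16) n : ℝ) : ℂ)) (s := (x:ℂ))
    ((abscissaOfAbsConv_residueClass_le_one (15 : ZMod 16)).trans_lt (by norm_cast))
  have h2 := Complex.hasSum_re h.hasSum |>.summable
  refine h2.congr fun n => ?_
  rcases Nat.eq_zero_or_pos n with rfl | hn
  · simp [rr_zero]
  · rw [LSeries.term_of_ne_zero (by omega)]
    rw [← Complex.ofReal_natCast, ← Complex.ofReal_cpow (by positivity), ← Complex.ofReal_div, Complex.ofReal_re]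
    rfl

lemma rr_tsum {x : ℝ} (hx : 1 < x) : ∑' n, rr n / (n : ℝ) ^ x =
        (LFunctionResidueClassAux (15 : ZMod 16) x).re + (1/8) / (x - 1) := by
  refine Complex.ofReal_injective ?_
  have ht : ((1/8 : ℝ) : ℂ) = (((16 : ℕ).totient : ℂ))⁻¹ := by
    rw [show (16:ℕ).totient = 8 by decide]; norm_num
  rw [Complex.ofReal_add, Complex.ofReal_div, ht]
  simp only [Complex.ofReal_tsum, Complex.ofReal_div, Complex.ofReal_cpow (Nat.cast_nonneg _), Complex.ofReal_natCast,
      Complex.ofReal_sub, Complex.ofReal_one]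
  rw [← LFunctionResidueClassAux_real unit15 hx,
      eqOn_LFunctionResidueClassAux unit15 (show (x:ℂ) ∈ {s : ℂ | 1 < s.re} from hx)]
  rw [sub_add_cancel, LSeries]
  refine tsum_congr fun n ↦ ?_
  unfold LSeries.term
  split_ifs with hn
  · simp [hn, rr_zero]
  · rfl

lemma rr_tendsto : Tendsto (fun σ : ℝ => σ * ∑' n, rr n / (n : ℝ) ^ (1 + σ)) (𝓝[>] 0) (𝓝 (1/8)) := by
  have hc : ContinuousOn (fun x : ℝ ↦ (LFunctionResidueClassAux (15 : ZMod 16) x).re) (Set.Ici 1) :=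
    Complex.continuous_re.continuousOn.comp (t := Set.univ) (continuousOn_LFunctionResidueClassAux _)
      (fun ⦃x⦄ a ↦ trivial) |>.comp Complex.continuous_ofReal.continuousOn fun x hx ↦ by
        simpa using hx
  have h1 : Tendsto (fun σ : ℝ => (1 + σ)) (𝓝[>] 0) (𝓝[≥] 1) := by
    apply tendsto_nhdsWithin_of_tendsto_nhds_of_eventually_within
    · have : Tendsto (fun σ : ℝ => (1 + σ)) (𝓝 0) (𝓝 (1 + 0)) := tendsto_const_nhds.add tendsto_id
      rw [add_zero] at this
      exact this.mono_left nhdsWithin_le_nhds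
    · filter_upwards [self_mem_nhdsWithin] with σ hσ
      have : (0:ℝ) < σ := hσ
      simp; linarith
  have h2 := (hc 1 (by simp)).tendsto.comp h1
  have h3 : Tendsto (fun σ : ℝ => σ) (𝓝[>] (0:ℝ)) (𝓝 0) := nhdsWithin_le_nhds
  have h4 := (h3.mul h2).add_const (1/8)
  rw [zero_mul, zero_add] at h4
  refine h4.congr' ?_
  filter_upwards [self_mem_nhdsWithin] with σ hσ
  have hσ' : (0:ℝ) < σ := hσ
  rw [rr_tsum (by linarith)]
  simp only [Function.comp]
  rw [add_sub_cancel_left]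
  field_simp

/-- Karamata step: polynomial moments. -/
lemma karamata (P : ℝ[X]) :
    (∀ σ : ℝ, 0 < σ → Summable fun n : ℕ => rr n / n * ((n:ℝ) ^ (-σ) * P.eval ((n:ℝ) ^ (-σ)))) ∧
    Tendsto (fun σ : ℝ => σ * ∑' n : ℕ, rr n / n * ((n:ℝ) ^ (-σ) * P.eval ((n:ℝ) ^ (-σ)))) (𝓝[>] 0)
      (𝓝 (1 / 8 * ∫ z in (0:ℝ)..1, P.eval z)) := by
  induction P using Polynomial.induction_on' with
  | add p q hp hq =>
    have e : ∀ σ : ℝ, ∀ n : ℕ, rr n / n * ((n:ℝ) ^ (-σ) * (p + q).eval ((n:ℝ) ^ (-σ))) =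
        rr n / n * ((n:ℝ) ^ (-σ) * p.eval ((n:ℝ) ^ (-σ))) + rr n / n * ((n:ℝ) ^ (-σ) * q.eval ((n:ℝ) ^ (-σ))) := by
      intro σ n; rw [eval_add]; ring
    constructor
    · intro σ hσ
      simp_rw [e]
      exact (hp.1 σ hσ).add (hq.1 σ hσ)
    · have := hp.2.add hq.2
      have ei : ∫ z in (0:ℝ)..1, (p + q).eval z = (∫ z in (0:ℝ)..1, p.eval z) + ∫ z in (0:ℝ)..1, q.eval z := by
        simp_rw [eval_add]
        exact intervalIntegral.integral_add (p.continuous.intervalIntegrable _ _) (q.continuous.intervalIntegrable _ _)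
      rw [ei, mul_add]
      refine this.congr' ?_
      filter_upwards [self_mem_nhdsWithin] with σ hσ
      simp_rw [e]
      rw [(hp.1 σ hσ).tsum_add (hq.1 σ hσ)]
      ring
  | monomial k a =>
    have e : ∀ σ : ℝ, ∀ n : ℕ, rr n / n * ((n:ℝ) ^ (-σ) * (monomial k a).eval ((n:ℝ) ^ (-σ))) =
        a * (rr n / (n:ℝ) ^ (1 + (k + 1) * σ)) := by
      intro σ n
      rcases Nat.eq_zero_or_pos n with rfl | hn
      · simp [rr_zero]
      have hn' : (0:ℝ) < n := by exact_mod_cast hn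
      rw [eval_monomial, Real.rpow_add hn', Real.rpow_one, Real.rpow_neg hn'.le]
      have : (n:ℝ) ^ (((k:ℝ) + 1) * σ) = ((n:ℝ) ^ σ) ^ (k + 1) := by
        rw [← Real.rpow_natCast, ← Real.rpow_mul hn'.le]; congr 1; push_cast; ring
      rw [this, inv_pow]
      field_simp
      ring
    have hk : (0:ℝ) < k + 1 := by positivity
    constructor
    · intro σ hσ
      simp_rw [e]
      exact (rr_summable _ (by nlinarith [mul_pos hk hσ])).mul_left a
    · have h1 : Tendsto (fun σ : ℝ => (k + 1) * σ) (𝓝[>] 0) (𝓝[>] 0) := by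
        apply tendsto_nhdsWithin_of_tendsto_nhds_of_eventually_within
        · have : Tendsto (fun σ : ℝ => ((k:ℝ) + 1) * σ) (𝓝 0) (𝓝 (((k:ℝ) + 1) * 0)) := tendsto_const_nhds.mul tendsto_id
          rw [mul_zero] at this
          exact this.mono_left nhdsWithin_le_nhds
        · filter_upwards [self_mem_nhdsWithin] with σ hσ
          exact mul_pos hk hσ
      have h2 := (rr_tendsto.comp h1).const_mul (a / (k + 1))
      have ei : ∫ z in (0:ℝ)..1, (monomial k a).eval z = a / (k + 1) := by
        simp_rw [eval_monomial]
        rw [intervalIntegral.integral_const_mul, integral_pow]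
        simp; ring
      rw [ei, mul_comm (1/8 : ℝ)]
      refine h2.congr fun σ => ?_
      simp_rw [e]
      rw [tsum_mul_left]
      simp only [Function.comp]
      field_simp

lemma bump (a b : ℝ) (ha : 0 < a) (hab : a < b) (hb : b < 1) : ∃ P : ℝ[X],
    (∀ z : ℝ, 0 ≤ z → z ≤ 1 → (z ≤ a ∨ b ≤ z) → P.eval z ≤ 0) ∧ 0 < ∫ z in (0:ℝ)..1, P.eval z := by
  set z0 := (a + b) / 2 with hz0
  set ρ := (b - a) / 2 with hρ
  have hρ0 : 0 < ρ := by rw [hρ]; linarith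
  have hρ1 : ρ < 1/2 := by rw [hρ]; linarith
  have hκ : 0 < 1 - ρ ^ 2 := by nlinarith
  have hκ' : 0 < 1 - (ρ / 2) ^ 2 := by nlinarith
  obtain ⟨N, hN⟩ := exists_pow_lt_of_lt_one hρ0 (y := (1 - ρ ^ 2) / (1 - (ρ / 2) ^ 2))
    ((div_lt_one hκ').mpr (by nlinarith))
  rw [div_pow, div_lt_iff₀ (by positivity)] at hN
  refine ⟨(1 - (X - C z0) ^ 2) ^ N - C ((1 - ρ ^ 2) ^ N), ?_, ?_⟩
  · intro z h0 h1 hz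
    simp only [eval_sub, eval_pow, eval_one, eval_X, eval_C]
    rw [sub_nonpos]
    have hlow : 0 ≤ 1 - (z - z0) ^ 2 := by
      have : |z - z0| ≤ 1 := by rw [abs_le]; constructor <;> rw [hz0] <;> linarith
      have := (sq_le_one_iff_abs_le_one (z - z0)).mpr this
      linarith
    apply pow_le_pow_left₀ hlow
    have : ρ ^ 2 ≤ (z - z0) ^ 2 := by
      rcases hz with hz | hz
      · rw [hz0, hρ]; nlinarith
      · rw [hz0, hρ]; nlinarith
    linarith
  · simp only [eval_sub, eval_pow, eval_one, eval_X, eval_C]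
    have hc : Continuous fun z : ℝ => (1 - (z - z0) ^ 2) ^ N := by fun_prop
    rw [intervalIntegral.integral_sub (hc.intervalIntegrable _ _) (by simp)]
    have h1 : ∫ z in (0:ℝ)..1, (1 - ρ ^ 2) ^ N = (1 - ρ ^ 2) ^ N := by simp
    have h2 : ρ * (1 - (ρ / 2) ^ 2) ^ N ≤ ∫ z in (0:ℝ)..1, (1 - (z - z0) ^ 2) ^ N := by
      calc ρ * (1 - (ρ / 2) ^ 2) ^ N = ∫ z in (z0 - ρ / 2)..(z0 + ρ / 2), (1 - (ρ / 2) ^ 2) ^ N := by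
            rw [intervalIntegral.integral_const, smul_eq_mul]; ring
        _ ≤ ∫ z in (z0 - ρ / 2)..(z0 + ρ / 2), (1 - (z - z0) ^ 2) ^ N := by
            apply intervalIntegral.integral_mono_on (by linarith) (by simp) (hc.intervalIntegrable _ _)
            intro z hz
            rw [Set.mem_Icc] at hz
            apply pow_le_pow_left₀ hκ'.le
            have : (z - z0) ^ 2 ≤ (ρ / 2) ^ 2 := by
              apply sq_le_sq' <;> linarith [hz.1, hz.2]
            linarith
        _ ≤ _ := by
            apply intervalIntegral.integral_mono_interval
            · rw [hz0, hρ]; linarith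
            · linarith
            · rw [hz0, hρ]; linarith
            · filter_upwards [MeasureTheory.ae_restrict_mem measurableSet_Ioc] with z hz
              rw [Set.mem_Ioc] at hz
              apply pow_nonneg
              have : |z - z0| ≤ 1 := by rw [abs_le]; constructor <;> rw [hz0] <;> linarith [hz.1, hz.2]
              have := (sq_le_one_iff_abs_le_one (z - z0)).mpr this
              linarith
            · exact hc.intervalIntegrable _ _
    rw [h1]
    linarith

theorem psi_lower (η : ℝ) (h0 : 0 < η) (h1 : η < 1) : ∃ c : ℝ, 0 < c ∧ ∀ᶠ x : ℕ in atTop,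
    c * (x:ℝ) ^ (1 - η) * Real.log x ≤ ∑ n ∈ Finset.Ioc 0 x, rr n := by
  obtain ⟨P, hP, hI⟩ := bump (Real.exp (-1)) (Real.exp (-(1 - η))) (Real.exp_pos _)
    (Real.exp_lt_exp.mpr (by linarith)) (by rw [Real.exp_lt_one_iff]; linarith)
  set I := ∫ z in (0:ℝ)..1, P.eval z with hIdef
  obtain ⟨M0, hM0⟩ := (isCompact_Icc (a := (0:ℝ)) (b := 1)).bddAbove_image P.continuous.continuousOn
  have hM : ∀ z : ℝ, 0 ≤ z → z ≤ 1 → P.eval z ≤ max M0 1 := by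
    intro z a b
    exact (hM0 ⟨z, ⟨a, b⟩, rfl⟩).trans (le_max_left _ _)
  set M := max M0 1
  have hM1 : 0 < M := lt_of_lt_of_le one_pos (le_max_right _ _)
  refine ⟨I / (16 * M), by positivity, ?_⟩
  have hσ : Tendsto (fun x : ℕ => (Real.log x)⁻¹) atTop (𝓝[>] 0) :=
    tendsto_inv_atTop_nhdsGT_zero.comp (Real.tendsto_log_atTop.comp tendsto_natCast_atTop_atTop)
  have hk := (karamata P).2.comp hσ
  have hlt : 1 / 16 * I < 1 / 8 * I := by linarith
  filter_upwards [hk.eventually_const_lt hlt, eventually_ge_atTop 3] with x hx hx3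
  simp only [Function.comp] at hx
  have hxr : (3:ℝ) ≤ x := by exact_mod_cast hx3
  have hx0 : (0:ℝ) < x := by linarith
  have hL : 0 < Real.log x := Real.log_pos (by linarith)
  have hsum := (karamata P).1 (Real.log x)⁻¹ (by positivity)
  set σ := (Real.log x)⁻¹ with hσd
  have hS : ∑' n : ℕ, rr n / n * ((n:ℝ) ^ (-σ) * P.eval ((n:ℝ) ^ (-σ))) ≤
      ∑ n ∈ Finset.Ioc 0 x, rr n * (M / (x:ℝ) ^ (1 - η)) := by
    have e : ∑ n ∈ Finset.Ioc 0 x, rr n * (M / (x:ℝ) ^ (1 - η)) =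
        ∑' n : ℕ, if n ∈ Finset.Ioc 0 x then rr n * (M / (x:ℝ) ^ (1 - η)) else 0 := by
      rw [tsum_eq_sum (s := Finset.Ioc 0 x)]
      · apply Finset.sum_congr rfl
        intro n hn; rw [if_pos hn]
      · intro n hn; rw [if_neg hn]
    rw [e]
    refine hsum.tsum_le_tsum (fun n => ?_) ?_
    · rcases Nat.eq_zero_or_pos n with rfl | hn
      · simp [rr_zero]
      have hn' : (0:ℝ) < n := by exact_mod_cast hn
      have hn1 : (1:ℝ) ≤ n := by exact_mod_cast hn
      have hz : (n:ℝ) ^ (-σ) = Real.exp (-(Real.log n / Real.log x)) := by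
        rw [Real.rpow_def_of_pos hn', hσd]; congr 1; field_simp
      have hz0 : 0 < (n:ℝ) ^ (-σ) := by positivity
      have hz1 : (n:ℝ) ^ (-σ) ≤ 1 := by
        rw [hz, Real.exp_le_one_iff]
        have := Real.log_nonneg hn1
        have : 0 ≤ Real.log n / Real.log x := by positivity
        linarith
      have hr := rr_nonneg n
      have hR : 0 ≤ if n ∈ Finset.Ioc 0 x then rr n * (M / (x:ℝ) ^ (1 - η)) else 0 := by
        split_ifs <;> positivity
      by_cases hcase : (n:ℝ) ^ (-σ) ≤ Real.exp (-1) ∨ Real.exp (-(1 - η)) ≤ (n:ℝ) ^ (-σ)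
      · refine le_trans ?_ hR
        have := hP _ hz0.le hz1 hcase
        apply mul_nonpos_of_nonneg_of_nonpos (by positivity)
        exact mul_nonpos_of_nonneg_of_nonpos hz0.le this
      · push Not at hcase
        obtain ⟨c1, c2⟩ := hcase
        rw [hz, Real.exp_lt_exp] at c1 c2
        have d1 : Real.log n < Real.log x := by
          have : Real.log n / Real.log x < 1 := by linarith
          rwa [div_lt_one hL] at this
        have d2 : (1 - η) * Real.log x < Real.log n := by
          have : 1 - η < Real.log n / Real.log x := by linarith
          rwa [lt_div_iff₀ hL] at this
        have f1 : n ≤ x := by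
          have := (Real.log_lt_log_iff hn' hx0).mp d1
          exact_mod_cast this.le
        have f2 : (x:ℝ) ^ (1 - η) ≤ n := by
          rw [← Real.log_rpow hx0] at d2
          exact ((Real.log_lt_log_iff (by positivity) hn').mp d2).le
        rw [if_pos (Finset.mem_Ioc.mpr ⟨hn, f1⟩)]
        have g1 : (n:ℝ) ^ (-σ) * P.eval ((n:ℝ) ^ (-σ)) ≤ M := by
          calc _ ≤ (n:ℝ) ^ (-σ) * M := by gcongr; exact hM _ hz0.le hz1
            _ ≤ 1 * M := by gcongr
            _ = M := one_mul _
        calc _ ≤ rr n / n * M := by gcongr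
          _ ≤ rr n / (x:ℝ) ^ (1 - η) * M := by gcongr
          _ = _ := by ring
    · apply summable_of_ne_finset_zero (s := Finset.Ioc 0 x)
      intro n hn; rw [if_neg hn]
  rw [← Finset.sum_mul] at hS
  have h5 : 1 / 16 * I ≤ σ * ((∑ n ∈ Finset.Ioc 0 x, rr n) * (M / (x:ℝ) ^ (1 - η))) :=
    hx.le.trans (mul_le_mul_of_nonneg_left hS (by positivity))
  have hX : 0 < (x:ℝ) ^ (1 - η) := by positivity
  have e6 : σ * ((∑ n ∈ Finset.Ioc 0 x, rr n) * (M / (x:ℝ) ^ (1 - η))) =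
      (∑ n ∈ Finset.Ioc 0 x, rr n) * M / ((x:ℝ) ^ (1 - η) * Real.log x) := by
    rw [hσd]; field_simp
  rw [e6, le_div_iff₀ (by positivity)] at h5
  rw [div_mul_eq_mul_div, div_mul_eq_mul_div, div_le_iff₀ (by positivity)]
  linarith

theorem pi_lower (η : ℝ) (h0 : 0 < η) (h1 : η < 1) : ∃ c : ℝ, 0 < c ∧ ∀ᶠ x : ℕ in atTop,
    c * (x:ℝ) ^ (1 - η) - 2 * √(x:ℝ) ≤ ((Finset.Ioc 0 x).filter (fun n => n.Prime ∧ n % 16 = 15)).card := by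
  obtain ⟨c, hc, h⟩ := psi_lower η h0 h1
  refine ⟨c, hc, ?_⟩
  filter_upwards [h, eventually_ge_atTop 3] with x hx hx3
  have hxr : (3:ℝ) ≤ x := by exact_mod_cast hx3
  have hL : 0 < Real.log x := Real.log_pos (by linarith)
  have hb : ∑ n ∈ Finset.Ioc 0 x, rr n ≤
      ((Finset.Ioc 0 x).filter (fun n => n.Prime ∧ n % 16 = 15)).card * Real.log x + 2 * √(x:ℝ) * Real.log x := by
    calc _ ≤ ∑ n ∈ Finset.Ioc 0 x, ((if n.Prime ∧ n % 16 = 15 then Real.log x else 0) + if n.Prime then 0 else Lam n) := by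
          apply Finset.sum_le_sum
          intro n hn
          rw [Finset.mem_Ioc] at hn
          have hn' : (0:ℝ) < n := by exact_mod_cast hn.1
          rw [rr_eq]
          have hl : ArithmeticFunction.vonMangoldt n ≤ Real.log x :=
            ArithmeticFunction.vonMangoldt_le_log.trans (Real.log_le_log hn' (by exact_mod_cast hn.2))
          have h0 := Lam_nonneg n
          by_cases a : n % 16 = 15 <;> by_cases b : n.Prime <;> simp [a, b, hl, h0, hL.le]
          exact le_rfl
      _ = _ := by
          rw [Finset.sum_add_distrib, ← Finset.sum_filter, Finset.sum_const, nsmul_eq_mul]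
      _ ≤ _ := by
          gcongr
          exact nonprime_sum x (by omega)
  have := hx.trans hb
  rw [← add_mul] at this
  have := le_of_mul_le_mul_right this hL
  linarith

end QSpin

namespace QSpin
open Filter Topology

theorem final (Q : ℕ → Prop) [DecidablePred Q]
    (hQ : ∀ p : ℕ, p.Prime → p % 16 = 15 → (Q p ↔ Aa p = -2)) :
    Tendsto (fun x : ℕ =>
      (((Finset.Ioc 0 x).filter (fun n => (n.Prime ∧ n % 16 = 15) ∧ Q n)).card : ℝ) /
      (((Finset.Ioc 0 x).filter (fun n => n.Prime ∧ n % 16 = 15)).card : ℝ)) atTop (𝓝 (1 / 2)) := by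
  obtain ⟨C, hC, hA⟩ := primeA_pow
  obtain ⟨c, hc, hN⟩ := pi_lower (1 / 9000) (by norm_num) (by norm_num)
  set N : ℕ → ℝ := fun x => (((Finset.Ioc 0 x).filter (fun n => n.Prime ∧ n % 16 = 15)).card : ℝ) with hNd
  set A : ℕ → ℝ := fun x => (((Finset.Ioc 0 x).filter (fun n => (n.Prime ∧ n % 16 = 15) ∧ Q n)).card : ℝ) with hAd
  have key : ∀ x, |N x - 2 * A x| ≤ C * (x:ℝ) ^ (1 - 1/8000 : ℝ) := by
    intro x
    have e : ∑ n ∈ Finset.Ioc 0 x, (if n.Prime then ((Aa n : ℤ):ℝ) else 0) = 2 * (N x - 2 * A x) := by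
      simp only [hNd, hAd]
      rw [Finset.card_filter, Finset.card_filter]
      push_cast
      rw [Finset.mul_sum, ← Finset.sum_sub_distrib, Finset.mul_sum]
      apply Finset.sum_congr rfl
      intro n _
      by_cases hp : n.Prime
      · by_cases h15 : n % 16 = 15
        · obtain ⟨s, hs, hAa, -⟩ := Aa_prime hp h15
          have hq := hQ n hp h15
          rcases hs with rfl | rfl
          · have : ¬ Q n := by rw [hq, hAa]; norm_num
            simp [hp, h15, this, hAa]
          · have : Q n := by rw [hq, hAa]; norm_num
            simp [hp, h15, this, hAa]; norm_num
        · have : Aa n = 0 := by unfold Aa; rw [if_neg h15]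
          simp [h15, this]
      · simp [hp]
    have h := hA x
    rw [e, abs_mul, abs_two] at h
    linarith [abs_nonneg (N x - 2 * A x)]
  have hev : ∀ᶠ x : ℕ in atTop, c / 2 * (x:ℝ) ^ (1 - 1/9000 : ℝ) ≤ N x := by
    have ht : Tendsto (fun x : ℕ => (x:ℝ) ^ (1/2 - 1/9000 : ℝ)) atTop atTop :=
      (tendsto_rpow_atTop (by norm_num)).comp tendsto_natCast_atTop_atTop
    filter_upwards [hN, ht.eventually_ge_atTop (4 / c), eventually_ge_atTop 1] with x hx h4 h1
    have hx0 : (0:ℝ) < x := by exact_mod_cast h1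
    refine le_trans ?_ hx
    have e : (x:ℝ) ^ (1 - 1/9000 : ℝ) = (x:ℝ) ^ (1/2 - 1/9000 : ℝ) * √(x:ℝ) := by
      rw [Real.sqrt_eq_rpow, ← Real.rpow_add hx0]; norm_num
    rw [e]
    rw [div_le_iff₀ hc] at h4
    nlinarith [Real.sqrt_nonneg (x:ℝ)]
  have hlim : Tendsto (fun x : ℕ => C / c * (x:ℝ) ^ (-(1/8000 - 1/9000) : ℝ)) atTop (𝓝 0) := by
    have := ((tendsto_rpow_neg_atTop (y := (1/8000 - 1/9000 : ℝ)) (by norm_num)).comp tendsto_natCast_atTop_atTop).const_mul (C / c)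
    rw [mul_zero] at this
    exact this
  rw [tendsto_iff_norm_sub_tendsto_zero]
  refine squeeze_zero' (Eventually.of_forall fun _ => norm_nonneg _) ?_ hlim
  filter_upwards [hev, eventually_ge_atTop 1] with x hx h1
  have hx0 : (0:ℝ) < x := by exact_mod_cast h1
  have hNp : 0 < N x := lt_of_lt_of_le (by positivity) hx
  have e : A x / N x - 1 / 2 = -(N x - 2 * A x) / (2 * N x) := by field_simp; ring
  rw [e, Real.norm_eq_abs, abs_div, abs_neg, abs_of_pos (show 0 < 2 * N x by positivity), div_le_iff₀ (by positivity)]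
  refine (key x).trans ?_
  calc C * (x:ℝ) ^ (1 - 1/8000 : ℝ) = C / c * (x:ℝ) ^ (-(1/8000 - 1/9000) : ℝ) * (2 * (c / 2 * (x:ℝ) ^ (1 - 1/9000 : ℝ))) := by
        have : (x:ℝ) ^ (1 - 1/8000 : ℝ) = (x:ℝ) ^ (-(1/8000 - 1/9000) : ℝ) * (x:ℝ) ^ (1 - 1/9000 : ℝ) := by
          rw [← Real.rpow_add hx0]; norm_num
        rw [this]; field_simp
    _ ≤ _ := by gcongr

end QSpin

open Polynomial NumberField Filter
/-- Assume that for every prime `p ≡ -1 (mod 16)` one has `4 ∥ h_K` iff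
`(p) = -1`, where `K = ℚ(⁴√p)` and `(p)` is the Jacobi symbol `(2u/v)` for any positive
integers `u, v` with `p = u² - 2v²`. Then the primes `p ≡ -1 (mod 16)` with `4 ∥ h_K`
have relative density `1/2` among the primes `p ≡ -1 (mod 16)`. Here `h : ℕ → ℕ` encodes
`p ↦ h_{ℚ(⁴√p)}`. -/
theorem density_four_exactly_divides_classNumber_of_conjecture
    (h : ℕ → ℕ)
    (hclass : ∀ p : ℕ, p.Prime → p % 16 = 15 →
      ∀ (K : Type) [Field K] [NumberField K],
        Nonempty (K ≃ₐ[ℚ] AdjoinRoot (X ^ 4 - C (p : ℚ))) → h p = classNumber K)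
    (conj : ∀ p : ℕ, p.Prime → p % 16 = 15 →
      ((4 ∣ h p ∧ ¬ 8 ∣ h p) ↔
        ∀ u v : ℕ, 0 < u → 0 < v → (p : ℤ) = u ^ 2 - 2 * v ^ 2 →
          jacobiSym (2 * u) v = -1)) :
    Tendsto
      (fun X : ℕ =>
        (Nat.card {p : ℕ | p ≤ X ∧ p.Prime ∧ p % 16 = 15 ∧ 4 ∣ h p ∧ ¬ 8 ∣ h p} : ℝ) /
          (Nat.card {p : ℕ | p ≤ X ∧ p.Prime ∧ p % 16 = 15} : ℝ))
      atTop (nhds (1 / 2)) := by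
  have key := QSpin.final (fun p => 4 ∣ h p ∧ ¬ 8 ∣ h p) (by
    intro p hp h15
    rw [conj p hp h15]
    obtain ⟨s, hs, hAa, ⟨u, v, hu, hv, huv⟩, hall⟩ := QSpin.Aa_prime hp h15
    constructor
    · intro H
      have h1 := H u v hu hv huv
      have h2 := hall u v hu hv huv
      rw [hAa]
      have : s = -1 := by rw [← h2, h1]
      rw [this]; norm_num
    · intro H u v hu hv huv
      rw [hall u v hu hv huv]
      omega)
  refine key.congr fun x => ?_
  congr 2
  · rw [Nat.card_coe_set_eq, ← Set.ncard_coe_finset]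
    congr 1
    ext p
    simp only [Finset.coe_filter, Finset.mem_Ioc, Set.mem_ofPred_eq]
    constructor
    · rintro ⟨⟨-, a⟩, ⟨b, c⟩, d⟩; exact ⟨a, b, c, d⟩
    · rintro ⟨a, b, c, d⟩; exact ⟨⟨b.pos, a⟩, ⟨b, c⟩, d⟩
  · rw [Nat.card_coe_set_eq, ← Set.ncard_coe_finset]
    congr 1
    ext p
    simp only [Finset.coe_filter, Finset.mem_Ioc, Set.mem_ofPred_eq]
    constructor
    · rintro ⟨⟨-, a⟩, b, c⟩; exact ⟨a, b, c⟩
    · rintro ⟨a, b, c⟩; exact ⟨⟨b.pos, a⟩, b, c⟩
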